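/- arXiv:1709.02424 — 2 statements merged into one kernel-verified Lean document; each statement's English description precedes it below -/
import Mathlib

section
/- Let S ⊆ ℝⁿ (n ≥ 2) be a centrally symmetric convex body of class C²₊ (C² boundary with everywhere strictly positive Gauss curvature). Then liminf_{δ→0} (d_S(δ) − 1)/δ^{2/(n+1)} ≥ G_max − G_min. -/
open MeasureTheory Metric Set Filter
open scoped RealInnerProductSpace Pointwise Topology

noncomputable section

abbrev Euc (n : ℕ) : Type := EuclideanSpace ℝ (Fin n)

/-- A centrally symmetric convex body in `ℝⁿ`. -/
def IsSymConvexBody {n : ℕ} (S : Set (Euc n)) : Prop :=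
  IsCompact S ∧ Convex ℝ S ∧ (interior S).Nonempty ∧ S = -S

/-- The convex floating body `K_δ`: the intersection of all closed halfspaces whose bounding
hyperplane cuts off a set of volume at most `δ·|K|ₙ` from `K`. -/
def floatingBody {n : ℕ} (K : Set (Euc n)) (δ : ℝ) : Set (Euc n) :=
  ⋂ (v : Euc n) (_ : v ≠ 0) (c : ℝ)
    (_ : volume (K ∩ {y | c ≤ ⟪v, y⟫}) ≤ ENNReal.ofReal δ * volume K),
    {y | ⟪v, y⟫ ≤ c}

/-- The illumination body `K^δ`. -/
def illuminationBody {n : ℕ} (K : Set (Euc n)) (δ : ℝ) : Set (Euc n) :=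
  {x | volume (convexHull ℝ (K ∪ {x})) ≤ ENNReal.ofReal (1 + δ) * volume K}

/-- The polar body `K°`. -/
def polarBody {n : ℕ} (K : Set (Euc n)) : Set (Euc n) :=
  {y | ∀ x ∈ K, ⟪x, y⟫ ≤ 1}

/-- The distance `d(C₁, C₂) = inf {a ≥ 1 : a⁻¹ C₁ ⊆ C₂ ⊆ a C₁}`. -/
def bodyDist {n : ℕ} (C₁ C₂ : Set (Euc n)) : ℝ :=
  sInf {a : ℝ | 1 ≤ a ∧ a⁻¹ • C₁ ⊆ C₂ ∧ C₂ ⊆ a • C₁}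

/-- `d_C(δ) = inf_{δ' > 0} d(C_δ, ((C°)^{δ'})°)`. -/
def dualDist {n : ℕ} (C : Set (Euc n)) (δ : ℝ) : ℝ :=
  sInf {r : ℝ | ∃ δ' > (0:ℝ), r = bodyDist (floatingBody C δ)
      (polarBody (illuminationBody (polarBody C) δ'))}

/-- `ν` is an outer unit normal of `S` at `x`. -/
def IsOuterNormalAt {n : ℕ} (S : Set (Euc n)) (x ν : Euc n) : Prop :=
  ‖ν‖ = 1 ∧ ∀ y ∈ S, ⟪y, ν⟫ ≤ ⟪x, ν⟫

/-- Near `x ∈ ∂S`, the boundary of `S` is the graph of a `C²` function `f` over the tangent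
hyperplane at `x` (embedded via a linear isometry `L` orthogonal to the normal `ν`), with
`f 0 = 0` and vanishing derivative at `0`, and `k` is the determinant of the Hessian of `f`
at `0`, i.e. the Gauss curvature of `∂S` at `x`. -/
def IsGaussCurvatureAt {n : ℕ} (S : Set (Euc n)) (x ν : Euc n) (k : ℝ) : Prop :=
  ∃ (L : Euc (n-1) →ₗᵢ[ℝ] Euc n) (f : Euc (n-1) → ℝ) (τ ε : ℝ),
    0 < τ ∧ 0 < ε ∧
    (∀ v, ⟪L v, ν⟫ = 0) ∧
    ContDiffOn ℝ 2 f (ball 0 τ) ∧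
    f 0 = 0 ∧ fderiv ℝ f 0 = 0 ∧
    frontier S ∩ ball x ε
      = {y | ∃ v ∈ ball (0 : Euc (n-1)) τ, y = x + L v - f v • ν} ∩ ball x ε ∧
    k = (Matrix.of fun i j : Fin (n-1) =>
      iteratedFDeriv ℝ 2 f 0 ![EuclideanSpace.single i 1, EuclideanSpace.single j 1]).det

/-- `S` has `C²` boundary, with outer unit normal map `u` and Gauss curvature function `κ`. -/
def IsC2Body {n : ℕ} (S : Set (Euc n)) (u : Euc n → Euc n) (κ : Euc n → ℝ) : Prop :=
  ∀ x ∈ frontier S, IsOuterNormalAt S x (u x) ∧ IsGaussCurvatureAt S x (u x) (κ x)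

/-- The constant `c(K, n) = ((n+1)^{2/(n+1)}/2)·(|K|ₙ/|B₂^{n−1}|_{n−1})^{2/(n+1)}`. -/
def cConst (n : ℕ) (K : Set (Euc n)) : ℝ :=
  ((n + 1 : ℝ) ^ ((2:ℝ)/(n+1)) / 2) *
    ((volume K).toReal / (volume (ball (0 : Euc (n-1)) 1)).toReal) ^ ((2:ℝ)/(n+1))

/-- The function `G_S(x) = c(S,n)·κ(x)^{1/(n+1)} / ⟨x, u(x)⟩`. -/
def Gfun {n : ℕ} (S : Set (Euc n)) (u : Euc n → Euc n) (κ : Euc n → ℝ) (x : Euc n) : ℝ :=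
  cConst n S * (κ x) ^ ((1:ℝ)/(n+1)) / ⟪x, u x⟫

/-! ### Regions between graphs in `ℝᵈ × ℝ` -/

/-- The region between the graphs of `f` and `g` over `s`, graphs included. -/
def closedRegion {α : Type*} (s : Set α) (f g : α → ℝ) : Set (α × ℝ) :=
  {p | p.1 ∈ s ∧ f p.1 ≤ p.2 ∧ p.2 ≤ g p.1}

theorem measurableSet_closedRegion {d : ℕ} {s : Set (Euc d)} {f g : Euc d → ℝ}
    (hs : IsClosed s) (hf : Continuous f) (hg : Continuous g) :
    MeasurableSet (closedRegion s f g) := by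
  apply IsClosed.measurableSet
  exact (hs.preimage continuous_fst).inter
    ((isClosed_le (hf.comp continuous_fst) continuous_snd).inter
      (isClosed_le continuous_snd (hg.comp continuous_fst)))

theorem volume_closedRegion {d : ℕ} {s : Set (Euc d)} {f g : Euc d → ℝ}
    (hs : IsClosed s) (hf : Continuous f) (hg : Continuous g) :
    volume (closedRegion s f g) = ∫⁻ ω in s, ENNReal.ofReal (g ω - f ω) := by
  rw [Measure.volume_eq_prod, Measure.prod_apply (measurableSet_closedRegion hs hf hg),
    ← lintegral_indicator hs.measurableSet]
  congr 1
  ext ω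
  by_cases h : ω ∈ s
  · rw [indicator_of_mem h, ← Real.volume_Icc]
    congr 1
    ext a
    simp [closedRegion, h]
  · rw [indicator_of_notMem h]
    convert! measure_empty (μ := (volume : Measure ℝ))
    ext a
    simp [closedRegion, h]

theorem volume_closedRegion_eq_ofReal {d : ℕ} {s : Set (Euc d)} {f g : Euc d → ℝ}
    (hs : IsCompact s) (hf : Continuous f) (hg : Continuous g) (hfg : ∀ ω ∈ s, f ω ≤ g ω) :
    volume (closedRegion s f g) = ENNReal.ofReal (∫ ω in s, (g ω - f ω)) := by
  rw [volume_closedRegion hs.isClosed hf hg, ofReal_integral_eq_lintegral_ofReal]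
  · exact (hg.sub hf).continuousOn.integrableOn_compact hs
  · rw [EventuallyLE, ae_restrict_iff' hs.measurableSet]
    exact Eventually.of_forall fun ω h => sub_nonneg.2 (hfg ω h)

theorem ofReal_integral_le_volume_closedRegion {d : ℕ} {s : Set (Euc d)} {f g : Euc d → ℝ}
    (hs : IsCompact s) (hf : Continuous f) (hg : Continuous g) :
    ENNReal.ofReal (∫ ω in s, (g ω - f ω)) ≤ volume (closedRegion s f g) := by
  have h1 : IntegrableOn (fun ω => g ω - f ω) s :=
    (hg.sub hf).continuousOn.integrableOn_compact hs
  have h2 : IntegrableOn (fun ω => max (g ω - f ω) 0) s :=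
    ((hg.sub hf).max continuous_const).continuousOn.integrableOn_compact hs
  rw [volume_closedRegion hs.isClosed hf hg]
  calc _ ≤ ENNReal.ofReal (∫ ω in s, max (g ω - f ω) 0) :=
        ENNReal.ofReal_le_ofReal (integral_mono h1 h2 fun ω => le_max_left _ _)
    _ = ∫⁻ ω in s, ENNReal.ofReal (max (g ω - f ω) 0) :=
        ofReal_integral_eq_lintegral_ofReal h2 (Eventually.of_forall fun ω => le_max_right _ _)
    _ = _ := by
        congr 1
        ext ω
        rw [ENNReal.ofReal_max, ENNReal.ofReal_zero, max_eq_left zero_le]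

/-- Normalised volume of a paraboloid cap. -/
def capConst (d : ℕ) : ℝ := (∫ ω in closedBall (0 : Euc d) 1, (1 - ‖ω‖ ^ 2)) / 2

/-- Normalised volume of the gap between a paraboloid and a circumscribed cone. -/
def coneConst (d : ℕ) : ℝ := (∫ ω in closedBall (0 : Euc d) 1, (1 - ‖ω‖) ^ 2) / 2

theorem setIntegral_closedBall_scale {d : ℕ} {R : ℝ} (hR : 0 < R) (f : Euc d → ℝ) :
    ∫ ω in closedBall (0 : Euc d) R, f ω
      = R ^ d * ∫ ω in closedBall (0 : Euc d) 1, f (R • ω) := by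
  rw [Measure.setIntegral_comp_smul_of_pos _ _ _ hR, _root_.smul_closedBall _ _ zero_le_one]
  simp only [finrank_euclideanSpace, Fintype.card_fin, smul_zero, Real.norm_eq_abs, abs_of_pos hR,
    mul_one, smul_eq_mul]
  field_simp

theorem setIntegral_closedBall_cap {d : ℕ} {R : ℝ} (hR : 0 < R) :
    ∫ ω in closedBall (0 : Euc d) R, (R ^ 2 - ‖ω‖ ^ 2) = 2 * capConst d * R ^ (d + 2) := by
  rw [setIntegral_closedBall_scale hR, capConst]
  have : ∀ ω : Euc d, R ^ 2 - ‖R • ω‖ ^ 2 = R ^ 2 * (1 - ‖ω‖ ^ 2) := fun ω => by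
    rw [norm_smul, Real.norm_eq_abs, abs_of_pos hR]; ring
  simp_rw [this, integral_const_mul]
  ring

theorem setIntegral_closedBall_cone {d : ℕ} {R : ℝ} (hR : 0 < R) (v : Euc d) :
    ∫ ω in closedBall v R, (R - ‖ω - v‖) ^ 2 = 2 * coneConst d * R ^ (d + 2) := by
  have h0 : ∫ ω in closedBall v R, (R - ‖ω - v‖) ^ 2
      = ∫ ω in closedBall (0 : Euc d) R, (R - ‖ω‖) ^ 2 := by
    rw [← integral_indicator isClosed_closedBall.measurableSet,
      ← integral_indicator isClosed_closedBall.measurableSet]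
    refine (integral_add_right_eq_self (μ := volume) _ v).symm.trans ?_
    congr 1
    ext ω
    simp [indicator, dist_eq_norm]
  rw [h0, setIntegral_closedBall_scale hR, coneConst]
  have : ∀ ω : Euc d, (R - ‖R • ω‖) ^ 2 = R ^ 2 * (1 - ‖ω‖) ^ 2 := fun ω => by
    rw [norm_smul, Real.norm_eq_abs, abs_of_pos hR]; ring
  simp_rw [this, integral_const_mul]
  ring

theorem setIntegral_closedBall_const {d : ℕ} {R : ℝ} (hR : 0 ≤ R) (v : Euc d) (c : ℝ) :
    ∫ _ω in closedBall v R, c = c * R ^ d * volume.real (ball (0 : Euc d) 1) := by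
  rw [setIntegral_const, smul_eq_mul, measureReal_def, Measure.addHaar_closedBall _ _ hR,
    ENNReal.toReal_mul, ENNReal.toReal_ofReal (by positivity)]
  simp [measureReal_def]
  ring

theorem coneConst_pos (d : ℕ) : 0 < coneConst d := by
  apply div_pos _ two_pos
  rw [setIntegral_pos_iff_support_of_nonneg_ae]
  · refine (measure_ball_pos volume (0 : Euc d) one_pos).trans_le (measure_mono fun ω h => ?_)
    rw [mem_ball_zero_iff] at h
    exact ⟨by simp only [Function.mem_support]; exact (pow_pos (by linarith) 2).ne',
      by simpa using h.le⟩
  · exact Eventually.of_forall fun ω => sq_nonneg _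
  · exact (by fun_prop : Continuous fun ω : Euc d => (1 - ‖ω‖) ^ 2).continuousOn.integrableOn_compact
      (isCompact_closedBall _ _)

theorem capConst_eq {d : ℕ} (hd : 1 ≤ d) :
    capConst d = volume.real (ball (0 : Euc d) 1) / (d + 2) := by
  have : Nontrivial (Euc d) := by
    have : Nonempty (Fin d) := ⟨⟨0, hd⟩⟩
    infer_instance
  have h := integral_fun_norm_addHaar (volume : Measure (Euc d))
    (fun r => (Iic (1:ℝ)).indicator (fun r : ℝ => 1 - r ^ 2) r)
  have h1 : ∫ ω in closedBall (0 : Euc d) 1, (1 - ‖ω‖ ^ 2) =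
      ∫ ω : Euc d, (Iic (1:ℝ)).indicator (fun r : ℝ => 1 - r ^ 2) ‖ω‖ := by
    rw [← integral_indicator isClosed_closedBall.measurableSet]
    congr 1
    ext ω
    simp [indicator]
  have h2 : ∫ y in Ioi (0:ℝ), (y ^ (Module.finrank ℝ (Euc d) - 1) : ℝ) •
      (Iic (1:ℝ)).indicator (fun r : ℝ => 1 - r ^ 2) y = 1 / (d : ℝ) - 1 / ((d : ℝ) + 2) := by
    have : ∀ y : ℝ, (y ^ (Module.finrank ℝ (Euc d) - 1) : ℝ) • (Iic (1:ℝ)).indicator (fun r : ℝ => 1 - r ^ 2) y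
        = (Iic (1:ℝ)).indicator (fun r => r ^ (d - 1) - r ^ (d + 1)) y := fun y => by
      obtain ⟨e, rfl⟩ : ∃ e, d = e + 1 := ⟨d - 1, by omega⟩
      by_cases hy : y ∈ Iic (1:ℝ)
      · rw [indicator_of_mem hy, indicator_of_mem hy]
        simp
        ring
      · rw [indicator_of_notMem hy, indicator_of_notMem hy]; simp
    simp_rw [this]
    rw [setIntegral_indicator measurableSet_Iic, Ioi_inter_Iic,
      ← intervalIntegral.integral_of_le zero_le_one, intervalIntegral.integral_sub
        (by apply Continuous.intervalIntegrable; fun_prop)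
        (by apply Continuous.intervalIntegrable; fun_prop), integral_pow, integral_pow]
    obtain ⟨e, rfl⟩ : ∃ e, d = e + 1 := ⟨d - 1, by omega⟩
    simp
    ring
  have hd' : (d : ℝ) ≠ 0 := by positivity
  rw [capConst, h1, h, h2]
  simp only [finrank_euclideanSpace, Fintype.card_fin, nsmul_eq_mul, smul_eq_mul]
  field_simp
  ring

theorem capConst_pos {d : ℕ} (hd : 1 ≤ d) : 0 < capConst d := by
  rw [capConst_eq hd]
  have : 0 < volume.real (ball (0 : Euc d) 1) :=
    ENNReal.toReal_pos (measure_ball_pos volume _ one_pos).ne' measure_ball_lt_top.ne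
  positivity

/-- A set that contains at least one of each pair of points symmetric about `z` contains at least
half of every set symmetric about `z`. -/
theorem measure_le_two_mul_of_symmetric {V : Type*} [AddCommGroup V] [MeasurableSpace V]
    [MeasurableAdd₂ V] [MeasurableNeg V] (μ : Measure V) [μ.IsAddLeftInvariant] [μ.IsNegInvariant]
    {B H : Set V} {z : V} (hB : ∀ p ∈ B, z + z - p ∈ B)
    (hH : ∀ p, p ∈ H ∨ z + z - p ∈ H) : μ B ≤ 2 * μ (B ∩ H) := by
  have h1 : B ⊆ (B ∩ H) ∪ (fun p => z + z - p) ⁻¹' (B ∩ H) := fun p hp =>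
    (hH p).elim (fun h => Or.inl ⟨hp, h⟩) fun h => Or.inr ⟨hB p hp, h⟩
  have h2 : μ ((fun p => z + z - p) ⁻¹' (B ∩ H)) = μ (B ∩ H) := by
    have : (fun p => z + z - p) ⁻¹' (B ∩ H) = -((fun p => z + z + p) ⁻¹' (B ∩ H)) := by
      ext p; simp [sub_eq_add_neg]
    rw [this, Measure.measure_neg, measure_preimage_add]
  calc μ B ≤ _ := measure_mono h1
    _ ≤ _ := measure_union_le _ _
    _ = _ := by rw [h2, two_mul]

instance isAddHaarMeasure_volume_prod {d : ℕ} :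
    (volume : Measure (Euc d × ℝ)).IsAddHaarMeasure :=
  inferInstanceAs (Measure.prod (volume : Measure (Euc d)) (volume : Measure ℝ)).IsAddHaarMeasure

/-! ### Convex sets osculated by a paraboloid -/

/-- `K` lies above the hyperplane `p.2 = 0`, touches it at the origin, and is approximated there to
second order by the paraboloid `{p | ‖p.1‖² / 2 ≤ p.2}`. -/
structure Osculates {d : ℕ} (K : Set (Euc d × ℝ)) : Prop where
  convex : Convex ℝ K
  isClosed : IsClosed K
  zero_mem : ((0 : Euc d), (0 : ℝ)) ∈ K
  nonneg : ∀ p ∈ K, 0 ≤ p.2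
  le_two : ∀ p ∈ K, p.2 ≤ 2
  center : ∃ r > 0, ∀ ω : Euc d, ‖ω‖ < r → (ω, (1 : ℝ)) ∈ K
  inner : ∀ ε > 0, ∃ ρ > 0, ∀ (ω : Euc d) (a : ℝ), ‖ω‖ < ρ → a < ρ →
    (1 + ε) * ‖ω‖ ^ 2 / 2 ≤ a → (ω, a) ∈ K
  outer : ∀ ε > 0, ∃ ρ > 0, ∀ (ω : Euc d) (a : ℝ), ‖ω‖ < ρ → a < ρ →
    (ω, a) ∈ K → (1 - ε) * ‖ω‖ ^ 2 / 2 ≤ a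

theorem Convex.mem_of_vertical {d : ℕ} {K : Set (Euc d × ℝ)} (hK : Convex ℝ K) {ω : Euc d}
    {a b c : ℝ} (ha : (ω, a) ∈ K) (hc : (ω, c) ∈ K) (hab : a ≤ b) (hbc : b ≤ c) :
    (ω, b) ∈ K := by
  rcases eq_or_lt_of_le (hab.trans hbc) with h | h
  · rwa [show b = a by linarith]
  · have hca : c - a ≠ 0 := by linarith
    have := hK ha hc (a := (c - b) / (c - a)) (b := (b - a) / (c - a))
      (div_nonneg (by linarith) (by linarith)) (div_nonneg (by linarith) (by linarith))
      (by field_simp; ring)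
    convert! this using 1
    ext1
    · simp only [Prod.smul_mk, Prod.mk_add_mk, ← add_smul]
      rw [show (c - b) / (c - a) + (b - a) / (c - a) = 1 by field_simp; ring, one_smul]
    · simp only [Prod.smul_mk, Prod.mk_add_mk, smul_eq_mul]
      field_simp
      ring

theorem Convex.mem_of_between {V : Type*} [AddCommGroup V] [Module ℝ V] {K : Set V}
    (hK : Convex ℝ K) {k q : V} {σ t : ℝ} (hk : k ∈ K) (h : σ • k + (1 - σ) • q ∈ K)
    (hσt : σ ≤ t) (ht : t ≤ 1) (hσ : σ < 1) : t • k + (1 - t) • q ∈ K := by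
  have h1 : 1 - σ ≠ 0 := by linarith
  have := hK hk h (a := (t - σ) / (1 - σ)) (b := (1 - t) / (1 - σ))
    (div_nonneg (by linarith) (by linarith)) (div_nonneg (by linarith) (by linarith))
    (by field_simp; ring)
  convert! this using 1
  rw [smul_add, smul_smul, smul_smul, ← add_assoc, ← add_smul]
  congr 2 <;> · field_simp; try ring

theorem exists_pos_lt_of_continuousAt {F : ℝ → ℝ} {c : ℝ} (hF : ContinuousAt F 0) (h : F 0 < c) :
    ∃ ε, 0 < ε ∧ ε < 1 / 2 ∧ F ε < c := by
  have h1 : ∀ᶠ ε in 𝓝[>] (0:ℝ), F ε < c :=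
    (hF.eventually (gt_mem_nhds h)).filter_mono nhdsWithin_le_nhds
  have h2 : ∀ᶠ ε in 𝓝[>] (0:ℝ), ε ∈ Ioo (0:ℝ) (1 / 2) :=
    Ioo_mem_nhdsGT (by norm_num)
  obtain ⟨ε, h3, h4⟩ := (h1.and h2).exists
  exact ⟨ε, h4.1, h4.2, h3⟩

theorem sqrt_div_pow {t c : ℝ} (ht : 0 ≤ t) (m : ℕ) :
    √(t / c) ^ m = √t ^ m * (√c)⁻¹ ^ m := by
  rw [Real.sqrt_div ht, div_eq_mul_inv, mul_pow]

namespace Osculates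

variable {d : ℕ} {K : Set (Euc d × ℝ)}

theorem outer_global (hK : Osculates K) {ε : ℝ} (hε : 0 < ε) (hε1 : ε < 1) :
    ∃ r > 0, ∀ p ∈ K, (1 - ε) * (‖p.1‖ * min ‖p.1‖ r) / 2 ≤ p.2 := by
  obtain ⟨ρ, hρ, h⟩ := hK.outer ε hε
  set r := min (ρ / 2) 1 with hr
  have hr0 : 0 < r := by positivity
  have hr1 : r ≤ 1 := min_le_right _ _
  have hrρ : r ≤ ρ / 2 := min_le_left _ _
  have key : ∀ p ∈ K, ‖p.1‖ ≤ r → (1 - ε) * ‖p.1‖ ^ 2 / 2 ≤ p.2 := by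
    intro p hp hpr
    by_cases hpρ : p.2 < ρ
    · exact h p.1 p.2 (by linarith) hpρ hp
    · have : ‖p.1‖ ^ 2 ≤ 1 * ρ := by nlinarith [norm_nonneg p.1]
      nlinarith [sq_nonneg ‖p.1‖]
  refine ⟨r, hr0, fun p hp => ?_⟩
  rcases le_or_gt ‖p.1‖ r with hpr | hpr
  · rw [min_eq_left hpr]
    convert! key p hp hpr using 1
    ring
  · rw [min_eq_right hpr.le]
    have hp0 : 0 < ‖p.1‖ := hr0.trans hpr
    have hmem : (r / ‖p.1‖) • p ∈ K :=
      hK.convex.smul_mem_of_zero_mem hK.zero_mem hp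
        ⟨by positivity, (div_le_one hp0).2 hpr.le⟩
    have hn : ‖((r / ‖p.1‖) • p).1‖ = r := by
      rw [Prod.smul_fst, norm_smul, Real.norm_eq_abs, abs_of_pos (by positivity)]
      field_simp
    have := key _ hmem hn.le
    rw [hn, Prod.smul_snd, smul_eq_mul, div_mul_eq_mul_div, le_div_iff₀ hp0] at this
    nlinarith

theorem inner_global (hK : Osculates K) {ε : ℝ} (hε : 0 < ε) :
    ∃ ρ > 0, ∀ (ω : Euc d) (a : ℝ), ‖ω‖ < ρ → a ≤ 1 → (1 + ε) * ‖ω‖ ^ 2 / 2 ≤ a → (ω, a) ∈ K := by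
  obtain ⟨ρ, hρ, h⟩ := hK.inner ε hε
  obtain ⟨r, hr, hr'⟩ := hK.center
  refine ⟨min (min ρ r) (min 1 (ρ / (1 + ε))), by positivity, fun ω a hω ha hωa => ?_⟩
  simp only [lt_min_iff] at hω
  obtain ⟨⟨h1, h2⟩, h3, h4⟩ := hω
  rw [lt_div_iff₀ (by positivity)] at h4
  refine hK.convex.mem_of_vertical (h ω _ h1 ?_ le_rfl) (hr' ω h2) hωa ha
  nlinarith [norm_nonneg ω]

theorem volume_cap_le (hK : Osculates K) (hd : 1 ≤ d) {η : ℝ} (hη : 0 < η) :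
    ∃ t₀ > 0, ∀ t, 0 < t → t < t₀ →
      volume (K ∩ {p | p.2 ≤ t}) ≤ ENNReal.ofReal ((1 + η) * capConst d * √(2 * t) ^ (d + 2)) := by
  obtain ⟨ε, hε, hε2, hF⟩ := exists_pos_lt_of_continuousAt
    (F := fun ε : ℝ => (1 - ε) * (√(1 - ε))⁻¹ ^ (d + 2)) (c := 1 + η)
    (by
      have : √(1 - (0:ℝ)) ≠ 0 := by simp
      fun_prop (disch := assumption)) (by simpa using hη)
  obtain ⟨r, hr, hout⟩ := hK.outer_global hε (by linarith)
  have hl : 0 < 1 - ε := by linarith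
  refine ⟨(1 - ε) * r ^ 2 / 2, by positivity, fun t ht ht0 => ?_⟩
  set R := √(2 * t / (1 - ε)) with hR
  have hR0 : 0 < R := by positivity
  have hR2 : R ^ 2 = 2 * t / (1 - ε) := Real.sq_sqrt (by positivity)
  have hR2' : (1 - ε) * R ^ 2 = 2 * t := by rw [hR2]; field_simp
  have hsub : K ∩ {p | p.2 ≤ t} ⊆ closedRegion (closedBall 0 R)
      (fun ω => (1 - ε) * ‖ω‖ ^ 2 / 2) (fun _ => t) := by
    rintro p ⟨hp, hpt⟩
    have hpt : p.2 ≤ t := hpt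
    have h1 := hout p hp
    have h2 : ‖p.1‖ ≤ r := by
      by_contra! hc
      rw [min_eq_right hc.le] at h1
      nlinarith [mul_pos hl hr, mul_lt_mul_of_pos_left hc (mul_pos hl hr)]
    rw [min_eq_left h2] at h1
    refine ⟨?_, by linarith [show (1 - ε) * ‖p.1‖ ^ 2 / 2 = (1 - ε) * (‖p.1‖ * ‖p.1‖) / 2 by ring],
      hpt⟩
    rw [mem_closedBall_zero_iff]
    apply abs_le_of_sq_le_sq' _ hR0.le |>.2
    nlinarith
  refine (measure_mono hsub).trans ?_
  rw [volume_closedRegion_eq_ofReal (isCompact_closedBall _ _) (by fun_prop) (by fun_prop)]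
  · apply ENNReal.ofReal_le_ofReal
    have : ∀ ω : Euc d, t - (1 - ε) * ‖ω‖ ^ 2 / 2 = (1 - ε) / 2 * (R ^ 2 - ‖ω‖ ^ 2) := fun ω => by
      linear_combination (-1 / 2) * hR2'
    simp_rw [this, integral_const_mul]
    rw [setIntegral_closedBall_cap hR0, hR, sqrt_div_pow (by positivity)]
    have h1 : 0 < capConst d * √(2 * t) ^ (d + 2) := mul_pos (capConst_pos hd) (by positivity)
    nlinarith [mul_lt_mul_of_pos_left hF h1]
  · intro ω hω
    rw [mem_closedBall_zero_iff] at hω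
    have : ‖ω‖ ^ 2 ≤ R ^ 2 := by gcongr
    nlinarith

theorem le_volume_halfspace (hK : Osculates K) (hd : 1 ≤ d) {η : ℝ} (hη : 0 < η) :
    ∃ t₀ > 0, ∀ t, 0 < t → t < t₀ → ∀ H : Set (Euc d × ℝ),
      (∀ p, p ∈ H ∨ ((0 : Euc d), t) + ((0 : Euc d), t) - p ∈ H) →
      ENNReal.ofReal ((1 - η) * capConst d * √(2 * t) ^ (d + 2)) ≤ volume (K ∩ H) := by
  obtain ⟨ε, hε, hε2, hF⟩ := exists_pos_lt_of_continuousAt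
    (F := fun ε : ℝ => -((1 + ε) * (√(1 + ε))⁻¹ ^ (d + 2))) (c := -(1 - η))
    (by
      have : √(1 + (0:ℝ)) ≠ 0 := by simp
      fun_prop (disch := assumption)) (by simpa using hη)
  obtain ⟨ρ, hρ, hin⟩ := hK.inner_global hε
  have hl : 0 < 1 + ε := by linarith
  refine ⟨min (1 / 2) (ρ ^ 2 / 2), by positivity, fun t ht ht0 H hH => ?_⟩
  rw [lt_min_iff] at ht0
  set R := √(2 * t / (1 + ε)) with hR
  have hR0 : 0 < R := by positivity
  have hR2 : R ^ 2 = 2 * t / (1 + ε) := Real.sq_sqrt (by positivity)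
  have hR2' : (1 + ε) * R ^ 2 = 2 * t := by rw [hR2]; field_simp
  have hRρ : R < ρ := by
    apply lt_of_pow_lt_pow_left₀ 2 hρ.le
    nlinarith
  set B := closedRegion (closedBall (0 : Euc d) R) (fun ω => (1 + ε) * ‖ω‖ ^ 2 / 2)
    (fun ω => 2 * t - (1 + ε) * ‖ω‖ ^ 2 / 2) with hB
  have hBK : B ⊆ K := by
    rintro ⟨ω, a⟩ ⟨h1, h2, h3⟩
    rw [mem_closedBall_zero_iff] at h1
    simp only at h2 h3
    exact hin ω a (h1.trans_lt hRρ) (by nlinarith [sq_nonneg ‖ω‖]) h2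
  have hsym : ∀ p ∈ B, ((0 : Euc d), t) + ((0 : Euc d), t) - p ∈ B := by
    rintro ⟨ω, a⟩ ⟨h1, h2, h3⟩
    simp only at h2 h3
    refine ⟨by simpa using h1, ?_, ?_⟩ <;> simp <;> linarith
  have h2 : volume B = 2 * ENNReal.ofReal ((1 + ε) * capConst d * R ^ (d + 2)) := by
    rw [hB, volume_closedRegion_eq_ofReal (isCompact_closedBall _ _) (by fun_prop) (by fun_prop)]
    · have : ∀ ω : Euc d, 2 * t - (1 + ε) * ‖ω‖ ^ 2 / 2 - (1 + ε) * ‖ω‖ ^ 2 / 2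
          = (1 + ε) * (R ^ 2 - ‖ω‖ ^ 2) := fun ω => by
        linear_combination (-1) * hR2'
      simp_rw [this, integral_const_mul]
      rw [setIntegral_closedBall_cap hR0, ← ENNReal.ofReal_ofNat, ← ENNReal.ofReal_mul (by simp)]
      congr 1
      ring
    · intro ω hω
      rw [mem_closedBall_zero_iff] at hω
      have : ‖ω‖ ^ 2 ≤ R ^ 2 := by gcongr
      nlinarith
  have h3 := measure_le_two_mul_of_symmetric volume hsym hH
  rw [h2, ENNReal.mul_le_mul_iff_right (by simp) (by simp)] at h3
  refine le_trans (ENNReal.ofReal_le_ofReal ?_) (h3.trans (measure_mono (by gcongr)))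
  rw [hR, sqrt_div_pow (by positivity)]
  have h1 : 0 < capConst d * √(2 * t) ^ (d + 2) := mul_pos (capConst_pos hd) (by positivity)
  nlinarith [mul_lt_mul_of_pos_left hF h1]

end Osculates

theorem mem_convexHull_union_singleton_iff {V : Type*} [AddCommGroup V] [Module ℝ V] {K : Set V}
    (hK : Convex ℝ K) (hne : K.Nonempty) {q w : V} :
    w ∈ convexHull ℝ (K ∪ {q}) ↔ ∃ k ∈ K, ∃ t : ℝ, 0 ≤ t ∧ t ≤ 1 ∧ w = t • k + (1 - t) • q := by
  rw [union_singleton, convexHull_insert hne, hK.convexHull_eq, mem_convexJoin]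
  simp only [mem_singleton_iff, exists_eq_left]
  refine exists_congr fun k => and_congr_right fun _ => ⟨?_, ?_⟩
  · rintro ⟨a, b, ha, hb, hab, rfl⟩
    exact ⟨b, hb, by linarith, by rw [show 1 - b = a by linarith, add_comm]⟩
  · rintro ⟨t, h0, h1, rfl⟩
    exact ⟨1 - t, t, by linarith, h0, by ring, add_comm _ _⟩

namespace Osculates

variable {d : ℕ} {K : Set (Euc d × ℝ)}

/-- The part of `conv (K ∪ {(0, -t)})` outside `K` lies near the origin and below the paraboloid
osculating `K` from inside. -/
theorem norm_le_of_mem_convexHull_diff (hK : Osculates K) {ε r ρ t : ℝ}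
    (hε2 : ε < 1 / 2)
    (hout : ∀ p ∈ K, (1 - ε) * (‖p.1‖ * min ‖p.1‖ r) / 2 ≤ p.2)
    (hin : ∀ (ω : Euc d) (a : ℝ), ‖ω‖ < ρ → a ≤ 1 → (1 + ε) * ‖ω‖ ^ 2 / 2 ≤ a → (ω, a) ∈ K)
    (ht : 0 < t) (ht1 : t < 1 / 40) (htr : 7 * √t ≤ r) (htρ : 7 * √t < ρ)
    {w : Euc d × ℝ} (hw : w ∈ convexHull ℝ (K ∪ {((0 : Euc d), -t)})) (hwK : w ∉ K) :
    ‖w.1‖ ≤ 7 * √t ∧ w.2 ≤ (1 + ε) * ‖w.1‖ ^ 2 / 2 := by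
  obtain ⟨k, hk, s, hs0, hs1, rfl⟩ :=
    (mem_convexHull_union_singleton_iff hK.convex ⟨_, hK.zero_mem⟩).1 hw
  have hst : √t ^ 2 = t := Real.sq_sqrt ht.le
  have hst0 : 0 < √t := Real.sqrt_pos.2 ht
  have hw1 : ∀ σ : ℝ, 0 ≤ σ → ‖(σ • k + (1 - σ) • ((0 : Euc d), -t)).1‖ = σ * ‖k.1‖ := by
    intro σ hσ
    simp [norm_smul, abs_of_nonneg hσ]
  have hw2 : ∀ σ : ℝ, (σ • k + (1 - σ) • ((0 : Euc d), -t)).2 = σ * k.2 - (1 - σ) * t := by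
    intro σ
    simp [sub_eq_add_neg]
  have hk0 := hK.nonneg k hk
  have hk2 := hK.le_two k hk
  have h1 : ‖(s • k + (1 - s) • ((0 : Euc d), -t)).1‖ ≤ 7 * √t := by
    by_contra! hc
    rw [hw1 s hs0] at hc
    have hkn : 7 * √t < ‖k.1‖ := by nlinarith [norm_nonneg k.1]
    have hkp : 0 < ‖k.1‖ := by linarith
    have hσ : √t / ‖k.1‖ ≤ 1 / 7 := by
      rw [div_le_iff₀ hkp]; linarith
    have hσ0 : 0 < √t / ‖k.1‖ := by positivity
    have hσk : √t / ‖k.1‖ * ‖k.1‖ = √t := by field_simp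
    set σ := √t / ‖k.1‖
    refine hwK (hK.convex.mem_of_between hk (σ := σ) ?_ ?_ hs1 (by linarith))
    · have hb : (1 - ε) * (√t * (7 * √t)) / 2 ≤ σ * k.2 := by
        have h3 : 7 * √t ≤ min ‖k.1‖ r := le_min hkn.le htr
        have h4 := hout k hk
        have h5 : (1 - ε) * (‖k.1‖ * (7 * √t)) / 2 ≤ k.2 := by
          refine le_trans ?_ h4
          have : 0 ≤ 1 - ε := by linarith
          gcongr
        have h6 := mul_le_mul_of_nonneg_left h5 hσ0.le
        calc _ = (1 - ε) * ((σ * ‖k.1‖) * (7 * √t)) / 2 := by rw [hσk]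
          _ = σ * ((1 - ε) * (‖k.1‖ * (7 * √t)) / 2) := by ring
          _ ≤ _ := h6
      have m1 := hw1 σ hσ0.le
      have m2 := hw2 σ
      rw [hσk] at m1
      set w' := σ • k + (1 - σ) • ((0 : Euc d), -t)
      refine hin w'.1 w'.2 (by rw [m1]; linarith) (by rw [m2]; nlinarith) ?_
      rw [m1, m2]
      nlinarith
    · by_contra! hcc
      nlinarith
  refine ⟨h1, ?_⟩
  by_contra! hc
  rcases le_or_gt (s • k + (1 - s) • ((0 : Euc d), -t)).2 1 with h2 | h2
  · exact hwK (hin _ _ (h1.trans_lt htρ) h2 hc.le)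
  · rw [hw1 s hs0] at h1
    rw [hw2] at h2
    have hkt : 0 < k.2 + t := by linarith
    have hσ : (1 + t) / (k.2 + t) * (k.2 + t) = 1 + t := by field_simp
    have hσ0 : 0 < (1 + t) / (k.2 + t) := by positivity
    set σ := (1 + t) / (k.2 + t)
    have hσs : σ < s := by
      by_contra! hcc
      nlinarith
    refine hwK (hK.convex.mem_of_between hk (σ := σ) ?_ hσs.le hs1 (by linarith))
    have h3 : σ * ‖k.1‖ ≤ 7 * √t := le_trans (by gcongr) h1
    have h4 : (σ • k + (1 - σ) • ((0 : Euc d), -t)).2 = 1 := by rw [hw2]; linarith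
    have m1 := hw1 σ hσ0.le
    set w' := σ • k + (1 - σ) • ((0 : Euc d), -t)
    refine hin w'.1 w'.2 (by rw [m1]; linarith) h4.le ?_
    rw [m1, h4]
    have : (σ * ‖k.1‖) ^ 2 ≤ (7 * √t) ^ 2 := by gcongr
    nlinarith

set_option maxHeartbeats 1000000 in
theorem volume_cone_le (hK : Osculates K) {η : ℝ} (hη : 0 < η) :
    ∃ t₀ > 0, ∀ t, 0 < t → t < t₀ →
      volume (convexHull ℝ (K ∪ {((0 : Euc d), -t)}))
        ≤ volume K + ENNReal.ofReal ((1 + η) * coneConst d * √(2 * t) ^ (d + 2)) := by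
  set V := volume.real (ball (0 : Euc d) 1) with hV
  obtain ⟨ε, hε, hε2, hF⟩ := exists_pos_lt_of_continuousAt
    (F := fun ε : ℝ => ε * (49 * 7 ^ d * V) + (1 - ε) * coneConst d * (√(1 - ε))⁻¹ ^ (d + 2))
    (c := (1 + η) * coneConst d)
    (by
      have : √(1 - (0:ℝ)) ≠ 0 := by simp
      fun_prop (disch := assumption)) (by simpa using by nlinarith [coneConst_pos d])
  obtain ⟨r, hr, hout⟩ := hK.outer_global hε (by linarith)
  obtain ⟨ρ, hρ, hin⟩ := hK.inner_global hε
  have hl : 0 < 1 - ε := by linarith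
  refine ⟨min (1 / 40) (min ((r / 14) ^ 2) ((ρ / 7) ^ 2)), by positivity, fun t ht ht0 => ?_⟩
  simp only [lt_min_iff] at ht0
  obtain ⟨ht1, ht2, ht3⟩ := ht0
  have hst : √t ^ 2 = t := Real.sq_sqrt ht.le
  have hst0 : 0 < √t := Real.sqrt_pos.2 ht
  have htr : √t < r / 14 := (Real.sqrt_lt' (by positivity)).2 ht2
  have htρ : √t < ρ / 7 := (Real.sqrt_lt' (by positivity)).2 ht3
  set R := √(2 * t / (1 - ε)) with hR
  have hR0 : 0 < R := by positivity
  have hR2 : R ^ 2 = 2 * t / (1 - ε) := Real.sq_sqrt (by positivity)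
  have hR2' : (1 - ε) * R ^ 2 = 2 * t := by rw [hR2]; field_simp
  have hRt : R ≤ 2 * √t := by
    apply le_of_sq_le_sq _ (by positivity)
    nlinarith [sq_nonneg R]
  have hsub : convexHull ℝ (K ∪ {((0 : Euc d), -t)}) ⊆ K ∪ closedRegion (closedBall 0 (7 * √t))
      (fun ω => (1 - ε) * ‖ω‖ ^ 2 / 2 - (1 - ε) / 2 * (max (R - ‖ω‖) 0) ^ 2)
      (fun ω => (1 + ε) * ‖ω‖ ^ 2 / 2) := by
    intro w hw
    by_cases hwK : w ∈ K
    · exact Or.inl hwK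
    obtain ⟨h1, h2⟩ := hK.norm_le_of_mem_convexHull_diff hε2 hout hin ht ht1 (by linarith)
      (by linarith) hw hwK
    refine Or.inr ⟨by simpa using h1, ?_, h2⟩
    set s := max R ‖w.1‖ with hs
    have hsR : R ≤ s := le_max_left _ _
    have hsr : s ≤ r / 2 := max_le (by linarith) (by linarith)
    have hlow : (1 - ε) * s * ‖w.1‖ - (1 - ε) * s ^ 2 / 2 ≤ w.2 := by
      obtain ⟨k, hk, θ, hθ0, hθ1, hwk⟩ :=
        (mem_convexHull_union_singleton_iff hK.convex ⟨_, hK.zero_mem⟩).1 hw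
      have e1 : ‖w.1‖ = θ * ‖k.1‖ := by simp [hwk, norm_smul, abs_of_nonneg hθ0]
      have e2 : w.2 = θ * k.2 - (1 - θ) * t := by simp [hwk, sub_eq_add_neg]
      have e3 : (1 - ε) * (s * ‖k.1‖ - s ^ 2 / 2) ≤ k.2 := by
        have h3 := hout k hk
        rw [mul_div_assoc] at h3
        refine le_trans (mul_le_mul_of_nonneg_left ?_ hl.le) h3
        rcases le_or_gt ‖k.1‖ r with h | h
        · rw [min_eq_left h]; nlinarith [sq_nonneg (s - ‖k.1‖)]
        · rw [min_eq_right h.le]; nlinarith [sq_nonneg s, norm_nonneg k.1]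
      have e4 : 2 * t ≤ (1 - ε) * s ^ 2 := by
        rw [← hR2']; gcongr
      rw [e1, e2]
      nlinarith [mul_le_mul_of_nonneg_left e3 hθ0,
        mul_le_mul_of_nonneg_left e4 (sub_nonneg.2 hθ1)]
    show (1 - ε) * ‖w.1‖ ^ 2 / 2 - (1 - ε) / 2 * (max (R - ‖w.1‖) 0) ^ 2 ≤ w.2
    rcases le_or_gt R ‖w.1‖ with h | h
    · rw [hs, max_eq_right h] at hlow
      rw [max_eq_right (by linarith)]
      nlinarith
    · rw [hs, max_eq_left h.le] at hlow
      rw [max_eq_left (by linarith)]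
      nlinarith
  refine (measure_mono hsub).trans ((measure_union_le _ _).trans (add_le_add_right ?_ _))
  rw [volume_closedRegion_eq_ofReal (isCompact_closedBall _ _) (by fun_prop) (by fun_prop)]
  · apply ENNReal.ofReal_le_ofReal
    have hc : IsCompact (closedBall (0 : Euc d) (7 * √t)) := isCompact_closedBall _ _
    have i1 : IntegrableOn (fun ω : Euc d => (1 + ε) * ‖ω‖ ^ 2 / 2 - ((1 - ε) * ‖ω‖ ^ 2 / 2
        - (1 - ε) / 2 * (max (R - ‖ω‖) 0) ^ 2)) (closedBall (0 : Euc d) (7 * √t)) :=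
      Continuous.continuousOn (by fun_prop) |>.integrableOn_compact hc
    have i2 : IntegrableOn (fun _ : Euc d => ε * (7 * √t) ^ 2) (closedBall (0 : Euc d) (7 * √t)) :=
      Continuous.continuousOn (by fun_prop) |>.integrableOn_compact hc
    have i3 : IntegrableOn (fun ω : Euc d => (1 - ε) / 2 * (max (R - ‖ω‖) 0) ^ 2)
        (closedBall (0 : Euc d) (7 * √t)) :=
      Continuous.continuousOn (by fun_prop) |>.integrableOn_compact hc
    have hI : ∫ ω in closedBall (0 : Euc d) (7 * √t), (max (R - ‖ω‖) 0) ^ 2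
        = 2 * coneConst d * R ^ (d + 2) := by
      rw [← setIntegral_closedBall_cone hR0 (0 : Euc d),
        setIntegral_eq_of_subset_of_forall_sdiff_eq_zero (t := closedBall (0 : Euc d) (7 * √t))
          (s := closedBall (0 : Euc d) R) isClosed_closedBall.measurableSet
          (closedBall_subset_closedBall (by linarith))]
      · refine setIntegral_congr_fun isClosed_closedBall.measurableSet fun ω hω => ?_
        rw [mem_closedBall_zero_iff] at hω
        simp only [sub_zero]
        rw [max_eq_left (by linarith)]
      · rintro ω ⟨-, hω⟩
        rw [mem_closedBall_zero_iff, not_le] at hω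
        rw [max_eq_right (by linarith)]
        simp
    calc _ ≤ ∫ ω in closedBall (0 : Euc d) (7 * √t),
          (ε * (7 * √t) ^ 2 + (1 - ε) / 2 * (max (R - ‖ω‖) 0) ^ 2) := by
          refine setIntegral_mono_on i1 (i2.add i3) isClosed_closedBall.measurableSet
            fun ω hω => ?_
          rw [mem_closedBall_zero_iff] at hω
          have : ‖ω‖ ^ 2 ≤ (7 * √t) ^ 2 := by gcongr
          nlinarith
      _ = ε * (7 * √t) ^ 2 * (7 * √t) ^ d * V + (1 - ε) * coneConst d * R ^ (d + 2) := by
          rw [integral_add i2 i3, setIntegral_closedBall_const (by positivity),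
            integral_const_mul, hI]
          ring
      _ = ε * (49 * 7 ^ d * V) * √t ^ (d + 2)
          + (1 - ε) * coneConst d * (√(1 - ε))⁻¹ ^ (d + 2) * √(2 * t) ^ (d + 2) := by
          rw [hR, sqrt_div_pow (by positivity)]
          ring
      _ ≤ ε * (49 * 7 ^ d * V) * √(2 * t) ^ (d + 2)
          + (1 - ε) * coneConst d * (√(1 - ε))⁻¹ ^ (d + 2) * √(2 * t) ^ (d + 2) := by
          have : √t ≤ √(2 * t) := Real.sqrt_le_sqrt (by linarith)
          gcongr
      _ ≤ _ := by
          rw [← add_mul]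
          gcongr
  · intro ω _
    nlinarith [sq_nonneg ‖ω‖, sq_nonneg (max (R - ‖ω‖) 0)]

/-- Points of the cone with apex `(v, μ ‖v‖² / 2 - μ R² / 2)` over the paraboloid with parameter
`μ`. -/
theorem mem_of_mem_cone {C : Set (Euc d × ℝ)} (hC : Convex ℝ C) {μ R ρ : ℝ} (hR0 : 0 < R)
    {v : Euc d} (hvR : ‖v‖ ≤ R) (hRρ : 2 * R < ρ)
    (hin : ∀ ω : Euc d, ‖ω‖ < ρ → (ω, μ * ‖ω‖ ^ 2 / 2) ∈ C)
    (hv : (v, μ * ‖v‖ ^ 2 / 2 - μ * R ^ 2 / 2) ∈ C) {ω : Euc d} (hω : ‖ω - v‖ ≤ R) :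
    (ω, μ * ‖ω‖ ^ 2 / 2 - μ / 2 * (R - ‖ω - v‖) ^ 2) ∈ C := by
  rcases eq_or_ne (ω - v) 0 with h | h
  · rw [sub_eq_zero] at h
    subst h
    convert! hv using 2
    simp
    ring
  · have hs : 0 < ‖ω - v‖ := norm_pos_iff.2 h
    obtain ⟨ζ, rfl⟩ : ∃ ζ, ω = v + ζ := ⟨ω - v, by abel⟩
    rw [add_sub_cancel_left] at *
    set s := ‖ζ‖ with hsdef
    have hc : ‖v + (R / s) • ζ‖ < ρ := by
      refine (norm_add_le _ _).trans_lt ?_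
      rw [norm_smul, Real.norm_eq_abs, abs_of_pos (by positivity), ← hsdef,
        div_mul_cancel₀ _ hs.ne']
      linarith
    have hcn : ‖v + (R / s) • ζ‖ ^ 2 = ‖v‖ ^ 2 + 2 * (R / s) * ⟪v, ζ⟫ + R ^ 2 := by
      rw [norm_add_sq_real, inner_smul_right, norm_smul, Real.norm_eq_abs,
        abs_of_pos (by positivity), ← hsdef, div_mul_cancel₀ _ hs.ne']
      ring
    have hn : ‖v + ζ‖ ^ 2 = ‖v‖ ^ 2 + 2 * ⟪v, ζ⟫ + s ^ 2 := by
      rw [norm_add_sq_real]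
    have := hC hv (hin _ hc) (a := 1 - s / R) (b := s / R)
      (sub_nonneg.2 ((div_le_one hR0).2 hω)) (by positivity) (by ring)
    convert! this using 1
    ext1
    · simp only [Prod.smul_mk, Prod.mk_add_mk, smul_add, smul_smul]
      rw [div_mul_div_cancel₀ hR0.ne', div_self hs.ne', one_smul, sub_smul, one_smul]
      abel
    · simp only [Prod.smul_mk, Prod.mk_add_mk, smul_eq_mul]
      rw [hcn, hn]
      field_simp
      ring

set_option maxHeartbeats 1000000 in
theorem le_volume_cone (hK : Osculates K) {η : ℝ} (hη : 0 < η) :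
    ∃ t₀ > 0, ∀ t, 0 < t → t < t₀ → ∀ z : Euc d × ℝ, z.2 ≤ -t →
      volume K + ENNReal.ofReal ((1 - η) * coneConst d * √(2 * t) ^ (d + 2))
        ≤ volume (convexHull ℝ (K ∪ {z})) := by
  set V := volume.real (ball (0 : Euc d) 1) with hV
  obtain ⟨ε, hε, hε2, hF⟩ := exists_pos_lt_of_continuousAt
    (F := fun ε : ℝ => -((√(1 + ε))⁻¹ ^ (d + 2) * ((1 + ε) * coneConst d - 5 * ε * V)))
    (c := -((1 - η) * coneConst d))
    (by
      have : √(1 + (0:ℝ)) ≠ 0 := by simp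
      fun_prop (disch := assumption)) (by simpa using by nlinarith [coneConst_pos d])
  obtain ⟨ρ₁, hρ₁, hin⟩ := hK.inner_global hε
  obtain ⟨ρ₂, hρ₂, hout⟩ := hK.outer ε hε
  have hl : 0 < 1 + ε := by linarith
  set ρ := min 1 (min ρ₁ ρ₂) with hρdef
  have hρ : 0 < ρ := by positivity
  have hρ1 : ρ ≤ 1 := min_le_left _ _
  have hρρ₁ : ρ ≤ ρ₁ := (min_le_right _ _).trans (min_le_left _ _)
  have hρρ₂ : ρ ≤ ρ₂ := (min_le_right _ _).trans (min_le_right _ _)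
  refine ⟨(ρ / 2) ^ 2 / 2, by positivity, fun t ht ht0 z hz => ?_⟩
  set R := √(2 * t / (1 + ε)) with hR
  have hR0 : 0 < R := by positivity
  have hR2 : R ^ 2 = 2 * t / (1 + ε) := Real.sq_sqrt (by positivity)
  have hR2' : (1 + ε) * R ^ 2 = 2 * t := by rw [hR2]; field_simp
  have hRρ : 2 * R < ρ := by
    have : R < ρ / 2 := by
      apply lt_of_pow_lt_pow_left₀ 2 (by positivity)
      nlinarith
    linarith
  set C := convexHull ℝ (K ∪ {z}) with hCdef
  have hC : Convex ℝ C := convex_convexHull ℝ _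
  have hKC : K ⊆ C := subset_union_left.trans (subset_convexHull ℝ _)
  have hzC : z ∈ C := subset_convexHull ℝ _ (Or.inr rfl)
  have hpar : ∀ ω : Euc d, ‖ω‖ < ρ → (ω, (1 + ε) * ‖ω‖ ^ 2 / 2) ∈ C := fun ω hω =>
    hKC (hin _ _ (by linarith) (by nlinarith [norm_nonneg ω]) le_rfl)
  obtain ⟨v, hvR, hv⟩ : ∃ v : Euc d, ‖v‖ ≤ R ∧
      (v, (1 + ε) * ‖v‖ ^ 2 / 2 - (1 + ε) * R ^ 2 / 2) ∈ C := by
    obtain ⟨θ, ⟨hθ0, hθ1⟩, hθ⟩ : (0:ℝ) ∈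
        (fun θ : ℝ => (1 + ε) * (θ * ‖z.1‖) ^ 2 / 2 - t - θ * z.2) '' Icc 0 1 := by
      apply intermediate_value_Icc zero_le_one (Continuous.continuousOn (by fun_prop))
      constructor
      · simp; linarith
      · simp only [one_mul]
        have : 0 ≤ (1 + ε) * ‖z.1‖ ^ 2 / 2 := by positivity
        linarith
    simp only at hθ
    have hn : ‖θ • z.1‖ = θ * ‖z.1‖ := by rw [norm_smul, Real.norm_eq_abs, abs_of_nonneg hθ0]
    refine ⟨θ • z.1, ?_, ?_⟩
    · rw [hn]
      apply le_of_sq_le_sq _ hR0.le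
      nlinarith
    · rw [hn, hR2', show (1 + ε) * (θ * ‖z.1‖) ^ 2 / 2 - 2 * t / 2 = θ * z.2 by linarith]
      exact hC.smul_mem_of_zero_mem (hKC hK.zero_mem) hzC ⟨hθ0, hθ1⟩
  set A := closedRegion (closedBall v R)
    (fun ω => (1 + ε) * ‖ω‖ ^ 2 / 2 - (1 + ε) / 2 * (R - ‖ω - v‖) ^ 2)
    (fun ω => (1 - ε) * ‖ω‖ ^ 2 / 2 - ε * t) with hA
  have hnω : ∀ ω ∈ closedBall v R, ‖ω‖ ≤ 2 * R := fun ω hω => by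
    rw [mem_closedBall, dist_eq_norm] at hω
    calc ‖ω‖ = ‖v + (ω - v)‖ := by congr 1; abel
      _ ≤ _ := norm_add_le _ _
      _ ≤ _ := by linarith
  have hAC : A ⊆ C := by
    rintro ⟨ω, a⟩ ⟨h1, h2, h3⟩
    have h4 := hnω ω h1
    simp only at h1 h2 h3
    rw [mem_closedBall, dist_eq_norm] at h1
    refine hC.mem_of_vertical (mem_of_mem_cone hC hR0 hvR hRρ hpar hv h1)
      (hpar ω (by linarith)) h2 (h3.trans ?_)
    nlinarith [sq_nonneg ‖ω‖]
  have hAK : Disjoint K A := by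
    rw [Set.disjoint_left]
    rintro ⟨ω, a⟩ hK' ⟨h1, h2, h3⟩
    have h4 := hnω ω h1
    simp only at h1 h2 h3
    have h5 : ‖ω‖ ^ 2 ≤ ρ := by nlinarith [norm_nonneg ω]
    have := hout ω a (by linarith) (by nlinarith [sq_nonneg ‖ω‖]) hK'
    nlinarith
  have hvol : volume K + volume A ≤ volume C := by
    rw [← measure_union' hAK hK.isClosed.measurableSet]
    exact measure_mono (union_subset hKC hAC)
  refine le_trans (add_le_add_right ?_ _) hvol
  refine le_trans (ENNReal.ofReal_le_ofReal ?_) (ofReal_integral_le_volume_closedRegion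
    (isCompact_closedBall _ _) (by fun_prop) (by fun_prop))
  have hc : IsCompact (closedBall v R) := isCompact_closedBall _ _
  have i1 : IntegrableOn (fun ω : Euc d => ((1 - ε) * ‖ω‖ ^ 2 / 2 - ε * t)
      - ((1 + ε) * ‖ω‖ ^ 2 / 2 - (1 + ε) / 2 * (R - ‖ω - v‖) ^ 2)) (closedBall v R) :=
    Continuous.continuousOn (by fun_prop) |>.integrableOn_compact hc
  have i2 : IntegrableOn (fun ω : Euc d => (1 + ε) / 2 * (R - ‖ω - v‖) ^ 2) (closedBall v R) :=
    Continuous.continuousOn (by fun_prop) |>.integrableOn_compact hc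
  have i3 : IntegrableOn (fun _ : Euc d => 5 * ε * R ^ 2) (closedBall v R) :=
    Continuous.continuousOn (by fun_prop) |>.integrableOn_compact hc
  calc _ ≤ (√(1 + ε))⁻¹ ^ (d + 2) * ((1 + ε) * coneConst d - 5 * ε * V) * √(2 * t) ^ (d + 2) := by
        exact mul_le_mul_of_nonneg_right (by linarith) (by positivity)
    _ = ((1 + ε) * coneConst d - 5 * ε * V) * R ^ (d + 2) := by
        rw [hR, sqrt_div_pow (by positivity)]
        ring
    _ = ∫ ω in closedBall v R, ((1 + ε) / 2 * (R - ‖ω - v‖) ^ 2 - 5 * ε * R ^ 2) := by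
        rw [integral_sub i2 i3, integral_const_mul, setIntegral_closedBall_cone hR0,
          setIntegral_closedBall_const hR0.le]
        ring
    _ ≤ _ := by
        refine setIntegral_mono_on (i2.sub i3) i1 isClosed_closedBall.measurableSet
          fun ω hω => ?_
        have h4 := hnω ω hω
        have h5 : ‖ω‖ ^ 2 ≤ (2 * R) ^ 2 := by gcongr
        have h6 : t ≤ R ^ 2 := by nlinarith [sq_nonneg R]
        linarith [mul_le_mul_of_nonneg_left h5 hε.le, mul_le_mul_of_nonneg_left h6 hε.le]

end Osculates

/-- The polar of `K` in coordinates in which both bodies are viewed from their boundary points. -/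
def dualRegion {d : ℕ} (K : Set (Euc d × ℝ)) : Set (Euc d × ℝ) :=
  {q | ∀ p ∈ K, (1 - p.2) * (1 - q.2) + ⟪p.1, q.1⟫ ≤ 1}

theorem Osculates.dualRegion {d : ℕ} {K : Set (Euc d × ℝ)} (hK : Osculates K)
    (hb : Bornology.IsBounded K) (h2 : ((0 : Euc d), (2 : ℝ)) ∈ K) :
    Osculates (dualRegion K) where
  convex := by
    intro q hq q' hq' a b ha hb hab p hp
    have h1 := mul_le_mul_of_nonneg_left (hq p hp) ha
    have h2 := mul_le_mul_of_nonneg_left (hq' p hp) hb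
    simp only [Prod.fst_add, Prod.smul_fst, Prod.snd_add, Prod.smul_snd, inner_add_right,
      inner_smul_right, smul_eq_mul]
    obtain rfl : b = 1 - a := by linarith
    linarith
  isClosed := by
    simp only [_root_.dualRegion, ofPred_forall]
    exact isClosed_biInter fun p _ => isClosed_le (by fun_prop) continuous_const
  zero_mem := fun p hp => by
    have := hK.nonneg p hp
    simpa using this
  nonneg := fun q hq => by
    have := hq _ hK.zero_mem
    simp at this
    linarith
  le_two := fun q hq => by
    have := hq _ h2
    simp at this
    linarith
  center := by
    obtain ⟨M, hM0, hM⟩ := hb.exists_pos_norm_le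
    refine ⟨1 / M, by positivity, fun ω hω p hp => ?_⟩
    have h3 : ‖p.1‖ ≤ M := (norm_fst_le p).trans (hM p hp)
    have h4 := real_inner_le_norm p.1 ω
    have h5 : ‖p.1‖ * ‖ω‖ ≤ M * (1 / M) := by gcongr
    rw [mul_one_div_cancel hM0.ne'] at h5
    simp only [sub_self, mul_zero, zero_add]
    linarith
  inner := by
    intro ε hε
    set e := ε / (2 * (1 + ε)) with he
    have he0 : 0 < e := by positivity
    have he' : (1 - 2 * e) * (1 + ε) = 1 := by rw [he]; field_simp; ring
    have he1 : e < 1 / 2 := by nlinarith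
    obtain ⟨r, hr, h⟩ := hK.outer_global he0 (by linarith)
    have hl : 0 < 1 - e := by linarith
    refine ⟨min e ((1 - e) ^ 2 * r / 2), by positivity, fun q β hq hβ hqβ p hp => ?_⟩
    simp only [lt_min_iff] at hq hβ
    have h0 := hK.nonneg p hp
    have hp' := h p hp
    have hin := real_inner_le_norm p.1 q
    suffices ‖p.1‖ * ‖q‖ ≤ p.2 * (1 - β) + β by
      simp only
      linarith
    have hβ0 : 0 ≤ β := le_trans (by positivity) hqβ
    have hα : p.2 * (1 - e) ≤ p.2 * (1 - β) := by
      apply mul_le_mul_of_nonneg_left _ h0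
      linarith
    rcases le_or_gt ‖p.1‖ r with hpr | hpr
    · rw [min_eq_left hpr] at hp'
      have h5 : ((1 - 2 * e) * (‖p.1‖ * ‖p.1‖)) / 2 ≤ p.2 * (1 - e) := by
        have := mul_le_mul_of_nonneg_right hp' hl.le
        have h6 : 0 ≤ e ^ 2 * (‖p.1‖ * ‖p.1‖) := by positivity
        linarith
      have h7 : 0 ≤ (1 - 2 * e) * (‖p.1‖ - (1 + ε) * ‖q‖) ^ 2 := by
        have : 0 ≤ 1 - 2 * e := by linarith
        positivity
      have h8 : (1 - 2 * e) * (‖p.1‖ - (1 + ε) * ‖q‖) ^ 2 = (1 - 2 * e) * (‖p.1‖ * ‖p.1‖)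
          - 2 * (‖p.1‖ * ‖q‖) * ((1 - 2 * e) * (1 + ε))
          + (1 + ε) * ‖q‖ ^ 2 * ((1 - 2 * e) * (1 + ε)) := by ring
      rw [he'] at h8
      linarith
    · rw [min_eq_right hpr.le] at hp'
      have h5 := mul_le_mul_of_nonneg_right hp' hl.le
      have h6 := mul_le_mul_of_nonneg_left hq.2.le (norm_nonneg p.1)
      linarith
  outer := by
    intro ε hε
    obtain ⟨ρ, hρ, h⟩ := hK.inner ε hε
    refine ⟨min ρ 1, by positivity, fun q β hq _ hmem => ?_⟩
    simp only [lt_min_iff] at hq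
    have hβ0 : 0 ≤ β := by
      have := hmem _ hK.zero_mem
      simp at this
      linarith
    have hl : 0 < 1 + ε := by linarith
    have hn : ‖(1 + ε)⁻¹ • q‖ = (1 + ε)⁻¹ * ‖q‖ := by
      rw [norm_smul, Real.norm_eq_abs, abs_of_pos (by positivity)]
    have hi : (1 + ε)⁻¹ * (1 + ε) = 1 := inv_mul_cancel₀ hl.ne'
    have hi1 : (1 + ε)⁻¹ ≤ 1 := inv_le_one_of_one_le₀ (by linarith)
    have hi0 : 0 < (1 + ε)⁻¹ := by positivity
    set i := (1 + ε)⁻¹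
    have e1 : (1 + ε) * ‖i • q‖ ^ 2 / 2 = i * ‖q‖ ^ 2 / 2 := by
      rw [hn]
      linear_combination (i * ‖q‖ ^ 2 / 2) * hi
    have hq2 : ‖q‖ ^ 2 ≤ ‖q‖ := by nlinarith [norm_nonneg q]
    have hk := h (i • q) (i * ‖q‖ ^ 2 / 2) (by rw [hn]; nlinarith [norm_nonneg q])
      (by nlinarith [norm_nonneg q]) e1.le
    have := hmem _ hk
    simp only [inner_smul_left, real_inner_self_eq_norm_sq, conj_trivial] at this
    have h6 : 0 ≤ β * (i * ‖q‖ ^ 2 / 2) := by positivity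
    have h7 : 1 - ε ≤ i := by nlinarith
    have h8 := mul_le_mul_of_nonneg_right h7 (sq_nonneg ‖q‖)
    linarith

/-! ### Local geometry of the boundary -/

/-- Second order Taylor expansion at a critical point with value zero. -/
theorem exists_abs_sub_hessian_le {d : ℕ} {f : Euc d → ℝ} (hf : ContDiffAt ℝ 2 f 0)
    (h0 : f 0 = 0) (h1 : fderiv ℝ f 0 = 0) {ε : ℝ} (hε : 0 < ε) :
    ∃ ρ > 0, ∀ v : Euc d, ‖v‖ < ρ →
      |f v - fderiv ℝ (fderiv ℝ f) 0 v v / 2| ≤ ε * ‖v‖ ^ 2 := by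
  set H := fderiv ℝ (fderiv ℝ f) 0 with hH
  have hs : ∀ v w, H v w = H w v := fun v w =>
    (hf.isSymmSndFDerivAt (by simp)).eq v w
  have hd : HasFDerivAt (fderiv ℝ f) H 0 :=
    ((hf.fderiv_right (m := 1) (by norm_num)).differentiableAt (by norm_num)).hasFDerivAt
  have h2 : ∀ᶠ v : Euc d in 𝓝 0, ‖fderiv ℝ f v - H v‖ ≤ ε * ‖v‖ := by
    have := hd.isLittleO.def hε
    simpa [h1] using this
  have h3 : ∀ᶠ v : Euc d in 𝓝 0, DifferentiableAt ℝ f v :=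
    (hf.eventually (by simp)).mono fun v hv => hv.differentiableAt (by simp)
  obtain ⟨ρ, hρ, h⟩ := Metric.eventually_nhds_iff_ball.1 (h2.and h3)
  refine ⟨ρ, hρ, fun v hv => ?_⟩
  set g : Euc d → ℝ := fun w => f w - H w w / 2 with hg
  have hgd : ∀ w ∈ ball (0 : Euc d) ρ, HasFDerivAt g (fderiv ℝ f w - H w) w := by
    intro w hw
    have e1 : HasFDerivAt (fun w => H w w) (H w + H.flip w) w := by
      have := (H.hasFDerivAt (x := w)).clm_apply (hasFDerivAt_id w)
      convert! this using 1
    have e2 : H.flip w = H w := by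
      ext z
      simp [hs z w]
    rw [e2] at e1
    have e3 := (h w hw).2.hasFDerivAt.sub (e1.mul_const (1 / 2))
    convert! e3 using 1
    · ext z; simp [hg]; ring
    · ext z; simp; ring
  have hsub : closedBall (0 : Euc d) ‖v‖ ⊆ ball 0 ρ := closedBall_subset_ball hv
  have := (convex_closedBall (0 : Euc d) ‖v‖).norm_image_sub_le_of_norm_hasFDerivWithin_le
    (f := g) (C := ε * ‖v‖) (x := 0) (y := v)
    (fun w hw => (hgd w (hsub hw)).hasFDerivWithinAt)
    (fun w hw => ((h w (hsub hw)).1).trans (by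
      rw [mem_closedBall_zero_iff] at hw
      gcongr)) (by simp) (by simp)
  simp only [hg, h0, map_zero, zero_div, sub_zero, Real.norm_eq_abs] at this
  linarith

theorem hessian_nonneg {d : ℕ} {f : Euc d → ℝ} (hf : ContDiffAt ℝ 2 f 0)
    (h0 : f 0 = 0) (h1 : fderiv ℝ f 0 = 0) (hpos : ∀ᶠ v in 𝓝 0, 0 ≤ f v) (v : Euc d) :
    0 ≤ fderiv ℝ (fderiv ℝ f) 0 v v := by
  refine le_of_forall_pos_le_add fun e he => ?_
  have hv0 : 0 < 1 + ‖v‖ ^ 2 := by positivity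
  obtain ⟨ρ, hρ, h⟩ := exists_abs_sub_hessian_le hf h0 h1
    (ε := e / (2 * (1 + ‖v‖ ^ 2))) (by positivity)
  obtain ⟨ρ', hρ', h'⟩ := Metric.eventually_nhds_iff_ball.1 hpos
  obtain ⟨t, ht, htv⟩ : ∃ t : ℝ, 0 < t ∧ ‖t • v‖ < min ρ ρ' := by
    refine ⟨min ρ ρ' / (2 * (1 + ‖v‖)), by positivity, ?_⟩
    rw [norm_smul, Real.norm_eq_abs, abs_of_pos (by positivity)]
    have hm : 0 < min ρ ρ' := by positivity
    rw [div_mul_eq_mul_div, div_lt_iff₀ (by positivity)]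
    nlinarith [norm_nonneg v]
  simp only [lt_min_iff] at htv
  have h2 := abs_le.1 (h _ htv.1)
  have h3 := h' (t • v) (by simpa using htv.2)
  simp only [map_smul, smul_apply, smul_eq_mul, norm_smul, Real.norm_eq_abs,
    mul_pow, sq_abs] at h2
  have h4 : 0 ≤ t ^ 2 * (fderiv ℝ (fderiv ℝ f) 0 v v / 2
      + e / (2 * (1 + ‖v‖ ^ 2)) * ‖v‖ ^ 2) := by nlinarith [h2.2]
  have h5 := nonneg_of_mul_nonneg_right h4 (by positivity)
  have h6 : e / (2 * (1 + ‖v‖ ^ 2)) * ‖v‖ ^ 2 ≤ e / 2 := by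
    rw [div_mul_eq_mul_div, div_le_div_iff₀ (by positivity) (by positivity)]
    nlinarith
  linarith

theorem bilinear_eq_inner_toEuclideanLin {d : ℕ} (H : Euc d →L[ℝ] Euc d →L[ℝ] ℝ) (v w : Euc d) :
    H v w = ⟪v, Matrix.toEuclideanLin (Matrix.of fun i j : Fin d =>
      H (EuclideanSpace.single i 1) (EuclideanSpace.single j 1)) w⟫ := by
  conv_lhs => rw [← (EuclideanSpace.basisFun (Fin d) ℝ).sum_repr v,
    ← (EuclideanSpace.basisFun (Fin d) ℝ).sum_repr w]
  simp only [map_sum, map_smul, sum_apply, smul_apply,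
    EuclideanSpace.basisFun_repr, EuclideanSpace.basisFun_apply, smul_eq_mul, PiLp.inner_apply,
    Matrix.ofLp_toLpLin, Matrix.toLin'_apply, Matrix.mulVec, dotProduct, Matrix.of_apply,
    RCLike.inner_apply, conj_trivial]
  simp only [Finset.mul_sum, Finset.sum_mul]
  rw [Finset.sum_comm]
  exact Finset.sum_congr rfl fun i _ => Finset.sum_congr rfl fun j _ => by ring

open scoped MatrixOrder in
/-- A positive definite quadratic form with determinant `κ` becomes `h ‖·‖²` after a linear change
of variables, whose determinant is computed; the contragredient map is provided as well. -/
theorem exists_normalizing_map {d : ℕ} (H : Euc d →L[ℝ] Euc d →L[ℝ] ℝ)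
    (hs : ∀ v w, H v w = H w v) (hpos : ∀ v, 0 ≤ H v v) {κ h : ℝ} (hκ : 0 < κ) (hh : 0 < h)
    (hdet : κ = (Matrix.of fun i j : Fin d =>
      H (EuclideanSpace.single i 1) (EuclideanSpace.single j 1)).det) :
    ∃ A A' : Euc d →ₗ[ℝ] Euc d, (∀ ω, H (A ω) (A ω) = h * ‖ω‖ ^ 2) ∧
      (∀ p ω, ⟪A p, A' ω⟫ = ⟪p, ω⟫) ∧ |LinearMap.det A| * √κ = √h ^ d ∧
      LinearMap.det A * LinearMap.det A' = 1 := by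
  set M := Matrix.of fun i j : Fin d =>
      H (EuclideanSpace.single i 1) (EuclideanSpace.single j 1) with hM
  have hMpos : M.PosSemidef := by
    refine .of_dotProduct_mulVec_nonneg ?_ fun x => ?_
    · ext i j
      simp [hM, hs]
    · have := hpos (WithLp.toLp 2 x)
      rw [bilinear_eq_inner_toEuclideanLin, ← hM] at this
      convert! this using 1
      simp [PiLp.inner_apply, dotProduct, mul_comm, Matrix.toLpLin_apply]
  obtain ⟨B, hB⟩ := CStarAlgebra.nonneg_iff_eq_star_mul_self.mp hMpos.nonneg
  rw [Matrix.star_eq_conjTranspose] at hB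
  have hBdet : B.det ^ 2 = κ := by
    rw [hdet, hB, Matrix.det_mul, Matrix.det_conjTranspose]
    simp [sq]
  have hB0 : B.det ≠ 0 := by
    intro h0
    rw [h0] at hBdet
    simp at hBdet
    linarith
  have hBu : IsUnit B.det := isUnit_iff_ne_zero.2 hB0
  have hsh : 0 < √h := Real.sqrt_pos.2 hh
  have hdetlin : ∀ C : Matrix (Fin d) (Fin d) ℝ,
      LinearMap.det (Matrix.toEuclideanLin C) = C.det := fun C => by
    rw [Matrix.toEuclideanLin_eq_toLin_orthonormal, LinearMap.det_toLin]
  have hcomp : ∀ ω, Matrix.toEuclideanLin B (Matrix.toEuclideanLin B⁻¹ ω) = ω := by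
    intro ω
    rw [Matrix.toLpLin_apply, Matrix.toLpLin_apply]
    simp [Matrix.mulVec_mulVec, Matrix.mul_nonsing_inv _ hBu]
  have hHB : ∀ v, H v v = ‖Matrix.toEuclideanLin B v‖ ^ 2 := by
    intro v
    rw [bilinear_eq_inner_toEuclideanLin, ← hM, hB, ← real_inner_self_eq_norm_sq,
      ← LinearMap.adjoint_inner_right, ← Matrix.toEuclideanLin_conjTranspose_eq_adjoint]
    congr 1
    simp [Matrix.toLpLin_apply, Matrix.mulVec_mulVec]
  refine ⟨√h • Matrix.toEuclideanLin B⁻¹, (√h)⁻¹ • Matrix.toEuclideanLin B.conjTranspose,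
    fun ω => ?_, fun p ω => ?_, ?_, ?_⟩
  · rw [hHB, LinearMap.smul_apply, map_smul, hcomp, norm_smul, mul_pow, Real.norm_eq_abs, sq_abs,
      Real.sq_sqrt hh.le]
  · rw [LinearMap.smul_apply, LinearMap.smul_apply, inner_smul_left, inner_smul_right,
      Matrix.toEuclideanLin_conjTranspose_eq_adjoint, LinearMap.adjoint_inner_right, hcomp]
    simp only [conj_trivial]
    field_simp
  · rw [LinearMap.det_smul, hdetlin, ← hBdet, Real.sqrt_sq_eq_abs, Matrix.det_nonsing_inv,
      Ring.inverse_eq_inv', abs_mul, abs_inv, abs_of_pos (by positivity), finrank_euclideanSpace_fin]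
    have := abs_pos.2 hB0
    field_simp
  · rw [LinearMap.det_smul, LinearMap.det_smul, hdetlin, hdetlin, Matrix.det_nonsing_inv,
      Ring.inverse_eq_inv', Matrix.det_conjTranspose, finrank_euclideanSpace_fin]
    simp only [star_trivial, inv_pow]
    field_simp

theorem IsPreconnected.subset_of_disjoint_frontier {X : Type*} [TopologicalSpace X] {s S : Set X}
    (hs : IsPreconnected s) (hd : Disjoint s (frontier S)) (hne : (s ∩ S).Nonempty) : s ⊆ S := by
  refine (hs.subset_left_of_subset_union isOpen_interior (isClosed_closure (s := S)).isOpen_compl ?_ ?_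
    ?_).trans interior_subset
  · exact disjoint_compl_right.mono_left interior_subset_closure
  · intro y hy
    by_contra hc
    simp only [mem_union, mem_compl_iff, not_or, not_not] at hc
    exact Set.disjoint_left.1 hd hy ⟨hc.2, hc.1⟩
  · obtain ⟨y, hy, hyS⟩ := hne
    refine ⟨y, hy, ?_⟩
    by_contra hc
    exact Set.disjoint_left.1 hd hy ⟨subset_closure hyS, hc⟩

/-- If the boundary of the convex set `S` is locally a graph, then `S` is locally an epigraph. -/
theorem exists_local_epigraph {d n : ℕ} {S : Set (Euc n)} (hconv : Convex ℝ S) (hcl : IsClosed S)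
    {x ν m' : Euc n} {m : Euc d} {L : Euc d →ₗᵢ[ℝ] Euc n} {f : Euc d → ℝ} {τ ε h : ℝ} (hh : 0 < h)
    (hm' : m' = L m) (hx : x = h • ν + m') (h0S : (0 : Euc n) ∈ S) (hxS : x ∈ S) (hν : ‖ν‖ = 1)
    (hmax : ∀ y ∈ S, ⟪y, ν⟫ ≤ ⟪x, ν⟫) (hL : ∀ v, ⟪L v, ν⟫ = 0) (hτ : 0 < τ) (hε : 0 < ε)
    (hf : ContinuousOn f (ball 0 τ)) (hf0 : f 0 = 0) (hf1 : HasFDerivAt f (0 : Euc d →L[ℝ] ℝ) 0)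
    (hgraph : frontier S ∩ ball x ε
      = {y | ∃ v ∈ ball (0 : Euc d) τ, y = x + L v - f v • ν} ∩ ball x ε) :
    ∃ ρ > 0, ρ ≤ τ ∧ ∀ v b, ‖v‖ < ρ → |b| < ρ → (x + L v - b • ν ∈ S ↔ f v ≤ b) := by
  set r := ε / 3 with hr
  have hr0 : 0 < r := by positivity
  have hc0 : ContinuousAt f 0 := hf1.continuousAt
  have hev : ∀ᶠ v in 𝓝 (0 : Euc d), |f v| < r := by
    have h1 : |f 0| < r := by simpa [hf0] using hr0
    exact hc0.abs.eventually (Iio_mem_nhds h1)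
  obtain ⟨ρ₀, hρ₀, hρf⟩ := Metric.eventually_nhds_iff_ball.1 hev
  set ρ := min (min ρ₀ τ) r with hρdef
  have hρ : 0 < ρ := by positivity
  have hρρ₀ : ρ ≤ ρ₀ := (min_le_left _ _).trans (min_le_left _ _)
  have hρτ : ρ ≤ τ := (min_le_left _ _).trans (min_le_right _ _)
  have hρr : ρ ≤ r := min_le_right _ _
  have hfr : ∀ v, ‖v‖ < ρ → |f v| < r := fun v hv => hρf v (by simpa using hv.trans_le hρρ₀)
  have hball : ∀ v b, ‖v‖ < ρ → |b| < r → x + L v - b • ν ∈ ball x ε := by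
    intro v b hv hb
    rw [mem_ball, dist_eq_norm, show x + L v - b • ν - x = L v - b • ν by abel]
    refine (norm_sub_le _ _).trans_lt ?_
    rw [L.norm_map, norm_smul, hν, mul_one, Real.norm_eq_abs]
    linarith
  have hνν : ⟪ν, ν⟫ = 1 := by rw [real_inner_self_eq_norm_sq, hν]; norm_num
  have hinner : ∀ v b, ⟪x + L v - b • ν, ν⟫ = ⟪x, ν⟫ - b := by
    intro v b
    rw [inner_sub_left, inner_add_left, hL, inner_smul_left, hνν]
    simp
  have hfront : ∀ v b, ‖v‖ < ρ → |b| < r → (x + L v - b • ν ∈ frontier S ↔ f v = b) := by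
    intro v b hv hb
    have : x + L v - b • ν ∈ frontier S ↔ x + L v - b • ν ∈ frontier S ∩ ball x ε :=
      ⟨fun h => ⟨h, hball v b hv hb⟩, fun h => h.1⟩
    rw [this, hgraph]
    constructor
    · rintro ⟨⟨w, hw, heq⟩, -⟩
      have h1 := congrArg (fun y => ⟪y, ν⟫) heq
      simp only [hinner] at h1
      have h2 : b = f w := by linarith
      rw [← h2] at heq
      have h3 : L v = L w := by simpa using heq
      rw [L.injective h3, h2]
    · rintro rfl
      exact ⟨⟨v, by simpa using hv.trans_le hρτ, rfl⟩, hball _ _ hv hb⟩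
  set Ψ : ℝ → Euc d × ℝ → Euc n := fun σ p => x + L p.1 - (f p.1 + p.2 * (σ - f p.1)) • ν with hΨ
  set B : Set (Euc d × ℝ) := ball 0 ρ ×ˢ Ioo 0 1 with hB
  have hpre : ∀ σ, IsPreconnected (Ψ σ '' B) := by
    intro σ
    refine (((convex_ball _ _).isPreconnected).prod isPreconnected_Ioo).image _ ?_
    have : ContinuousOn (fun p : Euc d × ℝ => f p.1) B :=
      hf.comp continuousOn_fst fun p hp => ball_subset_ball hρτ hp.1
    exact (continuous_const.add (L.continuous.comp continuous_fst)).continuousOn.sub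
      ((this.add (continuousOn_snd.mul (continuousOn_const.sub this))).smul continuousOn_const)
  have hmid : ∀ σ, |σ| = r → ∀ p ∈ B, |f p.1 + p.2 * (σ - f p.1)| < r ∧ σ - f p.1 ≠ 0 := by
    rintro σ hσ ⟨v, s⟩ ⟨h1, h2, h3⟩
    have h4 := hfr v (by simpa using h1)
    simp only at h2 h3 ⊢
    refine ⟨?_, ?_⟩
    · rw [show f v + s * (σ - f v) = (1 - s) * f v + s * σ by ring]
      refine (abs_add_le _ _).trans_lt ?_
      rw [abs_mul, abs_mul, hσ, abs_of_pos h2, abs_of_pos (by linarith : 0 < 1 - s)]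
      nlinarith
    · intro h5
      rw [sub_eq_zero] at h5
      rw [← h5] at h4
      linarith
  have hdisj : ∀ σ, |σ| = r → Disjoint (Ψ σ '' B) (frontier S) := by
    intro σ hσ
    rw [Set.disjoint_left]
    rintro _ ⟨p, hp, rfl⟩ hfr'
    obtain ⟨h1, h2⟩ := hmid σ hσ p hp
    rw [hΨ, hfront _ _ (by simpa using hp.1) h1] at hfr'
    have h3 : p.2 * (σ - f p.1) = 0 := by linarith
    rcases mul_eq_zero.1 h3 with h4 | h4
    · exact hp.2.1.ne' h4
    · exact h2 h4
  have hlow : ∀ y ∈ Ψ (-r) '' B, y ∉ S := by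
    intro y hy hyS
    have hsub := (hpre (-r)).subset_of_disjoint_frontier
      (hdisj _ (by rw [abs_neg, abs_of_pos hr0])) ⟨y, hy, hyS⟩
    have h1 := hmax _ (hsub ⟨((0 : Euc d), 1 / 2), ⟨by simpa using hρ, by norm_num, by norm_num⟩,
      rfl⟩)
    rw [hΨ] at h1
    simp only [hinner, hf0] at h1
    linarith
  have hup : Ψ r '' B ⊆ S := by
    refine (hpre r).subset_of_disjoint_frontier (hdisj _ (abs_of_pos hr0)) ?_
    have hsmall : ∀ᶠ v in 𝓝 (0 : Euc d), |f v| ≤ h / (2 * (‖m‖ + 1)) * ‖v‖ := by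
      have := hf1.isLittleO.def (c := h / (2 * (‖m‖ + 1))) (by positivity)
      simpa [hf0] using this
    have hlim : Tendsto (fun t : ℝ => (-t) • m) (𝓝[>] 0) (𝓝 0) := by
      have : Tendsto (fun t : ℝ => (-t) • m) (𝓝 0) (𝓝 ((-0 : ℝ) • m)) :=
        Continuous.tendsto (by fun_prop) 0
      simp only [neg_zero, zero_smul] at this
      exact this.mono_left nhdsWithin_le_nhds
    have h4 : ∀ᶠ t : ℝ in 𝓝[>] 0, t ∈ Ioo (0:ℝ) (min 1 (r / h)) :=
      Ioo_mem_nhdsGT (by positivity)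
    obtain ⟨t, ⟨ht1, ht2⟩, ht3, ht4⟩ :=
      ((hlim.eventually (hsmall.and (ball_mem_nhds _ hρ))).and h4).exists
    simp only [lt_min_iff] at ht4
    obtain ⟨ht4, ht5⟩ := ht4
    rw [lt_div_iff₀ hh] at ht5
    have hft : f ((-t) • m) < t * h := by
      refine (le_abs_self _).trans_lt (ht1.trans_lt ?_)
      rw [norm_smul, norm_neg, Real.norm_eq_abs, abs_of_pos ht3, div_mul_eq_mul_div,
        div_lt_iff₀ (by positivity)]
      have := norm_nonneg m
      have : 0 < t * h := by positivity
      nlinarith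
    have hfr' := (abs_lt.1 (hfr ((-t) • m) (by simpa using ht2))).2
    refine ⟨x + L ((-t) • m) - (t * h) • ν, ⟨((-t) • m, (t * h - f ((-t) • m)) /
      (r - f ((-t) • m))), ⟨ht2, div_pos (by linarith) (by linarith), ?_⟩, ?_⟩, ?_⟩
    · simp only
      rw [div_lt_one (by linarith)]
      linarith
    · simp only [hΨ]
      rw [div_mul_cancel₀ _ (by linarith)]
      simp
    · have h5 : x + L ((-t) • m) - (t * h) • ν = (1 - t) • x := by
        rw [map_smul, ← hm', mul_smul, neg_smul, sub_smul, one_smul]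
        nth_rewrite 3 [hx]
        rw [smul_add]
        abel
      rw [h5]
      exact hconv.smul_mem_of_zero_mem h0S hxS ⟨by linarith, by linarith⟩
  refine ⟨ρ, hρ, hρτ, fun v b hv hb => ?_⟩
  have hbr := hb.trans_le hρr
  have hfv := abs_lt.1 (hfr v hv)
  have hbr' := abs_lt.1 hbr
  have hvB : v ∈ ball (0 : Euc d) ρ := by simpa using hv
  rcases lt_trichotomy (f v) b with hlt | heq | hgt
  · refine ⟨fun _ => hlt.le, fun _ => hup ⟨(v, (b - f v) / (r - f v)),
      ⟨hvB, div_pos (by linarith) (by linarith), ?_⟩, ?_⟩⟩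
    · simp only
      rw [div_lt_one (by linarith)]
      linarith
    · simp only [hΨ]
      rw [div_mul_cancel₀ _ (by linarith)]
      simp
  · exact ⟨fun _ => heq.le, fun _ => hcl.frontier_subset ((hfront v b hv hbr).2 heq)⟩
  · refine ⟨fun hS => absurd hS (hlow _ ⟨(v, (b - f v) / (-r - f v)),
      ⟨hvB, div_pos_of_neg_of_neg (by linarith) (by linarith), ?_⟩, ?_⟩),
      fun hle => absurd hle (not_le.2 hgt)⟩
    · simp only
      rw [div_lt_one_of_neg (by linarith)]
      linarith
    · simp only [hΨ]
      rw [div_mul_cancel₀ _ (by linarith)]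
      simp

theorem exists_abs_sub_sq_le {d : ℕ} {f : Euc d → ℝ} (hf : ContDiffAt ℝ 2 f 0)
    (h0 : f 0 = 0) (h1 : fderiv ℝ f 0 = 0) {h : ℝ} (A : Euc d →ₗ[ℝ] Euc d) (m : Euc d)
    (hA : ∀ ω, fderiv ℝ (fderiv ℝ f) 0 (A ω) (A ω) = h * ‖ω‖ ^ 2) {e : ℝ} (he : 0 < e) :
    ∃ ρ > 0, ∀ (ω : Euc d) (α : ℝ), ‖ω‖ < ρ → |α| < ρ →
      |f (A ω - α • m) - h * ‖ω‖ ^ 2 / 2| ≤ e * (‖ω‖ ^ 2 + |α|) := by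
  set H := fderiv ℝ (fderiv ℝ f) 0 with hH
  set a := ‖A.toContinuousLinearMap‖ with ha
  have ha0 : 0 ≤ a := norm_nonneg _
  have hAa : ∀ ω, ‖A ω‖ ≤ a * ‖ω‖ := fun ω => A.toContinuousLinearMap.le_opNorm ω
  set Q := ‖H‖ with hQ
  have hQ0 : 0 ≤ Q := by positivity
  have hHQ : ∀ v w, |H v w| ≤ Q * ‖v‖ * ‖w‖ := fun v w => H.le_opNorm₂ v w
  set μ := ‖m‖ with hμ
  have hμ0 : 0 ≤ μ := norm_nonneg _
  set e₁ := e / (2 * (1 + a ^ 2)) with he₁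
  have he₁0 : 0 < e₁ := by positivity
  have hea : e₁ * (2 * a ^ 2) ≤ e := by
    rw [he₁, div_mul_eq_mul_div, div_le_iff₀ (by positivity)]
    nlinarith
  obtain ⟨ρ₀, hρ₀, hρ⟩ := exists_abs_sub_hessian_le hf h0 h1 he₁0
  set ρ := min 1 (min (ρ₀ / (a + μ + 1)) (e / (Q * a * μ + Q * μ ^ 2 + 2 * e₁ * μ ^ 2 + 1)))
    with hρdef
  have hρpos : 0 < ρ := by positivity
  have hρ1 : ρ ≤ 1 := min_le_left _ _
  have hρ2 : ρ * (a + μ + 1) ≤ ρ₀ := by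
    rw [← le_div_iff₀ (by positivity)]
    exact (min_le_right _ _).trans (min_le_left _ _)
  have hρ3 : ρ * (Q * a * μ + Q * μ ^ 2 + 2 * e₁ * μ ^ 2 + 1) ≤ e := by
    rw [← le_div_iff₀ (by positivity)]
    exact (min_le_right _ _).trans (min_le_right _ _)
  refine ⟨ρ, hρpos, fun ω α hω hα => ?_⟩
  have hω0 := norm_nonneg ω
  have hα0 := abs_nonneg α
  set v := A ω - α • m with hv
  have hvn : ‖v‖ ≤ a * ‖ω‖ + |α| * μ := by
    refine (norm_sub_le _ _).trans ?_
    rw [norm_smul, Real.norm_eq_abs]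
    gcongr
    exact hAa ω
  have hvρ : ‖v‖ < ρ₀ := by
    have h2 : a * ‖ω‖ ≤ a * ρ := by gcongr
    have h3 : |α| * μ ≤ ρ * μ := by gcongr
    linarith
  have hv2 : ‖v‖ ^ 2 ≤ 2 * a ^ 2 * ‖ω‖ ^ 2 + 2 * |α| ^ 2 * μ ^ 2 := by
    have : ‖v‖ ^ 2 ≤ (a * ‖ω‖ + |α| * μ) ^ 2 := by gcongr
    nlinarith [sq_nonneg (a * ‖ω‖ - |α| * μ)]
  have hexp : H v v = h * ‖ω‖ ^ 2 - α * (H (A ω) m + H m (A ω)) + α ^ 2 * H m m := by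
    rw [hv, ← hA]
    simp only [map_sub, map_smul, sub_apply, smul_apply,
      smul_eq_mul]
    ring
  have hb1 : |H (A ω) m| ≤ Q * a * μ * ‖ω‖ := by
    refine (hHQ _ _).trans ?_
    have := mul_le_mul_of_nonneg_left (hAa ω) (mul_nonneg hQ0 hμ0)
    linarith
  have hb2 : |H m (A ω)| ≤ Q * a * μ * ‖ω‖ := by
    refine (hHQ _ _).trans ?_
    have := mul_le_mul_of_nonneg_left (hAa ω) (mul_nonneg hQ0 hμ0)
    linarith
  have hb3 : |H m m| ≤ Q * μ ^ 2 := (hHQ _ _).trans_eq (by ring)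
  have hcross : |α * (H (A ω) m + H m (A ω))| ≤ |α| * (2 * (Q * a * μ * ρ)) := by
    rw [abs_mul]
    gcongr
    have h5 : Q * a * μ * ‖ω‖ ≤ Q * a * μ * ρ := by gcongr
    exact (abs_add_le _ _).trans (by linarith)
  have hsq : |α ^ 2 * H m m| ≤ |α| * (ρ * (Q * μ ^ 2)) := by
    rw [abs_mul, abs_pow, sq, mul_assoc]
    gcongr
  have h6 : e₁ * ‖v‖ ^ 2 ≤ e * ‖ω‖ ^ 2 + |α| * (2 * e₁ * μ ^ 2 * ρ) := by
    have h7 := mul_le_mul_of_nonneg_left hv2 he₁0.le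
    have h8 := mul_le_mul_of_nonneg_right hea (sq_nonneg ‖ω‖)
    have h9 : e₁ * μ ^ 2 * |α| * |α| ≤ e₁ * μ ^ 2 * |α| * ρ := by gcongr
    linarith
  have h10 := mul_le_mul_of_nonneg_left hρ3 hα0
  have h11 : 0 ≤ |α| * (Q * μ ^ 2 * ρ) := by positivity
  have h12 : 0 ≤ |α| * ρ := by positivity
  have h13 := abs_le.1 (hρ v hvρ)
  rw [abs_le] at hcross hsq ⊢
  rw [hexp] at h13
  constructor <;> linarith [h13.1, h13.2, hcross.1, hcross.2, hsq.1, hsq.2]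

/-- Linear coordinates at a boundary point `x` of `S` in which `S` is osculated by the standard
paraboloid, together with the contragredient coordinates at the dual point `x'`. -/
structure IsFrame {d : ℕ} (S : Set (Euc (d + 1))) (x x' : Euc (d + 1))
    (N N' : (Euc d × ℝ) ≃ₗ[ℝ] Euc (d + 1)) (D : ℝ) : Prop where
  pos : 0 < D
  inner_apply : ∀ p q, ⟪N p, N' q⟫ = ⟪p.1, q.1⟫ + p.2 * q.2
  apply_base : N (0, -1) = x
  apply_base' : N' (0, -1) = x'
  volume_image : ∀ s, volume (N '' s) = ENNReal.ofReal D * volume s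
  volume_image' : ∀ s, volume (N' '' s) = ENNReal.ofReal D⁻¹ * volume s
  osculates : Osculates {p | x + N p ∈ S}

/-- Orthonormal coordinates `(v, b) ↦ L v - b • ν`. -/
theorem exists_volume_preserving_equiv {d : ℕ} (L : Euc d →ₗᵢ[ℝ] Euc (d + 1)) {ν : Euc (d + 1)}
    (hν : ‖ν‖ = 1) (hL : ∀ v, ⟪L v, ν⟫ = 0) :
    ∃ J : (Euc d × ℝ) ≃ₗ[ℝ] Euc (d + 1), (∀ p, J p = L p.1 - p.2 • ν) ∧
      ∀ s, volume (J '' s) = volume s := by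
  let F : WithLp 2 (Euc d × ℝ) →ₗᵢ[ℝ] Euc (d + 1) :=
    { toFun := fun p => L p.fst - p.snd • ν
      map_add' := fun p q => by simp [add_smul]; abel
      map_smul' := fun c p => by simp [mul_smul, smul_sub]
      norm_map' := fun p => by
        have h1 : ‖L p.fst - p.snd • ν‖ ^ 2 = ‖p‖ ^ 2 := by
          rw [norm_sub_sq_real, inner_smul_right, hL, WithLp.prod_norm_sq_eq_of_L2, norm_smul, hν,
            L.norm_map]
          simp
        exact (sq_eq_sq₀ (norm_nonneg _) (norm_nonneg _)).1 h1 }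
  have hfin : Module.finrank ℝ (WithLp 2 (Euc d × ℝ)) = Module.finrank ℝ (Euc (d + 1)) := by
    rw [(WithLp.linearEquiv 2 ℝ (Euc d × ℝ)).finrank_eq]
    simp
  let e := F.toLinearIsometryEquiv hfin
  let J : (Euc d × ℝ) ≃ₗ[ℝ] Euc (d + 1) :=
    (WithLp.linearEquiv 2 ℝ (Euc d × ℝ)).symm ≪≫ₗ e.toLinearEquiv
  have hmp : MeasurePreserving J volume volume :=
    e.measurePreserving.comp (WithLp.volume_preserving_toLp (Euc d) ℝ)
  refine ⟨J, fun p => rfl, fun s => ?_⟩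
  have hemb : MeasurableEmbedding J :=
    J.toContinuousLinearEquiv.toHomeomorph.measurableEmbedding
  rw [← hmp.measure_preimage_emb hemb, preimage_image_eq _ J.injective]

theorem exists_coordinates {d : ℕ} {L : Euc d →ₗᵢ[ℝ] Euc (d + 1)} {ν : Euc (d + 1)}
    (hν : ‖ν‖ = 1) (hL : ∀ v, ⟪L v, ν⟫ = 0) (m : Euc d) {h : ℝ} (hh : 0 < h)
    {A A' : Euc d →ₗ[ℝ] Euc d} (hAA' : ∀ p ω, ⟪A p, A' ω⟫ = ⟪p, ω⟫)
    (hdet : LinearMap.det A * LinearMap.det A' = 1) :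
    ∃ N N' : (Euc d × ℝ) ≃ₗ[ℝ] Euc (d + 1),
      (∀ p, N p = L (A p.1 - p.2 • m) - (p.2 * h) • ν) ∧
      (∀ p q, ⟪N p, N' q⟫ = ⟪p.1, q.1⟫ + p.2 * q.2) ∧
      (N' (0, -1) = h⁻¹ • ν) ∧
      (∀ s, volume (N '' s) = ENNReal.ofReal (|LinearMap.det A| * h) * volume s) ∧
      ∀ s, volume (N' '' s) = ENNReal.ofReal (|LinearMap.det A| * h)⁻¹ * volume s := by
  obtain ⟨J, hJ, hJv⟩ := exists_volume_preserving_equiv L hν hL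
  have hJi : ∀ p q, ⟪J p, J q⟫ = ⟪p.1, q.1⟫ + p.2 * q.2 := by
    intro p q
    have h1 : ∀ v, ⟪ν, L v⟫ = 0 := fun v => by rw [real_inner_comm, hL]
    rw [hJ, hJ]
    simp only [inner_sub_left, inner_sub_right, inner_smul_left, inner_smul_right, hL, h1,
      real_inner_self_eq_norm_sq, hν, L.inner_map_map, conj_trivial]
    ring
  have hA0 : LinearMap.det A ≠ 0 := left_ne_zero_of_mul_eq_one hdet
  set T : Euc d × ℝ →ₗ[ℝ] Euc d × ℝ :=
    LinearMap.transvection (LinearMap.snd ℝ (Euc d) ℝ) (-(h⁻¹ • m), 0) ∘ₗ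
      LinearMap.prodMap A (h • LinearMap.id) with hT
  set T' : Euc d × ℝ →ₗ[ℝ] Euc d × ℝ :=
    LinearMap.transvection (h⁻¹ • ((innerₗ (Euc d) m) ∘ₗ LinearMap.fst ℝ (Euc d) ℝ)) (0, 1) ∘ₗ
      LinearMap.prodMap A' (h⁻¹ • LinearMap.id) with hT'
  have hTa : ∀ p, T p = (A p.1 - p.2 • m, p.2 * h) := by
    intro p
    ext1
    · have h1 : h * p.2 * h⁻¹ = p.2 := by field_simp
      simp [hT, LinearMap.transvection, smul_smul, h1, sub_eq_add_neg]
    · simp [hT, LinearMap.transvection, mul_comm]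
  have hTa' : ∀ p, T' p = (A' p.1, h⁻¹ * (p.2 + ⟪m, A' p.1⟫)) := by
    intro p
    ext1
    · simp [hT', LinearMap.transvection]
    · simp [hT', LinearMap.transvection, mul_add]
  have hTd : LinearMap.det T = LinearMap.det A * h := by
    rw [hT, LinearMap.det_comp, LinearMap.transvection.det, LinearMap.det_prodMap]
    simp
  have hTd' : LinearMap.det T' = LinearMap.det A' * h⁻¹ := by
    rw [hT', LinearMap.det_comp, LinearMap.transvection.det, LinearMap.det_prodMap]
    simp
  have hA'0 : LinearMap.det A' ≠ 0 := right_ne_zero_of_mul_eq_one hdet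
  let N := LinearMap.equivOfDetNeZero T (by rw [hTd]; positivity) ≪≫ₗ J
  let N' := LinearMap.equivOfDetNeZero T' (by rw [hTd']; positivity) ≪≫ₗ J
  have hN : ∀ p, N p = J (T p) := fun p => rfl
  have hN' : ∀ p, N' p = J (T' p) := fun p => rfl
  refine ⟨N, N', fun p => ?_, fun p q => ?_, ?_, fun s => ?_, fun s => ?_⟩
  · rw [hN, hTa, hJ]
  · rw [hN, hN', hJi, hTa, hTa']
    simp only [inner_sub_left, inner_smul_left, hAA', conj_trivial]
    field_simp
    ring
  · rw [hN', hTa', hJ]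
    simp
  · rw [show (N '' s) = J '' (T '' s) by rw [image_image]; rfl, hJv,
      MeasureTheory.Measure.addHaar_image_linearMap, hTd, abs_mul, abs_of_pos hh]
  · have h3 : |LinearMap.det A'| = |LinearMap.det A|⁻¹ := by
      rw [← abs_inv, eq_inv_of_mul_eq_one_right hdet]
    rw [show (N' '' s) = J '' (T' '' s) by rw [image_image]; rfl, hJv,
      MeasureTheory.Measure.addHaar_image_linearMap, hTd', abs_mul, abs_inv, abs_of_pos hh, h3,
      mul_inv]

theorem IsSymConvexBody.neg_mem {n : ℕ} {S : Set (Euc n)} (hS : IsSymConvexBody S) {y : Euc n}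
    (hy : y ∈ S) : -y ∈ S := by
  rw [hS.2.2.2]
  simpa using hy

theorem IsSymConvexBody.exists_closedBall_subset {n : ℕ} {S : Set (Euc n)}
    (hS : IsSymConvexBody S) : ∃ r > 0, closedBall (0 : Euc n) r ⊆ S := by
  obtain ⟨z, hz⟩ := hS.2.2.1
  obtain ⟨r, hr, hrS⟩ := Metric.isOpen_iff.1 isOpen_interior z hz
  refine ⟨r / 2, by positivity, fun y hy => ?_⟩
  rw [mem_closedBall_zero_iff] at hy
  have h1 : z + y ∈ S := interior_subset (hrS (by simp; linarith))
  have h2 : -z ∈ S := hS.neg_mem (interior_subset hz)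
  have h4 : z - y ∈ S := interior_subset (hrS (by simp; linarith))
  have h3 : -(z - y) ∈ S := hS.neg_mem h4
  have hconv : Convex ℝ S := hS.2.1
  have := hconv h1 h3 (a := 1 / 2) (b := 1 / 2) (by norm_num) (by norm_num) (by norm_num)
  convert! this using 1
  module

theorem IsSymConvexBody.zero_mem {n : ℕ} {S : Set (Euc n)} (hS : IsSymConvexBody S) :
    (0 : Euc n) ∈ S := by
  obtain ⟨r, hr, h⟩ := hS.exists_closedBall_subset
  exact h (by simpa using hr.le)

theorem IsSymConvexBody.inner_normal_pos {n : ℕ} {S : Set (Euc n)} (hS : IsSymConvexBody S)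
    {x ν : Euc n} (hν : IsOuterNormalAt S x ν) : 0 < ⟪x, ν⟫ := by
  obtain ⟨r, hr, h⟩ := hS.exists_closedBall_subset
  have h1 := hν.2 (r • ν) (h (by simp [norm_smul, hν.1, abs_of_pos hr]))
  rw [inner_smul_left, real_inner_self_eq_norm_sq, hν.1] at h1
  simp at h1
  linarith

/-- Near a boundary point, `S` is the epigraph of a `C²` function. -/
theorem exists_graph_chart {d : ℕ} {S : Set (Euc (d + 1))} (hS : IsSymConvexBody S)
    {x ν : Euc (d + 1)} {κ : ℝ} (hx : x ∈ frontier S) (hν : IsOuterNormalAt S x ν)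
    (hg : IsGaussCurvatureAt S x ν κ) :
    ∃ (L : Euc d →ₗᵢ[ℝ] Euc (d + 1)) (f : Euc d → ℝ) (m : Euc d) (ε ρ : ℝ), 0 < ε ∧ 0 < ρ ∧
      (∀ v, ⟪L v, ν⟫ = 0) ∧ ContDiffAt ℝ 2 f 0 ∧ f 0 = 0 ∧ fderiv ℝ f 0 = 0 ∧
      x = ⟪x, ν⟫ • ν + L m ∧
      (∀ y ∈ frontier S, dist y x < ε → ∃ v, y = x + L v - f v • ν) ∧
      (∀ v b, ‖v‖ < ρ → |b| < ρ → (x + L v - b • ν ∈ S ↔ f v ≤ b)) ∧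
      κ = (Matrix.of fun i j : Fin d =>
        iteratedFDeriv ℝ 2 f 0 ![EuclideanSpace.single i 1, EuclideanSpace.single j 1]).det := by
  have hh := hS.inner_normal_pos hν
  set h := ⟪x, ν⟫ with hhdef
  have hcl : IsClosed S := hS.1.isClosed
  have hxS : x ∈ S := hcl.frontier_subset hx
  obtain ⟨L, f, τ, ε, hτ, hε, hL, hf, hf0, hf1, hgraph, hdet⟩ := hg
  change Euc d →ₗᵢ[ℝ] Euc (d + 1) at L
  change Euc d → ℝ at f
  have hfc : ContDiffAt ℝ 2 f 0 := hf.contDiffAt (ball_mem_nhds _ hτ)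
  have hfd : HasFDerivAt f (0 : Euc d →L[ℝ] ℝ) 0 := by
    have := (hfc.differentiableAt (by norm_num)).hasFDerivAt
    rwa [hf1] at this
  have hνν : ⟪ν, ν⟫ = 1 := by rw [real_inner_self_eq_norm_sq, hν.1]; norm_num
  obtain ⟨J, hJ, -⟩ := exists_volume_preserving_equiv L hν.1 hL
  obtain ⟨m, hxm⟩ : ∃ m, x = h • ν + L m := by
    refine ⟨(J.symm x).1, ?_⟩
    have h1 : x = L (J.symm x).1 - (J.symm x).2 • ν := by rw [← hJ, J.apply_symm_apply]
    have h2 : h = -(J.symm x).2 := by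
      rw [hhdef]
      nth_rewrite 1 [h1]
      rw [inner_sub_left, hL, inner_smul_left, hνν]
      simp
    nth_rewrite 1 [h1]
    rw [h2, neg_smul]
    abel
  obtain ⟨ρ₀, hρ₀, hρτ, hepi⟩ := exists_local_epigraph hS.2.1 hcl hh rfl hxm hS.zero_mem hxS hν.1
    hν.2 hL hτ hε hf.continuousOn hf0 hfd hgraph
  refine ⟨L, f, m, ε, ρ₀, hε, hρ₀, hL, hfc, hf0, hf1, hxm, fun y hy hyx => ?_, hepi, hdet⟩
  have h1 : y ∈ frontier S ∩ ball x ε := ⟨hy, hyx⟩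
  rw [hgraph] at h1
  obtain ⟨⟨v, -, hv⟩, -⟩ := h1
  exact ⟨v, hv⟩

theorem exists_isFrame {d : ℕ} {S : Set (Euc (d + 1))} (hS : IsSymConvexBody S)
    {x ν : Euc (d + 1)} {κ : ℝ} (hx : x ∈ frontier S) (hν : IsOuterNormalAt S x ν)
    (hg : IsGaussCurvatureAt S x ν κ) (hκ : 0 < κ) :
    ∃ x' N N', IsFrame S x x' N N' (√⟪x, ν⟫ ^ d / √κ * ⟪x, ν⟫) := by
  have hh := hS.inner_normal_pos hν
  set h := ⟪x, ν⟫ with hhdef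
  have hcl : IsClosed S := hS.1.isClosed
  have hxS : x ∈ S := hcl.frontier_subset hx
  obtain ⟨L, f, m, -, ρ₀, -, hρ₀, hL, hfc, hf0, hf1, hxm, -, hepi, hdet⟩ :=
    exists_graph_chart hS hx hν hg
  have hfd : HasFDerivAt f (0 : Euc d →L[ℝ] ℝ) 0 := by
    have := (hfc.differentiableAt (by norm_num)).hasFDerivAt
    rwa [hf1] at this
  have hνν : ⟪ν, ν⟫ = 1 := by rw [real_inner_self_eq_norm_sq, hν.1]; norm_num
  have hfpos : ∀ᶠ v in 𝓝 (0 : Euc d), 0 ≤ f v := by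
    have hev : ∀ᶠ v in 𝓝 (0 : Euc d), |f v| < ρ₀ := by
      have h1 : |f 0| < ρ₀ := by simpa [hf0] using hρ₀
      exact hfd.continuousAt.abs.eventually (Iio_mem_nhds h1)
    filter_upwards [hev, ball_mem_nhds _ hρ₀] with v hv1 hv2
    have h1 := (hepi v (f v) (by simpa using hv2) hv1).2 le_rfl
    have h2 := hν.2 _ h1
    rw [inner_sub_left, inner_add_left, hL, inner_smul_left, hνν] at h2
    simp at h2
    exact h2
  obtain ⟨A, A', hA, hAA', hAd, hAd'⟩ := exists_normalizing_map (fderiv ℝ (fderiv ℝ f) 0)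
    (fun v w => (hfc.isSymmSndFDerivAt (by simp)).eq v w) (hessian_nonneg hfc hf0 hf1 hfpos) hκ hh
    (by
      rw [hdet]
      congr 1
      ext i j
      rw [Matrix.of_apply, Matrix.of_apply, iteratedFDeriv_two_apply]
      rfl)
  obtain ⟨N, N', hN, hNN', hN'b, hNv, hNv'⟩ := exists_coordinates hν.1 hL m hh hAA' hAd'
  have hsκ : 0 < √κ := Real.sqrt_pos.2 hκ
  have hD : |LinearMap.det A| * h = √h ^ d / √κ * h := by
    rw [← hAd]
    field_simp
  rw [hD] at hNv hNv'
  have hNc : Continuous N := N.toContinuousLinearEquiv.continuous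
  have hxN : ∀ p, x + N p = x + L (A p.1 - p.2 • m) - (p.2 * h) • ν := fun p => by
    rw [hN]; abel
  have hxNi : ∀ p, ⟪x + N p, ν⟫ = h - p.2 * h := fun p => by
    rw [hxN, inner_sub_left, inner_add_left, hL, inner_smul_left, hνν]
    simp [hhdef]
  have hNb : N (0, -1) = x := by
    rw [hN]
    conv_rhs => rw [hxm]
    simp
    abel
  have hnn : ∀ p ∈ {p | x + N p ∈ S}, 0 ≤ p.2 := fun p hp => by
    have := hν.2 _ hp
    rw [hxNi] at this
    by_contra! hc
    nlinarith
  have hcA : Continuous A := A.continuous_of_finiteDimensional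
  have hclose : ∃ ρ > 0, ∀ (ω : Euc d) (α : ℝ), ‖ω‖ < ρ → |α| < ρ →
      (x + N (ω, α) ∈ S ↔ f (A ω - α • m) ≤ α * h) := by
    have hc : ContinuousAt (fun p : Euc d × ℝ => (‖A p.1 - p.2 • m‖, |p.2 * h|)) 0 :=
      Continuous.continuousAt (by fun_prop)
    have h1 : (Iio ρ₀ ×ˢ Iio ρ₀ : Set (ℝ × ℝ)) ∈
        𝓝 ((fun p : Euc d × ℝ => (‖A p.1 - p.2 • m‖, |p.2 * h|)) 0) := by
      refine (isOpen_Iio.prod isOpen_Iio).mem_nhds ?_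
      simpa using hρ₀
    obtain ⟨ρ, hρ, h2⟩ := Metric.eventually_nhds_iff_ball.1 (hc.eventually h1)
    refine ⟨ρ, hρ, fun ω α hω hα => ?_⟩
    have h3 := h2 (ω, α) (by simpa [Prod.norm_def] using ⟨hω, hα⟩)
    rw [hxN]
    exact hepi _ _ h3.1 h3.2
  obtain ⟨ρ₁, hρ₁, hmem⟩ := hclose
  refine ⟨h⁻¹ • ν, N, N', ⟨by positivity, hNN', hNb, hN'b, hNv, hNv', ?_⟩⟩
  refine ⟨?_, ?_, ?_, hnn, ?_, ?_, ?_, ?_⟩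
  · intro p hp q hq a b ha hb hab
    have := hS.2.1 hp hq ha hb hab
    simp only [mem_ofPred_eq, map_add, map_smul]
    convert! this using 1
    obtain rfl : b = 1 - a := by linarith
    module
  · exact hcl.preimage (by fun_prop)
  · simpa [Prod.mk_zero_zero] using hxS
  · intro p hp
    have := hν.2 _ (hS.neg_mem hp)
    rw [inner_neg_left, hxNi] at this
    by_contra! hc
    nlinarith
  · obtain ⟨R, hR, hRS⟩ := hS.exists_closedBall_subset
    have hc : ContinuousAt (fun ω : Euc d => ‖N (ω, 0)‖) 0 := Continuous.continuousAt (by fun_prop)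
    have h1 : Iio R ∈ 𝓝 ((fun ω : Euc d => ‖N (ω, 0)‖) 0) := by
      apply Iio_mem_nhds
      simpa [Prod.mk_zero_zero] using hR
    obtain ⟨r, hr, h2⟩ := Metric.eventually_nhds_iff_ball.1 (hc.eventually h1)
    refine ⟨r, hr, fun ω hω => ?_⟩
    have h3 := h2 ω (by simpa using hω)
    have h4 : x + N (ω, 1) = N (ω, 0) := by
      nth_rewrite 1 [← hNb]
      rw [← map_add]
      simp
    show x + N (ω, 1) ∈ S
    rw [h4]
    exact hRS (by simpa using le_of_lt h3)
  · intro e he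
    set c := h * e / (3 * (1 + e)) with hc
    have hc0 : 0 < c := by positivity
    have hc' : 3 * c * (1 + e) = h * e := by rw [hc]; field_simp
    obtain ⟨ρ, hρ, hest⟩ := exists_abs_sub_sq_le hfc hf0 hf1 A m hA hc0
    refine ⟨min ρ ρ₁, by positivity, fun ω α hω hα hωα => ?_⟩
    simp only [lt_min_iff] at hω hα
    have hα0 : 0 ≤ α := le_trans (by positivity) hωα
    have h1 := (abs_le.1 (hest ω α hω.1 (by rw [abs_of_nonneg hα0]; exact hα.1))).2
    rw [abs_of_nonneg hα0] at h1
    refine (hmem ω α hω.2 (by rw [abs_of_nonneg hα0]; exact hα.2)).2 ?_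
    have h3 : (h / 2 + c) * ((1 + e) * ‖ω‖ ^ 2) ≤ (h / 2 + c) * (2 * α) := by
      apply mul_le_mul_of_nonneg_left _ (by positivity)
      linarith
    have h4 : (1 + e) * f (A ω - α • m) ≤ (1 + e) * (α * h) := by
      have h5 : (1 + e) * f (A ω - α • m)
          ≤ (1 + e) * (h * ‖ω‖ ^ 2 / 2 + c * (‖ω‖ ^ 2 + α)) := by
        apply mul_le_mul_of_nonneg_left _ (by positivity)
        linarith
      have h6 : 3 * c * (1 + e) * α = h * e * α := by rw [hc']
      have h7 : 0 ≤ c * e * α := by positivity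
      linarith
    exact le_of_mul_le_mul_left h4 (by positivity)
  · intro e he
    set c := h * e / 3 with hc
    have hc0 : 0 < c := by positivity
    obtain ⟨ρ, hρ, hest⟩ := exists_abs_sub_sq_le hfc hf0 hf1 A m hA hc0
    refine ⟨min ρ ρ₁, by positivity, fun ω α hω hα hωα => ?_⟩
    simp only [lt_min_iff] at hω hα
    have hα0 : 0 ≤ α := hnn _ hωα
    have h1 := (abs_le.1 (hest ω α hω.1 (by rw [abs_of_nonneg hα0]; exact hα.1))).1
    rw [abs_of_nonneg hα0] at h1
    have h2 := (hmem ω α hω.2 (by rw [abs_of_nonneg hα0]; exact hα.2)).1 hωα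
    have h3 : (h - 2 * c) * ‖ω‖ ^ 2 ≤ 2 * (h + c) * α := by linarith
    have h5 : (1 - e) * (h + c) ≤ h - 2 * c := by
      rw [hc]
      nlinarith [mul_pos hh he, mul_pos (mul_pos hh he) he]
    have h6 := mul_le_mul_of_nonneg_right h5 (sq_nonneg ‖ω‖)
    have h7 : (h + c) * ((1 - e) * ‖ω‖ ^ 2 / 2) ≤ (h + c) * α := by linarith
    exact le_of_mul_le_mul_left h7 (by positivity)

namespace IsFrame

variable {d : ℕ} {S : Set (Euc (d + 1))} {x x' : Euc (d + 1)}
  {N N' : (Euc d × ℝ) ≃ₗ[ℝ] Euc (d + 1)} {D : ℝ}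

theorem inner_add (h : IsFrame S x x' N N' D) (p q : Euc d × ℝ) :
    ⟪x + N p, x' + N' q⟫ = (1 - p.2) * (1 - q.2) + ⟪p.1, q.1⟫ := by
  rw [← h.apply_base, ← h.apply_base', ← map_add, ← map_add, h.inner_apply]
  simp
  ring

theorem inner_base (h : IsFrame S x x' N N' D) (p : Euc d × ℝ) : ⟪x', x + N p⟫ = 1 - p.2 := by
  have := h.inner_add p 0
  rw [real_inner_comm]
  simpa using this

theorem smul_base (h : IsFrame S x x' N N' D) (t : ℝ) : x + N (0, t) = (1 - t) • x := by
  have : N (0, t) = -t • N (0, -1) := by rw [← map_smul]; simp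
  rw [this, h.apply_base]
  module

theorem exists_coord (x : Euc (d + 1)) (N : (Euc d × ℝ) ≃ₗ[ℝ] Euc (d + 1)) (y : Euc (d + 1)) :
    ∃ p, y = x + N p := ⟨N.symm (y - x), by simp⟩

theorem image_preimage (x : Euc (d + 1)) (N : (Euc d × ℝ) ≃ₗ[ℝ] Euc (d + 1))
    (T : Set (Euc (d + 1))) : (fun p => x + N p) '' {p | x + N p ∈ T} = T := by
  ext y
  constructor
  · rintro ⟨p, hp, rfl⟩
    exact hp
  · intro hy
    obtain ⟨p, rfl⟩ := exists_coord x N y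
    exact ⟨p, hy, rfl⟩

theorem volume_eq (h : IsFrame S x x' N N' D) (T : Set (Euc (d + 1))) :
    volume T = ENNReal.ofReal D * volume {p | x + N p ∈ T} := by
  rw [← h.volume_image]
  conv_lhs => rw [← image_preimage x N T]
  rw [show (fun p => x + N p) = (fun y => x + y) ∘ N from rfl, image_comp, image_add_left,
    measure_preimage_add]

theorem preimage_convexHull (x : Euc (d + 1)) (N : (Euc d × ℝ) ≃ₗ[ℝ] Euc (d + 1))
    (T : Set (Euc (d + 1))) :
    {p | x + N p ∈ convexHull ℝ T} = convexHull ℝ {p | x + N p ∈ T} := by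
  let φ : Euc d × ℝ →ᵃ[ℝ] Euc (d + 1) := N.toLinearMap.toAffineMap + AffineMap.const ℝ _ x
  have hφ : ∀ p, φ p = x + N p := fun p => by simp [φ, add_comm]
  have h1 : φ '' {p | x + N p ∈ T} = T := by
    rw [← image_preimage x N T]
    simp [hφ]
  have h2 := φ.image_convexHull {p | x + N p ∈ T}
  rw [h1] at h2
  have hinj : Function.Injective φ := fun p q hpq => by simpa [hφ] using hpq
  ext p
  rw [mem_ofPred_eq, ← h2, ← hφ]
  exact ⟨fun ⟨q, hq, he⟩ => hinj he ▸ hq, fun hp => ⟨p, hp, rfl⟩⟩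

theorem preimage_union_singleton (N : (Euc d × ℝ) ≃ₗ[ℝ] Euc (d + 1)) (p : Euc d × ℝ) :
    {q | x + N q ∈ S ∪ {x + N p}} = {q | x + N q ∈ S} ∪ {p} := by
  ext q
  simp

theorem volume_cap_le (h : IsFrame S x x' N N' D) (hd : 1 ≤ d) {η : ℝ} (hη : 0 < η) :
    ∃ t₀ > 0, ∀ t, 0 < t → t < t₀ → volume (S ∩ {y | 1 - t ≤ ⟪x', y⟫})
      ≤ ENNReal.ofReal (D * ((1 + η) * capConst d * √(2 * t) ^ (d + 2))) := by
  obtain ⟨t₀, ht₀, H⟩ := h.osculates.volume_cap_le hd hη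
  refine ⟨t₀, ht₀, fun t ht ht' => ?_⟩
  rw [h.volume_eq, ENNReal.ofReal_mul h.pos.le]
  gcongr
  convert! H t ht ht' using 2
  ext p
  have : 1 - t ≤ 1 - p.2 ↔ p.2 ≤ t := by constructor <;> intro <;> linarith
  simp only [mem_inter_iff, mem_ofPred_eq, h.inner_base, this]

theorem le_volume_halfspace (h : IsFrame S x x' N N' D) (hd : 1 ≤ d) {η : ℝ} (hη : 0 < η) :
    ∃ t₀ > 0, ∀ t, 0 < t → t < t₀ → ∀ (v : Euc (d + 1)) (c : ℝ), c ≤ ⟪v, (1 - t) • x⟫ →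
      ENNReal.ofReal (D * ((1 - η) * capConst d * √(2 * t) ^ (d + 2)))
        ≤ volume (S ∩ {y | c ≤ ⟪v, y⟫}) := by
  obtain ⟨t₀, ht₀, H⟩ := h.osculates.le_volume_halfspace hd hη
  refine ⟨t₀, ht₀, fun t ht ht' v c hc => ?_⟩
  rw [h.volume_eq, ENNReal.ofReal_mul h.pos.le]
  gcongr
  refine H t ht ht' {p | c ≤ ⟪v, x + N p⟫} fun p => ?_
  by_contra! hp
  simp only [mem_ofPred_eq, not_le] at hp
  rw [← h.smul_base] at hc
  have h1 : ⟪v, x + N (((0 : Euc d), t) + ((0 : Euc d), t) - p)⟫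
      = 2 * ⟪v, x + N (0, t)⟫ - ⟪v, x + N p⟫ := by
    rw [map_sub, map_add]
    simp only [inner_add_right, inner_sub_right]
    ring
  linarith [hp.1, hp.2]

theorem le_volume_cone (h : IsFrame S x x' N N' D) {η : ℝ} (hη : 0 < η) :
    ∃ t₀ > 0, ∀ t, 0 < t → t < t₀ → ∀ z, 1 + t ≤ ⟪x', z⟫ →
      volume S + ENNReal.ofReal (D * ((1 - η) * coneConst d * √(2 * t) ^ (d + 2)))
        ≤ volume (convexHull ℝ (S ∪ {z})) := by
  obtain ⟨t₀, ht₀, H⟩ := h.osculates.le_volume_cone hη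
  refine ⟨t₀, ht₀, fun t ht ht' z hz => ?_⟩
  obtain ⟨p, rfl⟩ := exists_coord x N z
  rw [h.inner_base] at hz
  rw [h.volume_eq (convexHull ℝ _), h.volume_eq S, ENNReal.ofReal_mul h.pos.le, ← mul_add,
    preimage_convexHull, preimage_union_singleton]
  gcongr
  exact H t ht ht' p (by linarith)

theorem volume_cone_le (h : IsFrame S x x' N N' D) {η : ℝ} (hη : 0 < η) :
    ∃ t₀ > 0, ∀ t, 0 < t → t < t₀ → volume (convexHull ℝ (S ∪ {(1 + t) • x}))
      ≤ volume S + ENNReal.ofReal (D * ((1 + η) * coneConst d * √(2 * t) ^ (d + 2))) := by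
  obtain ⟨t₀, ht₀, H⟩ := h.osculates.volume_cone_le hη
  refine ⟨t₀, ht₀, fun t ht ht' => ?_⟩
  rw [← sub_neg_eq_add, ← h.smul_base, h.volume_eq (convexHull ℝ _), h.volume_eq S,
    ENNReal.ofReal_mul h.pos.le, ← mul_add, preimage_convexHull, preimage_union_singleton]
  gcongr
  exact H t ht ht'

theorem preimage_polarBody (h : IsFrame S x x' N N' D) :
    {q | x' + N' q ∈ polarBody S} = dualRegion {p | x + N p ∈ S} := by
  ext q
  constructor
  · intro hq p hp
    rw [← h.inner_add]
    exact hq _ hp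
  · intro hq y hy
    obtain ⟨p, rfl⟩ := exists_coord x N y
    rw [h.inner_add]
    exact hq p hy

/-- The contragredient coordinates form a frame for the polar body. -/
theorem polar (h : IsFrame S x x' N N' D) (hS : IsSymConvexBody S) :
    IsFrame (polarBody S) x' x N' N D⁻¹ where
  pos := inv_pos.2 h.pos
  inner_apply p q := by
    rw [real_inner_comm, h.inner_apply, real_inner_comm, mul_comm]
  apply_base := h.apply_base'
  apply_base' := h.apply_base
  volume_image := h.volume_image'
  volume_image' := by simpa using h.volume_image
  osculates := by
    rw [h.preimage_polarBody]
    refine h.osculates.dualRegion ?_ ?_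
    · have h1 : {p | x + N p ∈ S} = (fun y => N.symm (y - x)) '' S := by
        ext p
        constructor
        · intro hp
          exact ⟨_, hp, by simp⟩
        · rintro ⟨y, hy, rfl⟩
          simpa using hy
      have hc : Continuous N.symm := N.symm.toContinuousLinearEquiv.continuous
      rw [h1]
      exact (hS.1.image (by fun_prop)).isBounded
    · have hx : x ∈ S := by simpa [Prod.mk_zero_zero] using h.osculates.zero_mem
      have := hS.neg_mem hx
      rw [mem_ofPred_eq, h.smul_base]
      convert! this using 1
      module

end IsFrame

section Polarity

variable {n : ℕ} {S K : Set (Euc n)}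

theorem closedBall_subset_polarBody {R : ℝ} (hR : 0 < R) (h : K ⊆ closedBall 0 R) :
    closedBall 0 R⁻¹ ⊆ polarBody K := fun y hy x hx => by
  have h1 := h hx
  rw [mem_closedBall_zero_iff] at h1 hy
  calc ⟪x, y⟫ ≤ ‖x‖ * ‖y‖ := real_inner_le_norm _ _
    _ ≤ R * R⁻¹ := by gcongr
    _ = 1 := mul_inv_cancel₀ hR.ne'

theorem polarBody_subset_closedBall {r : ℝ} (hr : 0 < r) (h : closedBall 0 r ⊆ K) :
    polarBody K ⊆ closedBall 0 r⁻¹ := fun y hy => by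
  rw [mem_closedBall_zero_iff]
  rcases eq_or_ne y 0 with rfl | hy0
  · simpa using hr.le
  have hn : 0 < ‖y‖ := norm_pos_iff.2 hy0
  have h1 := hy ((r / ‖y‖) • y) (h (by
    rw [mem_closedBall_zero_iff, norm_smul, Real.norm_eq_abs, abs_of_pos (by positivity),
      div_mul_cancel₀ _ hn.ne']))
  rw [inner_smul_left, real_inner_self_eq_norm_sq] at h1
  simp only [conj_trivial] at h1
  rw [← one_div, le_div_iff₀ hr]
  calc ‖y‖ * r = r / ‖y‖ * ‖y‖ ^ 2 := by field_simp
    _ ≤ 1 := h1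

theorem IsSymConvexBody.exists_subset_closedBall (hS : IsSymConvexBody S) :
    ∃ R > 0, S ⊆ closedBall 0 R := by
  obtain ⟨R, hR⟩ := hS.1.isBounded.subset_closedBall (0 : Euc n)
  exact ⟨max R 1, by positivity, hR.trans (closedBall_subset_closedBall (le_max_left _ _))⟩

theorem isClosed_polarBody (K : Set (Euc n)) : IsClosed (polarBody K) := by
  simp only [polarBody, ofPred_forall]
  exact isClosed_biInter fun p _ => isClosed_le (by fun_prop) continuous_const

theorem IsSymConvexBody.polarBody (hS : IsSymConvexBody S) : IsSymConvexBody (polarBody S) := by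
  obtain ⟨r, hr, hrS⟩ := hS.exists_closedBall_subset
  obtain ⟨R, hR, hRS⟩ := hS.exists_subset_closedBall
  refine ⟨?_, ?_, ?_, ?_⟩
  · exact (isCompact_closedBall 0 r⁻¹).of_isClosed_subset (isClosed_polarBody S)
      (polarBody_subset_closedBall hr hrS)
  · intro y hy z hz a b ha hb hab x hx
    rw [inner_add_right, inner_smul_right, inner_smul_right]
    nlinarith [mul_le_mul_of_nonneg_left (hy x hx) ha, mul_le_mul_of_nonneg_left (hz x hx) hb]
  · refine ⟨0, mem_interior.2 ⟨ball 0 R⁻¹, ?_, isOpen_ball, by simpa using hR⟩⟩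
    exact ball_subset_closedBall.trans (closedBall_subset_polarBody hR hRS)
  · ext y
    have h1 : ∀ y ∈ _root_.polarBody S, -y ∈ _root_.polarBody S := fun y hy x hx => by
      rw [inner_neg_right, ← inner_neg_left]
      exact hy _ (hS.neg_mem hx)
    exact ⟨h1 y, fun h => by simpa using h1 _ h⟩

/-- A point outside a symmetric convex body is strictly separated from it by a hyperplane. -/
theorem IsSymConvexBody.exists_separation (hS : IsSymConvexBody S) {z : Euc n} (hz : z ∉ S) :
    ∃ (v : Euc n) (c : ℝ), v ≠ 0 ∧ 0 < c ∧ (∀ y ∈ S, ⟪v, y⟫ < c) ∧ c < ⟪v, z⟫ := by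
  obtain ⟨f, c, h1, h2⟩ := geometric_hahn_banach_closed_point hS.2.1 hS.1.isClosed hz
  have hf : ∀ y, ⟪(InnerProductSpace.toDual ℝ (Euc n)).symm f, y⟫ = f y := fun y =>
    InnerProductSpace.toDual_symm_apply
  have hc : 0 < c := by simpa using h1 0 hS.zero_mem
  refine ⟨(InnerProductSpace.toDual ℝ (Euc n)).symm f, c, fun h0 => ?_, hc, fun y hy => ?_, ?_⟩
  · have := hf z
    rw [h0, inner_zero_left] at this
    linarith
  · rw [hf]
    exact h1 y hy
  · rwa [hf]

theorem IsSymConvexBody.polarBody_polarBody_subset (hS : IsSymConvexBody S) :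
    _root_.polarBody (_root_.polarBody S) ⊆ S := fun z hz => by
  by_contra h
  obtain ⟨v, c, -, hc, h1, h2⟩ := hS.exists_separation h
  have h3 := hz (c⁻¹ • v) fun x hx => by
    rw [inner_smul_right, real_inner_comm, inv_mul_le_iff₀ hc, mul_one]
    exact (h1 x hx).le
  rw [inner_smul_left, conj_trivial, inv_mul_le_iff₀ hc] at h3
  linarith

theorem IsSymConvexBody.floatingBody_subset (hS : IsSymConvexBody S) (δ : ℝ) :
    floatingBody S δ ⊆ S := fun z hz => by
  by_contra h
  obtain ⟨v, c, hv, -, h1, h2⟩ := hS.exists_separation h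
  simp only [floatingBody, mem_iInter] at hz
  have h3 := hz v hv c (by
    rw [show S ∩ {y | c ≤ ⟪v, y⟫} = ∅ from
      eq_empty_of_forall_notMem fun y hy => (h1 y hy.1).not_ge hy.2]
    simp)
  exact h2.not_ge h3

theorem polarBody_anti {K L : Set (Euc n)} (h : K ⊆ L) : polarBody L ⊆ polarBody K :=
  fun _ hy x hx => hy x (h hx)

theorem IsSymConvexBody.volume_pos (hS : IsSymConvexBody S) : 0 < (volume S).toReal :=
  ENNReal.toReal_pos (Measure.measure_pos_of_nonempty_interior _ hS.2.2.1).ne' hS.1.measure_lt_top.ne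

theorem IsSymConvexBody.ofReal_volume (hS : IsSymConvexBody S) :
    ENNReal.ofReal (volume S).toReal = volume S :=
  ENNReal.ofReal_toReal hS.1.measure_lt_top.ne

theorem IsSymConvexBody.subset_illuminationBody (hS : IsSymConvexBody S) {δ : ℝ} (hδ : 0 ≤ δ) :
    S ⊆ illuminationBody S δ := fun z hz => by
  show volume (convexHull ℝ (S ∪ {z})) ≤ _
  rw [union_eq_self_of_subset_right (singleton_subset_iff.2 hz), hS.2.1.convexHull_eq]
  refine le_mul_of_one_le_left' ?_
  rw [← ENNReal.ofReal_one]
  gcongr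
  linarith

theorem ball_subset_convexHull (hK : Convex ℝ K) {r : ℝ} (hr : 0 < r) (hrK : closedBall 0 r ⊆ K)
    (z : Euc n) {θ : ℝ} (h0 : 0 ≤ θ) (h1 : θ < 1) :
    ball (θ • z) ((1 - θ) * r) ⊆ convexHull ℝ (K ∪ {z}) := fun y hy => by
  have hl : 0 < 1 - θ := by linarith
  rw [mem_convexHull_union_singleton_iff hK ⟨0, hrK (by simpa using hr.le)⟩]
  refine ⟨(1 - θ)⁻¹ • (y - θ • z), hrK ?_, 1 - θ, hl.le, by linarith, ?_⟩
  · rw [mem_ball, dist_eq_norm] at hy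
    rw [mem_closedBall_zero_iff, norm_smul, Real.norm_eq_abs, abs_of_pos (inv_pos.2 hl),
      inv_mul_le_iff₀ hl]
    exact hy.le
  · rw [smul_smul, mul_inv_cancel₀ hl.ne']
    module

theorem IsSymConvexBody.exists_illuminationBody_subset_closedBall (hS : IsSymConvexBody S)
    (δ : ℝ) : ∃ R > 0, illuminationBody S δ ⊆ closedBall 0 R := by
  obtain ⟨r, hr, hrS⟩ := hS.exists_closedBall_subset
  set B := volume (ball (0 : Euc n) (r / 2)) with hB
  have hB0 : B ≠ 0 := (measure_ball_pos _ _ (by positivity)).ne'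
  obtain ⟨m, hm⟩ := ENNReal.exists_nat_mul_gt hB0
    (ENNReal.mul_ne_top (ENNReal.ofReal_ne_top (r := 1 + δ))
      (hS.1.measure_lt_top (μ := volume)).ne)
  have hm0 : 0 < (m : ℝ) := by
    rcases Nat.eq_zero_or_pos m with rfl | h
    · simp at hm
    · exact_mod_cast h
  refine ⟨2 * m * r, by positivity, fun z hz => ?_⟩
  by_contra h
  rw [mem_closedBall_zero_iff, not_le] at h
  have hz' : volume (convexHull ℝ (S ∪ {z})) ≤ _ := hz
  refine (hm.trans_le ?_).not_ge hz'
  set c : ℕ → Euc n := fun i => ((i : ℝ) / (2 * m)) • z with hc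
  have hsub : ∀ i ∈ Finset.range m, ball (c i) (r / 2) ⊆ convexHull ℝ (S ∪ {z}) := by
    intro i hi
    have hi : (i : ℝ) < m := by exact_mod_cast Finset.mem_range.1 hi
    have h2 : (i : ℝ) / (2 * m) < 1 / 2 := by
      rw [div_lt_iff₀ (by positivity)]
      linarith
    refine (ball_subset_ball ?_).trans
      (ball_subset_convexHull hS.2.1 hr hrS z (by positivity) (by linarith))
    nlinarith
  have hdisj : (Finset.range m : Set ℕ).PairwiseDisjoint fun i => ball (c i) (r / 2) := by
    intro i _ j _ hij
    apply ball_disjoint_ball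
    have h2 : (1 : ℝ) ≤ |(i : ℝ) - j| := by
      have h3 : (i : ℤ) - j ≠ 0 := by omega
      exact_mod_cast Int.one_le_abs h3
    rw [dist_eq_norm, hc, ← sub_smul, ← sub_div, norm_smul, Real.norm_eq_abs, abs_div,
      abs_of_pos (show (0 : ℝ) < 2 * m by positivity), add_halves, div_mul_eq_mul_div,
      le_div_iff₀ (by positivity)]
    have h3 := le_mul_of_one_le_left (norm_nonneg z) h2
    linarith
  calc (m : ENNReal) * B = ∑ i ∈ Finset.range m, volume (ball (c i) (r / 2)) := by
        simp [hB, Measure.addHaar_ball_center]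
    _ = volume (⋃ i ∈ Finset.range m, ball (c i) (r / 2)) :=
        (measure_biUnion_finset hdisj fun i _ => measurableSet_ball).symm
    _ ≤ _ := measure_mono (iUnion₂_subset hsub)

theorem IsSymConvexBody.exists_illuminationBody_subset (hS : IsSymConvexBody S) {ε : ℝ}
    (hε : 0 < ε) : ∃ δ > 0, ∀ z ∈ illuminationBody S δ, (1 + ε)⁻¹ • z ∈ S := by
  obtain ⟨r, hr, hrS⟩ := hS.exists_closedBall_subset
  set θ := 2 / (2 + ε) with hθ
  have hθ0 : 0 ≤ θ := by positivity
  have hθ1 : θ < 1 := by rw [hθ, div_lt_one (by positivity)]; linarith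
  have hθe : θ * (2 + ε) = 2 := by rw [hθ]; field_simp
  have hρ : 0 < (1 - θ) * r := mul_pos (by linarith) hr
  set B := volume (ball (0 : Euc n) ((1 - θ) * r)) with hB
  have hB0 : B ≠ 0 := (measure_ball_pos _ _ hρ).ne'
  have hBt : B ≠ ⊤ := measure_ball_lt_top.ne
  have hV := hS.volume_pos
  refine ⟨B.toReal / (2 * (volume S).toReal), div_pos (ENNReal.toReal_pos hB0 hBt) (by positivity),
    fun z hz => ?_⟩
  by_contra h
  obtain ⟨v, c, -, hc, h1, h2⟩ := hS.exists_separation h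
  rw [inner_smul_right, lt_inv_mul_iff₀ (by positivity)] at h2
  have hdisj : Disjoint S (ball (θ • z) ((1 - θ) * r)) := by
    rw [disjoint_left]
    intro y hy hyb
    have h3 : (1 - θ)⁻¹ • (y - θ • z) ∈ S := hrS (by
      rw [mem_ball, dist_eq_norm] at hyb
      rw [mem_closedBall_zero_iff, norm_smul, Real.norm_eq_abs,
        abs_of_pos (inv_pos.2 (by linarith)), inv_mul_le_iff₀ (by linarith)]
      exact hyb.le)
    have h4 := h1 _ (hS.neg_mem h3)
    rw [inner_neg_right, inner_smul_right, inner_sub_right, inner_smul_right, ← mul_neg,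
      inv_mul_lt_iff₀ (by linarith)] at h4
    have h5 := h1 y hy
    nlinarith [mul_le_mul_of_nonneg_left h2.le hθ0]
  have h3 : volume S + B ≤ volume (convexHull ℝ (S ∪ {z})) := by
    rw [hB, ← Measure.addHaar_ball_center volume (θ • z), ← measure_union hdisj measurableSet_ball]
    refine measure_mono (union_subset (subset_union_left.trans (subset_convexHull ℝ _)) ?_)
    exact ball_subset_convexHull hS.2.1 hr hrS z hθ0 hθ1
  have h4 : volume S + B ≤ _ := h3.trans hz
  have hBp := ENNReal.toReal_pos hB0 hBt
  rw [← hS.ofReal_volume, ← ENNReal.ofReal_toReal hBt, ← ENNReal.ofReal_add hV.le hBp.le,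
    ← ENNReal.ofReal_mul (by positivity), ENNReal.ofReal_le_ofReal_iff (by positivity)] at h4
  rw [ENNReal.toReal_ofReal hBp.le, ENNReal.toReal_ofReal hV.le] at h4
  have h5 : (1 + B.toReal / (2 * (volume S).toReal)) * (volume S).toReal
      = (volume S).toReal + B.toReal / 2 := by field_simp
  linarith

end Polarity

/-- First order Taylor estimate, uniform in the base point. -/
theorem exists_uniform_taylor {d : ℕ} {f : Euc d → ℝ} (hf : ContDiffAt ℝ 2 f 0)
    (h1 : fderiv ℝ f 0 = 0) :
    ∃ M ≥ 1, ∃ ρ > 0, ∀ v w : Euc d, ‖v‖ < ρ → ‖v + w‖ < ρ →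
      ‖fderiv ℝ f v‖ ≤ M * ‖v‖ ∧ f (v + w) ≤ f v + fderiv ℝ f v w + M * ‖w‖ ^ 2 := by
  have hd : ContDiffAt ℝ 1 (fderiv ℝ f) 0 := hf.fderiv_right (by norm_num)
  obtain ⟨K, t, ht, hK⟩ := hd.exists_lipschitzOnWith
  have hdiff : ∀ᶠ v in 𝓝 (0 : Euc d), DifferentiableAt ℝ f v :=
    (hf.eventually (by simp)).mono fun v hv => hv.differentiableAt (by norm_num)
  obtain ⟨ρ, hρ, h⟩ := Metric.eventually_nhds_iff_ball.1 (hdiff.and ht)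
  have hlip : ∀ v ∈ ball (0 : Euc d) ρ, ∀ w ∈ ball (0 : Euc d) ρ,
      ‖fderiv ℝ f w - fderiv ℝ f v‖ ≤ max (K : ℝ) 1 * ‖w - v‖ := fun v hv w hw =>
    (hK.norm_sub_le (h w hw).2 (h v hv).2).trans (by gcongr; exact le_max_left _ _)
  refine ⟨max K 1, le_max_right _ _, ρ, hρ, fun v w hv hw => ⟨?_, ?_⟩⟩
  · simpa [h1] using hlip 0 (by simpa using hρ) v (by simpa using hv)
  · have hvb : v ∈ ball (0 : Euc d) ρ := by simpa using hv
    have hwb : v + w ∈ ball (0 : Euc d) ρ := by simpa using hw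
    have hseg : segment ℝ v (v + w) ⊆ ball (0 : Euc d) ρ :=
      (convex_ball _ _).segment_subset hvb hwb
    have := (convex_segment v (v + w)).norm_image_sub_le_of_norm_hasFDerivWithin_le'
      (f := f) (f' := fderiv ℝ f) (φ := fderiv ℝ f v) (C := max (K : ℝ) 1 * ‖w‖)
      (fun z hz => (h z (hseg hz)).1.hasFDerivAt.hasFDerivWithinAt)
      (fun z hz => (hlip v hvb z (hseg hz)).trans (by
        gcongr
        have := norm_sub_le_of_mem_segment hz
        simpa using this))
      (left_mem_segment ℝ v (v + w)) (right_mem_segment ℝ v (v + w))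
    rw [add_sub_cancel_left] at this
    have h2 := (abs_le.1 this).2
    nlinarith

theorem volume_le_two_mul_volume_halfspace {d : ℕ} {S : Set (Euc (d + 1))} {z : Euc (d + 1)}
    {J : (Euc d × ℝ) ≃ₗ[ℝ] Euc (d + 1)} (hJ : ∀ s, volume (J '' s) = volume s)
    {B : Set (Euc d × ℝ)} (hB : ∀ p ∈ B, -p ∈ B) (hBS : ∀ p ∈ B, z + J p ∈ S)
    {a : Euc (d + 1)} {c : ℝ} (hac : c ≤ ⟪a, z⟫) :
    volume B ≤ 2 * volume (S ∩ {y | c ≤ ⟪a, y⟫}) := by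
  have h1 := measure_le_two_mul_of_symmetric volume (B := B) (H := {p | c ≤ ⟪a, z + J p⟫})
    (z := 0) (fun p hp => by simpa using hB p hp) (fun p => by
      by_contra! hp
      simp only [mem_ofPred_eq, not_le, add_zero, zero_sub, map_neg, inner_add_right,
        inner_neg_right] at hp
      linarith [hp.1, hp.2])
  refine h1.trans ?_
  gcongr
  rw [← hJ, ← measure_preimage_add volume (-z)]
  refine measure_mono ?_
  rintro q ⟨p, ⟨hpB, hpH⟩, hpq⟩
  obtain rfl : q = z + J p := by simp [hpq]
  exact ⟨hBS p hpB, hpH⟩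

theorem exists_local_halfspace_bound {d : ℕ} {S : Set (Euc (d + 1))} (hS : IsSymConvexBody S)
    {x ν : Euc (d + 1)} {κ : ℝ} (hx : x ∈ frontier S) (hν : IsOuterNormalAt S x ν)
    (hg : IsGaussCurvatureAt S x ν κ) :
    ∃ ε > 0, ∃ A > 0, ∃ t₀ > 0, ∀ y ∈ frontier S, dist y x < ε → ∀ t, 0 < t → t < t₀ →
      ∃ z, ‖z - y‖ ≤ t ∧ ∀ (v : Euc (d + 1)) (c : ℝ), c ≤ ⟪v, z⟫ →
        ENNReal.ofReal (A * √t ^ (d + 2)) ≤ volume (S ∩ {y | c ≤ ⟪v, y⟫}) := by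
  obtain ⟨L, f, m, ε, ρ, hε, hρ, hL, hfc, hf0, hf1, -, hgraph, hepi, -⟩ :=
    exists_graph_chart hS hx hν hg
  obtain ⟨J, hJ, hJv⟩ := exists_volume_preserving_equiv L hν.1 hL
  obtain ⟨M, hM, ρ₁, hρ₁, htay⟩ := exists_uniform_taylor hfc hf1
  have hνν : ⟪ν, ν⟫ = 1 := by rw [real_inner_self_eq_norm_sq, hν.1]; norm_num
  set ω := volume.real (ball (0 : Euc d) 1) with hω
  have hω0 : 0 < ω :=
    ENNReal.toReal_pos (measure_ball_pos volume _ one_pos).ne' measure_ball_lt_top.ne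
  set e := min 1 (min (ρ / 8) (min (ρ₁ / 4) (1 / M))) with he
  have he0 : 0 < e := by positivity
  have he1 : e ≤ 1 := min_le_left _ _
  have he2 : e ≤ ρ / 8 := (min_le_right _ _).trans (min_le_left _ _)
  have he3 : e ≤ ρ₁ / 4 := (min_le_right _ _).trans ((min_le_right _ _).trans (min_le_left _ _))
  have he4 : M * e ≤ 1 := by
    rw [mul_comm, ← le_div_iff₀ (by positivity)]
    exact (min_le_right _ _).trans ((min_le_right _ _).trans (min_le_right _ _))
  refine ⟨min ε e, by positivity, (ω / (2 * M) ^ d) / 2, by positivity, e ^ 2, by positivity,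
    fun y hy hyx t ht ht0 => ?_⟩
  simp only [lt_min_iff] at hyx
  obtain ⟨v, hv⟩ := hgraph y hy hyx.1
  have hyxv : y - x = L v - f v • ν := by rw [hv]; abel
  have hvf : ‖v‖ ^ 2 + f v ^ 2 = ‖y - x‖ ^ 2 := by
    rw [hyxv, norm_sub_sq_real, inner_smul_right, hL, norm_smul, hν.1, L.norm_map]
    simp
  have hyx2 : ‖y - x‖ < e := by rw [← dist_eq_norm]; exact hyx.2
  have hve : ‖v‖ < e := lt_of_le_of_lt
    (abs_le_of_sq_le_sq' (by nlinarith [sq_nonneg (f v)]) (norm_nonneg _)).2 hyx2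
  have hfe : |f v| < e := lt_of_le_of_lt
    (abs_le_of_sq_le_sq (by nlinarith [sq_nonneg ‖v‖]) (norm_nonneg _)) hyx2
  have hst : √t ^ 2 = t := Real.sq_sqrt ht.le
  have hst0 : 0 < √t := Real.sqrt_pos.2 ht
  have hste : √t < e := (Real.sqrt_lt' he0).2 ht0
  set R := √t / (2 * M) with hR
  have hR0 : 0 < R := by positivity
  have hRt : R * (2 * M) = √t := by rw [hR]; field_simp
  set ℓ := fderiv ℝ f v with hℓ
  set B := closedRegion (closedBall (0 : Euc d) R) (fun w => ℓ w - t / 2) (fun w => ℓ w + t / 2)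
    with hB
  set z := y - t • ν with hz
  refine ⟨z, ?_, fun a c hac => ?_⟩
  · rw [hz, sub_sub_cancel_left, norm_neg, norm_smul, hν.1, Real.norm_eq_abs, abs_of_pos ht,
      mul_one]
  have hBS : ∀ p ∈ B, z + J p ∈ S := by
    rintro ⟨w, b⟩ ⟨hw, hb1, hb2⟩
    simp only [mem_closedBall_zero_iff] at hw hb1 hb2
    have e1 : z + J (w, b) = x + L (v + w) - (f v + t + b) • ν := by
      rw [hz, hv, hJ, map_add]
      module
    have hwt : ‖w‖ ≤ √t := hw.trans (by nlinarith)
    have hvw : ‖v + w‖ < 2 * e := (norm_add_le _ _).trans_lt (by linarith)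
    obtain ⟨h1, h2⟩ := htay v w (by linarith) (by linarith)
    have hℓw : |ℓ w| ≤ e := by
      calc |ℓ w| ≤ ‖ℓ‖ * ‖w‖ := ℓ.le_opNorm w
        _ ≤ (M * e) * e := by
          gcongr
          · exact h1.trans (by gcongr)
          · linarith
        _ ≤ 1 * e := by gcongr
        _ = e := one_mul e
    have hte : t ≤ e := by nlinarith
    rw [abs_le] at hℓw
    rw [abs_lt] at hfe
    rw [e1]
    refine (hepi _ _ (by linarith) (by rw [abs_lt]; constructor <;> linarith)).2 ?_
    have h3 : M * ‖w‖ ^ 2 ≤ t / 2 := by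
      have h4 : ‖w‖ ^ 2 ≤ R ^ 2 := by gcongr
      have h5 : M * R ^ 2 * (4 * M) = t := by rw [← hst, ← hRt]; ring
      have h6 : M * ‖w‖ ^ 2 ≤ M * R ^ 2 := by gcongr
      have h7 : M * R ^ 2 * (4 * 1) ≤ M * R ^ 2 * (4 * M) := by gcongr
      linarith
    linarith
  have hvol : volume B = ENNReal.ofReal (2 * (ω / (2 * M) ^ d / 2 * √t ^ (d + 2))) := by
    rw [hB, volume_closedRegion_eq_ofReal (isCompact_closedBall _ _) (by fun_prop) (by fun_prop)
      (fun w _ => by linarith)]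
    congr 1
    have : ∀ w, ℓ w + t / 2 - (ℓ w - t / 2) = t := fun w => by ring
    simp only [this]
    rw [setIntegral_const, smul_eq_mul, measureReal_def, Measure.addHaar_closedBall _ _ hR0.le,
      ENNReal.toReal_mul, ENNReal.toReal_ofReal (by positivity)]
    simp only [finrank_euclideanSpace, Fintype.card_fin]
    rw [← measureReal_def, ← hω, hR, div_pow, pow_add, hst]
    ring
  have hneg : ∀ p ∈ B, -p ∈ B := by
    rintro ⟨w, b⟩ ⟨hw, hb1, hb2⟩
    simp only at hw hb1 hb2
    refine ⟨by simpa using hw, ?_, ?_⟩ <;> simp only [Prod.neg_mk, map_neg] <;> linarith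
  have h2 := volume_le_two_mul_volume_halfspace hJv hneg hBS hac
  rw [hvol, ENNReal.ofReal_mul (by norm_num), ENNReal.ofReal_ofNat] at h2
  exact (ENNReal.mul_le_mul_iff_right (by norm_num) (by norm_num)).1 h2

theorem exists_uniform_halfspace_bound {d : ℕ} {S : Set (Euc (d + 1))} (hS : IsSymConvexBody S)
    {u : Euc (d + 1) → Euc (d + 1)} {κ : Euc (d + 1) → ℝ} (hC2 : IsC2Body S u κ) :
    ∃ A > 0, ∃ t₀ > 0, ∀ y ∈ frontier S, ∀ t, 0 < t → t < t₀ →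
      ∃ z, ‖z - y‖ ≤ t ∧ ∀ (v : Euc (d + 1)) (c : ℝ), c ≤ ⟪v, z⟫ →
        ENNReal.ofReal (A * √t ^ (d + 2)) ≤ volume (S ∩ {y | c ≤ ⟪v, y⟫}) := by
  have hc : IsCompact (frontier S) :=
    hS.1.of_isClosed_subset isClosed_frontier hS.1.isClosed.frontier_subset
  refine hc.induction_on (p := fun T => ∃ A > 0, ∃ t₀ > 0, ∀ y ∈ T, ∀ t, 0 < t → t < t₀ →
    ∃ z, ‖z - y‖ ≤ t ∧ ∀ (v : Euc (d + 1)) (c : ℝ), c ≤ ⟪v, z⟫ →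
        ENNReal.ofReal (A * √t ^ (d + 2)) ≤ volume (S ∩ {y | c ≤ ⟪v, y⟫})) ?_ ?_ ?_ ?_
  · exact ⟨1, one_pos, 1, one_pos, by simp⟩
  · rintro T T' hT ⟨A, hA, t₀, ht₀, h⟩
    exact ⟨A, hA, t₀, ht₀, fun y hy => h y (hT hy)⟩
  · rintro T T' ⟨A, hA, t₀, ht₀, h⟩ ⟨A', hA', t₀', ht₀', h'⟩
    refine ⟨min A A', by positivity, min t₀ t₀', by positivity, ?_⟩
    rintro y (hy | hy) t ht htt <;> simp only [lt_min_iff] at htt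
    · obtain ⟨z, hz, H⟩ := h y hy t ht htt.1
      refine ⟨z, hz, fun v c hvc => le_trans ?_ (H v c hvc)⟩
      gcongr
      exact min_le_left _ _
    · obtain ⟨z, hz, H⟩ := h' y hy t ht htt.2
      refine ⟨z, hz, fun v c hvc => le_trans ?_ (H v c hvc)⟩
      gcongr
      exact min_le_right _ _
  · intro x hx
    obtain ⟨ε, hε, A, hA, t₀, ht₀, h⟩ :=
      exists_local_halfspace_bound hS hx (hC2 x hx).1 (hC2 x hx).2
    exact ⟨frontier S ∩ ball x ε, inter_mem self_mem_nhdsWithin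
      (mem_nhdsWithin_of_mem_nhds (ball_mem_nhds x hε)), A, hA, t₀, ht₀,
      fun y hy => h y hy.1 hy.2⟩

theorem mem_frontier_of_isMaxOn_inner {n : ℕ} {S : Set (Euc n)} {v y : Euc n} (hv : v ≠ 0)
    (hy : y ∈ S) (hmax : ∀ z ∈ S, ⟪v, z⟫ ≤ ⟪v, y⟫) : y ∈ frontier S := by
  refine ⟨subset_closure hy, fun hi => ?_⟩
  obtain ⟨r, hr, h⟩ := Metric.isOpen_iff.1 isOpen_interior y hi
  have hn : 0 < ‖v‖ := norm_pos_iff.2 hv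
  have h1 := hmax (y + (r / 2 / ‖v‖) • v) (interior_subset (h (by
    rw [mem_ball, dist_eq_norm, add_sub_cancel_left, norm_smul, Real.norm_eq_abs,
      abs_of_pos (by positivity), div_mul_cancel₀ _ hn.ne']
    linarith)))
  rw [inner_add_right, inner_smul_right, real_inner_self_eq_norm_sq] at h1
  have : 0 < r / 2 / ‖v‖ * ‖v‖ ^ 2 := by positivity
  linarith

theorem exists_smul_mem_floatingBody {d : ℕ} {S : Set (Euc (d + 1))} (hS : IsSymConvexBody S)
    {u : Euc (d + 1) → Euc (d + 1)} {κ : Euc (d + 1) → ℝ} (hC2 : IsC2Body S u κ) :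
    ∃ C > 0, ∃ s₀ > 0, ∀ s, 0 < s → s < s₀ → ∀ y ∈ S,
      (1 - C * s) • y ∈ floatingBody S (√s ^ (d + 2)) := by
  obtain ⟨A, hA, t₀, ht₀, h⟩ := exists_uniform_halfspace_bound hS hC2
  obtain ⟨r, hr, hrS⟩ := hS.exists_closedBall_subset
  have hV := hS.volume_pos
  set V := (volume S).toReal with hVdef
  set q := V / A + 1 with hq
  have hq1 : 1 ≤ q := by rw [hq]; linarith [show 0 < V / A by positivity]
  have hAq : V < A * q ^ (d + 2) := by
    have h1 : q ≤ q ^ (d + 2) := le_self_pow₀ hq1 (by omega)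
    have h2 : A * q = V + A := by rw [hq]; field_simp
    have h3 : A * q ≤ A * q ^ (d + 2) := by gcongr
    linarith
  have hC : 0 < q ^ 2 / r := by positivity
  refine ⟨q ^ 2 / r, hC, min (t₀ / q ^ 2) (1 / (q ^ 2 / r)), by positivity, fun s hs hs' y hy => ?_⟩
  simp only [lt_min_iff] at hs'
  have hCs : q ^ 2 / r * s ≤ 1 := by
    rw [lt_div_iff₀ hC] at hs'
    linarith [hs'.2]
  have ht : q ^ 2 * s < t₀ := by
    rw [lt_div_iff₀ (by positivity)] at hs'
    linarith [hs'.1]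
  simp only [floatingBody, mem_iInter, mem_ofPred_eq]
  intro v hv c hc
  obtain ⟨y₀, hy₀, hmax⟩ := hS.1.exists_isMaxOn ⟨_, hS.zero_mem⟩
    (f := fun y => ⟪v, y⟫) (by fun_prop)
  have hmax' : ∀ z ∈ S, ⟪v, z⟫ ≤ ⟪v, y₀⟫ := fun z hz => hmax hz
  have hn : 0 < ‖v‖ := norm_pos_iff.2 hv
  have hsupp : r * ‖v‖ ≤ ⟪v, y₀⟫ := by
    have h1 := hmax' ((r / ‖v‖) • v) (hrS (by
      rw [mem_closedBall_zero_iff, norm_smul, Real.norm_eq_abs, abs_of_pos (by positivity),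
        div_mul_cancel₀ _ hn.ne']))
    rw [inner_smul_right, real_inner_self_eq_norm_sq] at h1
    calc r * ‖v‖ = r / ‖v‖ * ‖v‖ ^ 2 := by field_simp
      _ ≤ _ := h1
  obtain ⟨z, hz, H⟩ := h y₀ (mem_frontier_of_isMaxOn_inner hv hy₀ hmax') (q ^ 2 * s)
    (by positivity) ht
  have hzc : ⟪v, z⟫ < c := by
    by_contra! hcz
    have h1 := (H v c hcz).trans hc
    rw [← hS.ofReal_volume, ← ENNReal.ofReal_mul (by positivity),
      ENNReal.ofReal_le_ofReal_iff (by positivity), Real.sqrt_mul (by positivity),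
      Real.sqrt_sq (by linarith), mul_pow, ← mul_assoc, mul_comm] at h1
    exact absurd (le_of_mul_le_mul_left h1 (by positivity)) (not_le.2 hAq)
  have hzy : ⟪v, y₀⟫ - q ^ 2 * s * ‖v‖ ≤ ⟪v, z⟫ := by
    have h1 := (abs_le.1 (abs_real_inner_le_norm v (z - y₀))).1
    rw [inner_sub_right] at h1
    have h2 : ‖v‖ * ‖z - y₀‖ ≤ ‖v‖ * (q ^ 2 * s) := by gcongr
    linarith
  rw [inner_smul_right]
  have h1 : (1 - q ^ 2 / r * s) * ⟪v, y⟫ ≤ (1 - q ^ 2 / r * s) * ⟪v, y₀⟫ :=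
    mul_le_mul_of_nonneg_left (hmax' y hy) (by linarith)
  have h2 : q ^ 2 / r * s * (r * ‖v‖) ≤ q ^ 2 / r * s * ⟪v, y₀⟫ := by gcongr
  have h3 : q ^ 2 / r * s * (r * ‖v‖) = q ^ 2 * s * ‖v‖ := by field_simp
  linarith

theorem Gfun_pos {d : ℕ} {S : Set (Euc (d + 1))} (hS : IsSymConvexBody S)
    {u : Euc (d + 1) → Euc (d + 1)} {κ : Euc (d + 1) → ℝ} {x : Euc (d + 1)}
    (hh : 0 < ⟪x, u x⟫) (hκ : 0 < κ x) : 0 < Gfun S u κ x := by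
  have hω : 0 < (volume (ball (0 : Euc d) 1)).toReal :=
    ENNReal.toReal_pos (measure_ball_pos volume _ one_pos).ne' measure_ball_lt_top.ne
  have hV := hS.volume_pos
  have hc : 0 < cConst (d + 1) S := mul_pos (by positivity) (Real.rpow_pos_of_pos (div_pos hV hω) _)
  exact div_pos (mul_pos hc (Real.rpow_pos_of_pos hκ _)) hh

theorem Gfun_identity {d : ℕ} (hd : 1 ≤ d) {S : Set (Euc (d + 1))} (hS : IsSymConvexBody S)
    {u : Euc (d + 1) → Euc (d + 1)} {κ : Euc (d + 1) → ℝ} {x : Euc (d + 1)}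
    (hh : 0 < ⟪x, u x⟫) (hκ : 0 < κ x) :
    √⟪x, u x⟫ ^ d / √(κ x) * ⟪x, u x⟫ * capConst d * √(2 * Gfun S u κ x) ^ (d + 2)
      = (volume S).toReal := by
  set h := ⟪x, u x⟫ with hhdef
  set k := κ x with hk
  have hω : 0 < volume.real (ball (0 : Euc d) 1) :=
    ENNReal.toReal_pos (measure_ball_pos volume _ one_pos).ne' measure_ball_lt_top.ne
  set ω := volume.real (ball (0 : Euc d) 1) with hωdef
  have hV := hS.volume_pos
  set V := (volume S).toReal with hVdef
  have hsh : 0 < √h := Real.sqrt_pos.2 hh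
  have hsk : 0 < √k := Real.sqrt_pos.2 hκ
  set P : ℝ := (d + 2) * (V / ω) * √k with hP
  have hP0 : 0 < P := by positivity
  have h1 : 2 * Gfun S u κ x = (P ^ ((1 : ℝ) / (d + 2)) / √h) ^ 2 := by
    have e1 : (((d + 1 : ℕ) : ℝ) + 1) = d + 2 := by push_cast; ring
    have e2 : 2 * Gfun S u κ x = (((d : ℝ) + 2) ^ ((2 : ℝ) / (d + 2)) *
        (V / ω) ^ ((2 : ℝ) / (d + 2))) * k ^ ((1 : ℝ) / (d + 2)) / h := by
      rw [Gfun, cConst, e1]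
      change 2 * (((d : ℝ) + 2) ^ ((2 : ℝ) / (d + 2)) / 2 * (V / ω) ^ ((2 : ℝ) / (d + 2))
        * k ^ ((1 : ℝ) / (d + 2)) / h) = _
      ring
    have e3 : k ^ ((1 : ℝ) / (d + 2)) = √k ^ ((2 : ℝ) / (d + 2)) := by
      rw [Real.sqrt_eq_rpow, ← Real.rpow_mul hκ.le]
      congr 1
      ring
    rw [e2, e3, ← Real.mul_rpow (by positivity) (by positivity),
      ← Real.mul_rpow (by positivity) (by positivity), ← hP, div_pow, Real.sq_sqrt hh.le,
      ← Real.rpow_natCast, ← Real.rpow_mul hP0.le]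
    congr 2
    push_cast
    ring
  have h2 : (P ^ ((1 : ℝ) / (d + 2))) ^ (d + 2) = P := by
    rw [← Real.rpow_natCast, ← Real.rpow_mul hP0.le]
    push_cast
    rw [one_div_mul_cancel (by positivity), Real.rpow_one]
  rw [h1, Real.sqrt_sq (by positivity), div_pow, h2, capConst_eq hd, ← hωdef, hP]
  have h3 : √h ^ (d + 2) = √h ^ d * h := by rw [pow_add, Real.sq_sqrt hh.le]
  rw [h3]
  field_simp

theorem sqrt_rpow_pow {d : ℕ} {δ : ℝ} (hδ : 0 < δ) :
    √(δ ^ ((2 : ℝ) / (((d + 1 : ℕ) : ℝ) + 1))) ^ (d + 2) = δ := by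
  rw [Real.sqrt_eq_rpow, ← Real.rpow_mul hδ.le, ← Real.rpow_natCast, ← Real.rpow_mul hδ.le]
  push_cast
  rw [show (2 : ℝ) / (d + 1 + 1) * (1 / 2) * (d + 2) = 1 by field_simp; ring, Real.rpow_one]

/-- The set over which the infimum in `bodyDist` is taken is nonempty as soon as both sets are
bounded and contain a ball around the origin. -/
theorem exists_dilation {n : ℕ} {C₁ C₂ : Set (Euc n)} {r₁ r₂ R : ℝ} (h₁ : 0 < r₁) (h₂ : 0 < r₂)
    (hR : 0 < R) (hr₁ : closedBall 0 r₁ ⊆ C₁) (hr₂ : closedBall 0 r₂ ⊆ C₂)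
    (hR₁ : C₁ ⊆ closedBall 0 R) (hR₂ : C₂ ⊆ closedBall 0 R) :
    {a : ℝ | 1 ≤ a ∧ a⁻¹ • C₁ ⊆ C₂ ∧ C₂ ⊆ a • C₁}.Nonempty := by
  set a := max 1 (max (R / r₁) (R / r₂)) with ha
  have ha0 : 0 < a := by positivity
  have ha1 : R ≤ a * r₁ := (div_le_iff₀ h₁).1 ((le_max_left _ _).trans (le_max_right _ _))
  have ha2 : R ≤ a * r₂ := (div_le_iff₀ h₂).1 ((le_max_right _ _).trans (le_max_right _ _))
  have key : ∀ (r : ℝ) (y : Euc n), R ≤ a * r → y ∈ closedBall (0 : Euc n) R →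
      a⁻¹ • y ∈ closedBall (0 : Euc n) r := fun r y hr hy => by
    rw [mem_closedBall_zero_iff] at hy ⊢
    rw [norm_smul, Real.norm_eq_abs, abs_of_pos (inv_pos.2 ha0), inv_mul_le_iff₀ ha0]
    exact hy.trans hr
  refine ⟨a, le_max_left _ _, ?_, fun y hy => ?_⟩
  · rintro _ ⟨y, hy, rfl⟩
    exact hr₂ (key _ _ ha2 (hR₁ hy))
  · exact ⟨a⁻¹ • y, hr₁ (key _ _ ha1 (hR₂ hy)), smul_inv_smul₀ ha0.ne' y⟩

theorem bodyDist_nonneg {n : ℕ} (C₁ C₂ : Set (Euc n)) : 0 ≤ bodyDist C₁ C₂ :=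
  Real.sInf_nonneg fun _ ha => zero_le_one.trans ha.1

theorem bodyDist_le {n : ℕ} {C₁ C₂ : Set (Euc n)} {a : ℝ} (h1 : 1 ≤ a) (h2 : a⁻¹ • C₁ ⊆ C₂)
    (h3 : C₂ ⊆ a • C₁) : bodyDist C₁ C₂ ≤ a :=
  csInf_le ⟨1, fun _ h => h.1⟩ ⟨h1, h2, h3⟩

theorem IsSymConvexBody.polar_illumination_subset {n : ℕ} {S : Set (Euc n)}
    (hS : IsSymConvexBody S) {δ : ℝ} (hδ : 0 ≤ δ) :
    _root_.polarBody (illuminationBody (_root_.polarBody S) δ) ⊆ S :=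
  (polarBody_anti (hS.polarBody.subset_illuminationBody hδ)).trans hS.polarBody_polarBody_subset

theorem dualDist_le {n : ℕ} (S : Set (Euc n)) {δ δ' : ℝ} (hδ' : 0 < δ') :
    dualDist S δ ≤ bodyDist (floatingBody S δ)
      (polarBody (illuminationBody (polarBody S) δ')) :=
  csInf_le ⟨0, by rintro _ ⟨δ', -, rfl⟩; exact bodyDist_nonneg _ _⟩ ⟨δ', hδ', rfl⟩

theorem exists_dualDist_le {d : ℕ} {S : Set (Euc (d + 1))} (hS : IsSymConvexBody S)
    {u : Euc (d + 1) → Euc (d + 1)} {κ : Euc (d + 1) → ℝ} (hC2 : IsC2Body S u κ) :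
    ∃ M, ∃ s₀ > 0, ∀ s, 0 < s → s < s₀ → dualDist S (√s ^ (d + 2)) ≤ 1 + M * s := by
  obtain ⟨C, hC, s₀, hs₀, h⟩ := exists_smul_mem_floatingBody hS hC2
  refine ⟨2 * C + 2, min s₀ (1 / (2 * C)), by positivity, fun s hs hs' => ?_⟩
  simp only [lt_min_iff] at hs'
  have hCs : C * s < 1 / 2 := by
    rw [lt_div_iff₀ (by positivity)] at hs'
    linarith [hs'.2]
  obtain ⟨δ', hδ', hill⟩ := hS.polarBody.exists_illuminationBody_subset hs
  refine (dualDist_le S hδ').trans ?_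
  have hl : 0 < 1 - C * s := by linarith
  have hCs0 : 0 < C * s := by positivity
  have hscale : ∀ (c : ℝ) (y : Euc (d + 1)), 0 ≤ c → c ≤ 1 → y ∈ S → c • y ∈ S :=
    fun c y h0 h1 hy => hS.2.1.smul_mem_of_zero_mem hS.zero_mem hy ⟨h0, h1⟩
  have hi0 : 0 < (1 + s)⁻¹ := by positivity
  have hi1 : (1 + s)⁻¹ ≤ 1 := inv_le_one_of_one_le₀ (by linarith)
  have ha : ((1 + s) / (1 - C * s))⁻¹ = (1 - C * s) * (1 + s)⁻¹ := by rw [inv_div]; rfl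
  refine (bodyDist_le (a := (1 + s) / (1 - C * s)) ?_ ?_ ?_).trans ?_
  · rw [le_div_iff₀ hl]
    linarith
  · rintro _ ⟨y, hy, rfl⟩ z hz
    show ⟪z, ((1 + s) / (1 - C * s))⁻¹ • y⟫ ≤ 1
    have h1 := hill z hz _ (hscale (1 - C * s) y hl.le (by linarith)
      (hS.floatingBody_subset _ hy))
    rw [ha, mul_comm, mul_smul, inner_smul_right, real_inner_comm, ← inner_smul_right]
    exact h1
  · intro y hy
    refine ⟨((1 + s) / (1 - C * s))⁻¹ • y, ?_, smul_inv_smul₀ (by positivity) y⟩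
    show ((1 + s) / (1 - C * s))⁻¹ • y ∈ _
    rw [ha, mul_smul]
    exact h s hs hs'.1 _ (hscale _ y hi0.le hi1 (hS.polar_illumination_subset hδ'.le hy))
  · rw [div_le_iff₀ hl]
    nlinarith [mul_pos hs hC]

theorem sqrt_scale_pow {a g s : ℝ} (ha : 0 ≤ a) (hg : 0 ≤ g) (k : ℕ) :
    √(2 * (a * g * s)) ^ k = √a ^ k * (√(2 * g) ^ k * √s ^ k) := by
  rw [← mul_pow, ← mul_pow, ← Real.sqrt_mul (by positivity), ← Real.sqrt_mul ha]
  congr 2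
  ring

theorem le_sqrt_pow {a : ℝ} (ha : 1 ≤ a) (d : ℕ) : a ≤ √a ^ (d + 2) := by
  have h1 : 1 ≤ √a := Real.one_le_sqrt.2 ha
  have h2 : √a ^ 2 ≤ √a ^ (d + 2) := pow_le_pow_right₀ h1 (by omega)
  rwa [Real.sq_sqrt (by linarith)] at h2

theorem sqrt_pow_le {a : ℝ} (h0 : 0 ≤ a) (ha : a ≤ 1) (d : ℕ) : √a ^ (d + 2) ≤ a := by
  have h1 : √a ≤ 1 := Real.sqrt_le_one.2 ha
  have h2 : √a ^ (d + 2) ≤ √a ^ 2 := pow_le_pow_of_le_one (Real.sqrt_nonneg _) h1 (by omega)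
  rwa [Real.sq_sqrt h0] at h2

theorem dilation_set_nonempty {d : ℕ} {S : Set (Euc (d + 1))} (hS : IsSymConvexBody S)
    {l Δ δ : ℝ} (hl : 1 / 2 < l) (hfl : ∀ y ∈ S, l • y ∈ floatingBody S Δ) (hδ : 0 < δ) :
    {a : ℝ | 1 ≤ a ∧ a⁻¹ • floatingBody S Δ ⊆ polarBody (illuminationBody (polarBody S) δ) ∧
      polarBody (illuminationBody (polarBody S) δ) ⊆ a • floatingBody S Δ}.Nonempty := by
  obtain ⟨r, hr, hrS⟩ := hS.exists_closedBall_subset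
  obtain ⟨R, hR, hRS⟩ := hS.exists_subset_closedBall
  obtain ⟨ρ, hρ, hρS⟩ := hS.polarBody.exists_illuminationBody_subset_closedBall δ
  refine exists_dilation (r₁ := r / 2) (r₂ := ρ⁻¹) (by positivity) (by positivity) hR ?_
    (closedBall_subset_polarBody hρ hρS) ((hS.floatingBody_subset Δ).trans hRS)
    ((hS.polar_illumination_subset hδ.le).trans hRS)
  intro z hz
  rw [mem_closedBall_zero_iff] at hz
  have hl0 : 0 < l := by linarith
  have hlr : 1 / 2 * r ≤ l * r := mul_le_mul_of_nonneg_right hl.le hr.le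
  have hmem : l⁻¹ • z ∈ S := by
    apply hrS
    rw [mem_closedBall_zero_iff, norm_smul, Real.norm_eq_abs, abs_of_pos (inv_pos.2 hl0),
      inv_mul_le_iff₀ hl0]
    linarith
  have h := hfl _ hmem
  rwa [smul_inv_smul₀ hl0.ne'] at h

theorem exists_le_bodyDist {d : ℕ} (hd : 1 ≤ d) {S : Set (Euc (d + 1))} (hS : IsSymConvexBody S)
    {u : Euc (d + 1) → Euc (d + 1)} {κ : Euc (d + 1) → ℝ} (hC2 : IsC2Body S u κ)
    {x x' y y' : Euc (d + 1)} {N N' M M' : (Euc d × ℝ) ≃ₗ[ℝ] Euc (d + 1)} {D E g γ η : ℝ}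
    (hx : IsFrame S x x' N N' D) (hy : IsFrame S y y' M M' E) (hg : 0 < g) (hγ : 0 < γ)
    (hDg : D * capConst d * √(2 * g) ^ (d + 2) = (volume S).toReal)
    (hEγ : E * capConst d * √(2 * γ) ^ (d + 2) = (volume S).toReal)
    (hη : 0 < η) (hη1 : η < 1) :
    ∃ s₀ > 0, ∀ s, 0 < s → s < s₀ → ∀ δ > 0,
      (1 - (1 + η) * γ * s) * (1 + (1 - η) * g * s)
        ≤ bodyDist (floatingBody S (√s ^ (d + 2)))
          (polarBody (illuminationBody (polarBody S) δ)) := by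
  have hP := hS.polarBody
  have hη4 : 0 < η / 4 := by positivity
  obtain ⟨t₁, ht₁, cap⟩ := hx.volume_cap_le hd hη4
  obtain ⟨t₂, ht₂, half⟩ := hy.le_volume_halfspace hd hη4
  obtain ⟨t₃, ht₃, cone⟩ := (hx.polar hS).le_volume_cone hη4
  obtain ⟨t₄, ht₄, cone'⟩ := (hy.polar hS).volume_cone_le hη4
  obtain ⟨C, hC, s₅, hs₅, hfl⟩ := exists_smul_mem_floatingBody hS hC2
  have ha : 0 < 1 - η := by linarith
  have hb : 0 < 1 + η := by linarith
  have hV := hS.volume_pos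
  have hW := hP.volume_pos
  set V := (volume S).toReal with hVdef
  set W := (volume (polarBody S)).toReal with hWdef
  have hD := hx.pos
  have hE := hy.pos
  have hcap := capConst_pos hd
  have hcone := coneConst_pos d
  set cg := (1 - η) * g with hcg
  set cγ := (1 + η) * γ with hcγ
  have hcg0 : 0 < cg := by positivity
  have hcγ0 : 0 < cγ := by positivity
  refine ⟨min (min (min (t₁ / cg) (t₂ / cγ)) (min (t₃ / cγ) (t₄ / cg)))
    (min (min s₅ (1 / (2 * C))) (min (1 / cg) (1 / cγ))), by positivity, fun s hs hs' δ hδ => ?_⟩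
  simp only [lt_min_iff, lt_div_iff₀ hcg0, lt_div_iff₀ hcγ0,
    lt_div_iff₀ (show 0 < 2 * C by positivity)] at hs'
  obtain ⟨⟨⟨h1, h2⟩, h3, h4⟩, ⟨h5, h6⟩, h7, h8⟩ := hs'
  have ht0 : 0 < cg * s := by positivity
  have hτ0 : 0 < cγ * s := by positivity
  set t := cg * s with ht
  set τ := cγ * s with hτ
  have ht1 : t < 1 := by linarith
  have hτ1 : τ < 1 := by linarith
  set Δ := √s ^ (d + 2) with hΔ
  have hΔ0 : 0 < Δ := by positivity
  have et : √(2 * t) ^ (d + 2) = √(1 - η) ^ (d + 2) * (√(2 * g) ^ (d + 2) * Δ) := by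
    rw [ht, hcg, sqrt_scale_pow ha.le hg.le]
  have eτ : √(2 * τ) ^ (d + 2) = √(1 + η) ^ (d + 2) * (√(2 * γ) ^ (d + 2) * Δ) := by
    rw [hτ, hcγ, sqrt_scale_pow hb.le hγ.le]
  have hup : 1 < (1 - η / 4) * √(1 + η) ^ (d + 2) := by
    have := mul_le_mul_of_nonneg_left (le_sqrt_pow (by linarith : (1 : ℝ) ≤ 1 + η) d)
      (by linarith : 0 ≤ 1 - η / 4)
    nlinarith only [this, hη, hη1]
  have hdown : (1 + η / 4) * √(1 - η) ^ (d + 2) ≤ 1 := by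
    have := mul_le_mul_of_nonneg_left (sqrt_pow_le ha.le (by linarith) d)
      (by linarith : 0 ≤ 1 + η / 4)
    nlinarith only [this, hη, hη1]
  have hfloat : ∀ z ∈ floatingBody S Δ, ⟪x', z⟫ ≤ 1 - t := by
    intro z hz
    simp only [floatingBody, mem_iInter] at hz
    refine hz x' ?_ (1 - t) ((cap t ht0 (by linarith)).trans ?_)
    · rintro rfl
      have := hx.inner_base 0
      simp at this
    · rw [← hS.ofReal_volume, ← ENNReal.ofReal_mul hΔ0.le, et]
      apply ENNReal.ofReal_le_ofReal
      calc D * ((1 + η / 4) * capConst d * (√(1 - η) ^ (d + 2) * (√(2 * g) ^ (d + 2) * Δ)))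
          = (1 + η / 4) * √(1 - η) ^ (d + 2)
            * (D * capConst d * √(2 * g) ^ (d + 2) * Δ) := by ring
        _ ≤ 1 * (V * Δ) := by rw [hDg]; gcongr
        _ = Δ * V := by ring
  have hmem : (1 - τ) • y ∈ floatingBody S Δ := by
    simp only [floatingBody, mem_iInter, mem_ofPred_eq]
    intro v hv c hc
    by_contra! hlt
    have h9 := (half τ hτ0 (by linarith) v c hlt.le).trans hc
    rw [← hS.ofReal_volume, ← ENNReal.ofReal_mul hΔ0.le,
      ENNReal.ofReal_le_ofReal_iff (by positivity), eτ] at h9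
    have : E * ((1 - η / 4) * capConst d * (√(1 + η) ^ (d + 2) * (√(2 * γ) ^ (d + 2) * Δ)))
        = (1 - η / 4) * √(1 + η) ^ (d + 2) * (V * Δ) := by rw [← hEγ]; ring
    rw [this] at h9
    have h10 := mul_lt_mul_of_pos_right hup (mul_pos hV hΔ0)
    linarith only [h9, h10]
  have hne := dilation_set_nonempty hS (by linarith : 1 / 2 < 1 - C * s) (hfl s hs h5) hδ
  refine le_csInf hne ?_
  rintro a ⟨ha1, haS, hSa⟩
  have ha0 : 0 < a := by linarith
  set B := coneConst d * V * Δ / (D * E * capConst d) with hB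
  have hB0 : 0 < B := by positivity
  rcases lt_or_ge (δ * W) ((1 - η / 4) * √(1 + η) ^ (d + 2) * B) with hcase | hcase
  · have hxC : (1 + τ)⁻¹ • x ∈ polarBody (illuminationBody (polarBody S) δ) := by
      intro z hz
      rw [inner_smul_right, inv_mul_le_iff₀ (by positivity), mul_one, real_inner_comm]
      by_contra! hlt
      have h9 := (cone τ hτ0 (by linarith) z hlt.le).trans hz
      rw [← hP.ofReal_volume, ← ENNReal.ofReal_add hW.le
        (by have : 0 < 1 - η / 4 := by linarith
            positivity), ← ENNReal.ofReal_mul (by positivity),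
        ENNReal.ofReal_le_ofReal_iff (by positivity), eτ] at h9
      have : D⁻¹ * ((1 - η / 4) * coneConst d * (√(1 + η) ^ (d + 2) * (√(2 * γ) ^ (d + 2) * Δ)))
          = (1 - η / 4) * √(1 + η) ^ (d + 2) * B := by
        rw [hB, ← hEγ]
        field_simp
      rw [this] at h9
      linarith only [h9, hcase]
    obtain ⟨z, hz, hzx⟩ := hSa hxC
    have h9 : (1 + τ)⁻¹ = a * ⟪x', z⟫ := by
      have hzx : a • z = (1 + τ)⁻¹ • x := hzx
      have h10 : ⟪x', x⟫ = 1 := by simpa using hx.inner_base 0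
      rw [← inner_smul_right, hzx, inner_smul_right, h10, mul_one]
    have h10 : (1 + τ)⁻¹ ≤ a * (1 - t) := by
      rw [h9]
      exact mul_le_mul_of_nonneg_left (hfloat z hz) ha0.le
    rw [inv_le_iff_one_le_mul₀ (by positivity)] at h10
    calc (1 - τ) * (1 + t) ≤ (1 - τ) * (1 + t) * (a * (1 - t) * (1 + τ)) :=
          le_mul_of_one_le_right (mul_nonneg (by linarith) (by linarith)) h10
      _ = a * ((1 - τ ^ 2) * (1 - t ^ 2)) := by ring
      _ ≤ a * (1 * 1) := by
        have ht2 : 0 ≤ 1 - t ^ 2 := by nlinarith only [ht0, ht1]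
        have hτ2 : 0 ≤ 1 - τ ^ 2 := by nlinarith only [hτ0, hτ1]
        exact mul_le_mul_of_nonneg_left (mul_le_mul (by linarith only [sq_nonneg τ])
          (by linarith only [sq_nonneg t]) ht2 zero_le_one) ha0.le
      _ = a := by ring
  · have hyI : (1 + t) • y' ∈ illuminationBody (polarBody S) δ := by
      refine (cone' t ht0 (by linarith)).trans ?_
      rw [← hP.ofReal_volume, ← ENNReal.ofReal_add hW.le (by positivity),
        ← ENNReal.ofReal_mul (by positivity)]
      apply ENNReal.ofReal_le_ofReal
      rw [et]
      have : E⁻¹ * ((1 + η / 4) * coneConst d * (√(1 - η) ^ (d + 2) * (√(2 * g) ^ (d + 2) * Δ)))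
          = (1 + η / 4) * √(1 - η) ^ (d + 2) * B := by
        rw [hB, ← hDg]
        field_simp
      rw [this]
      have h9 := mul_le_mul_of_nonneg_right (hdown.trans hup.le) hB0.le
      linarith only [h9, hcase]
    have h9 := haS ⟨_, hmem, rfl⟩ _ hyI
    have h10 : ⟪y', y⟫ = 1 := by simpa using hy.inner_base 0
    simp only [inner_smul_right, inner_smul_left, h10, conj_trivial, mul_one] at h9
    rw [inv_mul_le_iff₀ ha0, mul_one] at h9
    linarith

theorem IsSymConvexBody.frontier_nonempty {d : ℕ} {S : Set (Euc (d + 1))}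
    (hS : IsSymConvexBody S) : (frontier S).Nonempty := by
  set v : Euc (d + 1) := EuclideanSpace.single 0 1 with hv
  have hv0 : v ≠ 0 := by
    intro h
    have h1 : ‖v‖ = 1 := by simp [hv]
    rw [h, norm_zero] at h1
    exact zero_ne_one h1
  obtain ⟨y, hy, hmax⟩ := hS.1.exists_isMaxOn ⟨0, hS.zero_mem⟩
    (f := fun z => ⟪v, z⟫) (by fun_prop)
  exact ⟨y, mem_frontier_of_isMaxOn_inner hv0 hy fun z hz => hmax hz⟩

theorem exists_le_dualDist {d : ℕ} (hd : 1 ≤ d) {S : Set (Euc (d + 1))} (hS : IsSymConvexBody S)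
    {u : Euc (d + 1) → Euc (d + 1)} {κ : Euc (d + 1) → ℝ} (hC2 : IsC2Body S u κ)
    (hκ : ∀ x ∈ frontier S, 0 < κ x) {x y : Euc (d + 1)} (hx : x ∈ frontier S)
    (hy : y ∈ frontier S) {e : ℝ} (he : 0 < e) :
    ∃ s₀ > 0, ∀ s, 0 < s → s < s₀ →
      Gfun S u κ x - Gfun S u κ y - e ≤ (dualDist S (√s ^ (d + 2)) - 1) / s := by
  obtain ⟨hνx, hgx⟩ := hC2 x hx
  obtain ⟨hνy, hgy⟩ := hC2 y hy
  obtain ⟨x', N, N', hfx⟩ := exists_isFrame hS hx hνx hgx (hκ x hx)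
  obtain ⟨y', M, M', hfy⟩ := exists_isFrame hS hy hνy hgy (hκ y hy)
  have hhx := hS.inner_normal_pos hνx
  have hhy := hS.inner_normal_pos hνy
  have hg := Gfun_pos hS hhx (hκ x hx)
  have hγ := Gfun_pos hS hhy (hκ y hy)
  have hDg := Gfun_identity hd hS hhx (hκ x hx)
  have hEγ := Gfun_identity hd hS hhy (hκ y hy)
  set g := Gfun S u κ x
  set γ := Gfun S u κ y
  set η := min (1 / 2) (e / (2 * (g + γ))) with hηdef
  have hη : 0 < η := by positivity
  have hη1 : η < 1 := (min_le_left _ _).trans_lt (by norm_num)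
  have hηe : η * (g + γ) ≤ e / 2 := by
    have h1 : η ≤ e / (2 * (g + γ)) := min_le_right _ _
    rw [le_div_iff₀ (by positivity)] at h1
    linarith
  obtain ⟨s₀, hs₀, h⟩ := exists_le_bodyDist hd hS hC2 hfx hfy hg hγ hDg hEγ hη hη1
  refine ⟨min s₀ (e / (2 * (g * γ))), by positivity, fun s hs hs' => ?_⟩
  rw [lt_min_iff, lt_div_iff₀ (by positivity)] at hs'
  have hle : (1 - (1 + η) * γ * s) * (1 + (1 - η) * g * s) ≤ dualDist S (√s ^ (d + 2)) := by
    refine le_csInf ⟨_, 1, one_pos, rfl⟩ ?_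
    rintro _ ⟨δ', hδ', rfl⟩
    exact h s hs hs'.1 δ' hδ'
  rw [le_div_iff₀ hs]
  have h1 : (1 - η ^ 2) * (g * γ * s) ≤ e / 2 := by
    have h2 : (1 - η ^ 2) * (g * γ * s) ≤ 1 * (g * γ * s) :=
      mul_le_mul_of_nonneg_right (by linarith only [sq_nonneg η]) (by positivity)
    linarith only [h2, hs'.2]
  have h3 : (η * (g + γ) + (1 - η ^ 2) * (g * γ * s)) * s ≤ e * s :=
    mul_le_mul_of_nonneg_right (by linarith only [h1, hηe]) hs.le
  linarith only [hle, h3]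

theorem tendsto_rpow_nhdsGT_zero {p : ℝ} (hp : 0 < p) :
    Tendsto (fun δ : ℝ => δ ^ p) (𝓝[>] 0) (𝓝[>] 0) := by
  refine tendsto_nhdsWithin_iff.2 ⟨?_, ?_⟩
  · have h := (Real.continuousAt_rpow_const 0 p (Or.inr hp.le)).tendsto
    rw [Real.zero_rpow hp.ne'] at h
    exact h.mono_left nhdsWithin_le_nhds
  · filter_upwards [self_mem_nhdsWithin] with δ hδ
    exact Real.rpow_pos_of_pos hδ p

/-- Transfer of a statement about all small `s` to the scale `s = δ ^ (2 / (n + 1))`. -/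
theorem eventually_of_scale {d : ℕ} {P : ℝ → ℝ → Prop} {s₀ : ℝ} (hs₀ : 0 < s₀)
    (h : ∀ s, 0 < s → s < s₀ → P (√s ^ (d + 2)) s) :
    ∀ᶠ δ : ℝ in 𝓝[>] 0, P δ (δ ^ ((2 : ℝ) / (((d + 1 : ℕ) : ℝ) + 1))) := by
  have h1 := tendsto_rpow_nhdsGT_zero (p := (2 : ℝ) / (((d + 1 : ℕ) : ℝ) + 1)) (by positivity)
  filter_upwards [self_mem_nhdsWithin, h1.eventually (Ioo_mem_nhdsGT hs₀)] with δ hδ hs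
  have h2 := h _ hs.1 hs.2
  rwa [sqrt_rpow_pow hδ] at h2

/-- Proposition 4.2: for `S` of class `C²₊`,
`liminf_{δ→0} (d_S(δ) − 1)/δ^{2/(n+1)} ≥ G_max − G_min`. -/
theorem statement9 {n : ℕ} (hn : 2 ≤ n) (S : Set (Euc n))
    (u : Euc n → Euc n) (κ : Euc n → ℝ)
    (hS : IsSymConvexBody S) (hC2 : IsC2Body S u κ)
    (hκ : ∀ x ∈ frontier S, 0 < κ x) :
    sSup (Gfun S u κ '' frontier S) - sInf (Gfun S u κ '' frontier S)
      ≤ liminf (fun δ : ℝ => (dualDist S δ - 1) / δ ^ ((2:ℝ)/(n+1))) (𝓝[>] 0) := by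
  obtain ⟨d, rfl⟩ : ∃ d, n = d + 1 := ⟨n - 1, by omega⟩
  have hd : 1 ≤ d := by omega
  set l := liminf (fun δ : ℝ => (dualDist S δ - 1) / δ ^ ((2:ℝ)/(((d + 1 : ℕ) : ℝ)+1))) (𝓝[>] 0)
    with hl
  obtain ⟨M, s₁, hs₁, hM⟩ := exists_dualDist_le hS hC2
  have hbdd : ∀ᶠ δ : ℝ in 𝓝[>] 0,
      (dualDist S δ - 1) / δ ^ ((2:ℝ)/(((d + 1 : ℕ) : ℝ)+1)) ≤ M :=
    eventually_of_scale (P := fun δ s => (dualDist S δ - 1) / s ≤ M) hs₁ fun s hs hs' => by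
      rw [div_le_iff₀ hs]
      linarith [hM s hs hs']
  have hcob : IsCoboundedUnder (· ≥ ·) (𝓝[>] (0 : ℝ))
      fun δ : ℝ => (dualDist S δ - 1) / δ ^ ((2:ℝ)/(((d + 1 : ℕ) : ℝ)+1)) :=
    IsBoundedUnder.isCoboundedUnder_ge ⟨M, hbdd⟩
  have key : ∀ x ∈ frontier S, ∀ y ∈ frontier S, Gfun S u κ x - Gfun S u κ y ≤ l := by
    intro x hx y hy
    refine le_of_forall_pos_sub_le fun e he => ?_
    obtain ⟨s₀, hs₀, h⟩ := exists_le_dualDist hd hS hC2 hκ hx hy he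
    exact le_liminf_of_le hcob (eventually_of_scale
      (P := fun δ s => Gfun S u κ x - Gfun S u κ y - e ≤ (dualDist S δ - 1) / s) hs₀ h)
  have hne := hS.frontier_nonempty.image (Gfun S u κ)
  rw [sub_le_iff_le_add]
  refine csSup_le hne ?_
  rintro _ ⟨x, hx, rfl⟩
  rw [← sub_le_iff_le_add']
  refine le_csInf hne ?_
  rintro _ ⟨y, hy, rfl⟩
  linarith [key x hx y hy]
end
end

section
/- Let τ > 0 and f : (−τ,τ) → ℝ≥0 be convex and C² with f(0) = 0, f'(0) = 0, f''(0) > 0. Let 0 ≤ η < 1/16 and let 0 < θ < τ be such that |t| ≤ θ implies ((1−η)/2)f''(0)t² ≤ f(t) ≤ ((1+η)/2)f''(0)t². If Δ > 0 satisfies Δ < ((1 − 4√η)f''(0)/2)θ², then there exists 0 < t₀ < θ such that the line through (0,−Δ) and (t₀, f(t₀)) is tangent to the graph of f at (t₀, f(t₀)), and in this case f(t₀) ≤ ((1+η)/(1−4√η))·Δ. -/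
open MeasureTheory Metric Set Filter
open scoped RealInnerProductSpace Pointwise Topology

noncomputable section

/-- Two-sided quadratic bounds on a convex function bound the Legendre-type expression
`t f'(t) - f(t)` from below, with a free parameter `l`. -/
lemma ConvexOn.quadratic_le_mul_deriv_sub {S : Set ℝ} {f : ℝ → ℝ} (hf : ConvexOn ℝ S f)
    {a η t l : ℝ} (ht : 0 < t) (hl0 : 0 < l) (htS : t ∈ S) (huS : (1 - l) * t ∈ S)
    (hd : DifferentiableAt ℝ f t) (hl1 : l < 1)
    (hlow : (1 - η) / 2 * a * t ^ 2 ≤ f t)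
    (hup : f ((1 - l) * t) ≤ (1 + η) / 2 * a * ((1 - l) * t) ^ 2) :
    a / 2 * t ^ 2 * ((1 - l) * ((1 + η) * l - 2 * η)) ≤ l * (t * deriv f t - f t) := by
  have hlt : (1 - l) * t < t := by nlinarith
  have h := hf.slope_le_deriv huS htS hlt hd
  rw [slope_def_field, show t - (1 - l) * t = l * t by ring, div_le_iff₀ (by positivity)] at h
  have h' := mul_le_mul_of_nonneg_left hlow (sub_nonneg.2 hl1.le)
  linarith

/-- With quadratic bounds up to a relative error `η`, the expression `t f'(t) - f(t)` is at least
`(1 - 4 √η)` times its value for the exact parabola. -/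
lemma ConvexOn.quadratic_le_mul_deriv_sub_sqrt {S : Set ℝ} {f : ℝ → ℝ} (hf : ConvexOn ℝ S f)
    {a η t : ℝ} (ha : 0 < a) (hη0 : 0 ≤ η) (hη : η < 1 / 16) (ht : 0 < t)
    (hS : Icc 0 t ⊆ S) (hd : DifferentiableAt ℝ f t)
    (hb : ∀ u ∈ Icc 0 t, (1 - η) / 2 * a * u ^ 2 ≤ f u ∧ f u ≤ (1 + η) / 2 * a * u ^ 2) :
    (1 - 4 * √η) * a / 2 * t ^ 2 ≤ t * deriv f t - f t := by
  have htI : t ∈ Icc 0 t := ⟨ht.le, le_rfl⟩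
  have key : ∀ l : ℝ, 0 < l → l < 1 →
      a / 2 * t ^ 2 * ((1 - l) * ((1 + η) * l - 2 * η)) ≤ l * (t * deriv f t - f t) := by
    intro l hl0 hl1
    have hu : (1 - l) * t ∈ Icc 0 t := ⟨by nlinarith, by nlinarith⟩
    exact hf.quadratic_le_mul_deriv_sub ht hl0 (hS htI) (hS hu) hd hl1 (hb t htI).1 (hb _ hu).2
  have hc : 0 < a / 2 * t ^ 2 := by positivity
  rcases hη0.eq_or_lt with rfl | hpos
  · have key' : ∀ l : ℝ, 0 < l → l < 1 → a / 2 * t ^ 2 * (1 - l) ≤ t * deriv f t - f t := by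
      intro l hl0 hl1
      refine le_of_mul_le_mul_left ?_ hl0
      linarith [key l hl0 hl1]
    have hlim : Tendsto (fun l : ℝ => a / 2 * t ^ 2 * (1 - l)) (𝓝[>] 0)
        (𝓝 (a / 2 * t ^ 2 * (1 - 0))) :=
      (Continuous.tendsto (by fun_prop) 0).mono_left nhdsWithin_le_nhds
    have h := le_of_tendsto hlim <| by
      filter_upwards [Ioo_mem_nhdsGT (zero_lt_one' ℝ)] with l hl using key' l hl.1 hl.2
    simpa using h
  · have hs : 0 < √η := Real.sqrt_pos.2 hpos
    have hsq : √η ^ 2 = η := Real.sq_sqrt hη0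
    have hs1 : √η < 1 := by nlinarith
    refine le_of_mul_le_mul_left ?_ hs
    refine le_trans ?_ (key _ hs hs1)
    rw [← hsq, Real.sqrt_sq hs.le]
    have h : √η * (1 - 4 * √η) ≤
        (1 - √η) * ((1 + √η ^ 2) * √η - 2 * √η ^ 2) := by
      have h3 : 0 ≤ √η ^ 2 * (1 + 3 * √η - √η ^ 2) := by
        apply mul_nonneg (sq_nonneg _); nlinarith
      nlinarith
    nlinarith [mul_le_mul_of_nonneg_left h hc.le]

/-- Lemma 2.4: a one-dimensional tangency lemma. -/
theorem statement11 (τ : ℝ) (hτ : 0 < τ) (f : ℝ → ℝ)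
    (hconv : ConvexOn ℝ (Ioo (-τ) τ) f)
    (hreg : ContDiffOn ℝ 2 f (Ioo (-τ) τ))
    (hnonneg : ∀ t ∈ Ioo (-τ) τ, 0 ≤ f t)
    (hf0 : f 0 = 0) (hf'0 : deriv f 0 = 0) (hf''0 : 0 < deriv (deriv f) 0)
    (η : ℝ) (hη0 : 0 ≤ η) (hη : η < 1/16)
    (θ : ℝ) (hθ0 : 0 < θ) (hθτ : θ < τ)
    (hθ : ∀ t : ℝ, |t| ≤ θ →
      (1 - η)/2 * deriv (deriv f) 0 * t^2 ≤ f t ∧ f t ≤ (1 + η)/2 * deriv (deriv f) 0 * t^2)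
    (Δ : ℝ) (hΔ0 : 0 < Δ)
    (hΔ : Δ < (1 - 4*Real.sqrt η) * deriv (deriv f) 0 / 2 * θ^2) :
    ∃ t₀ : ℝ, 0 < t₀ ∧ t₀ < θ ∧ deriv f t₀ = (f t₀ + Δ)/t₀ ∧
      f t₀ ≤ (1 + η)/(1 - 4*Real.sqrt η) * Δ := by
  have hI : ∀ t ∈ Icc 0 θ, t ∈ Ioo (-τ) τ := fun t ht =>
    ⟨by linarith [ht.1], by linarith [ht.2]⟩
  have hdiff : ∀ t ∈ Icc 0 θ, DifferentiableAt ℝ f t := fun t ht =>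
    (hreg.differentiableOn (by norm_num)).differentiableAt (isOpen_Ioo.mem_nhds (hI t ht))
  have hcont : ContinuousOn (fun t => t * deriv f t - f t) (Icc 0 θ) :=
    (continuousOn_id.mul ((hreg.continuousOn_deriv_of_isOpen isOpen_Ioo
      (by norm_num)).mono hI)).sub (hreg.continuousOn.mono hI)
  have hbound : ∀ t, 0 < t → t ≤ θ →
      (1 - 4 * √η) * deriv (deriv f) 0 / 2 * t ^ 2 ≤ t * deriv f t - f t := by
    intro t ht htθ
    refine hconv.quadratic_le_mul_deriv_sub_sqrt hf''0 hη0 hη ht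
      (fun u hu => hI u ⟨hu.1, hu.2.trans htθ⟩) (hdiff t ⟨ht.le, htθ⟩) fun u hu => hθ u ?_
    rw [abs_of_nonneg hu.1]
    exact hu.2.trans htθ
  obtain ⟨t₀, ⟨h0, h1⟩, heq⟩ := intermediate_value_Ioo hθ0.le hcont
    (show Δ ∈ Ioo _ _ from ⟨by simpa [hf0] using hΔ0, hΔ.trans_le (hbound θ hθ0 le_rfl)⟩)
  simp only at heq
  refine ⟨t₀, h0, h1, ?_, ?_⟩
  · rw [eq_div_iff h0.ne']
    linarith
  · have hs : 0 < 1 - 4 * √η := by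
      have : √η < 1 / 4 := (Real.sqrt_lt' (by norm_num)).2 (by linarith)
      linarith
    have hb := hbound t₀ h0 h1.le
    rw [heq] at hb
    have hf := (hθ t₀ (by rw [abs_of_pos h0]; exact h1.le)).2
    rw [div_mul_eq_mul_div, le_div_iff₀ hs]
    calc f t₀ * (1 - 4 * √η)
        ≤ (1 + η) / 2 * deriv (deriv f) 0 * t₀ ^ 2 * (1 - 4 * √η) := by gcongr
      _ = (1 + η) * ((1 - 4 * √η) * deriv (deriv f) 0 / 2 * t₀ ^ 2) := by ring
      _ ≤ (1 + η) * Δ := by gcongr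
end
end
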